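/- arXiv:1203.6303 — 3 statements merged into one kernel-verified Lean document; each statement's English description precedes it below -/
import Mathlib

section
/- For every p ∈ ℝ^d, the deterministic values coincide: H̄₊(p) = H̄₋(p). Equivalently, almost surely in ω, inf_{w ∈ SL⁺} esssup_{y} H(p + Dw(y), y, ω) = inf_{w ∈ SL⁻} esssup_{y} H(p + Dw(y), y, ω). -/
open MeasureTheory Filter Topology Bornology
open scoped RealInnerProductSpace NNReal

noncomputable section

/-- Euclidean space ℝ^d. -/
abbrev Ed (d : ℕ) := EuclideanSpace ℝ (Fin d)

/-- The set 𝓛 of globally Lipschitz real-valued functions on ℝ^d. -/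
def LipFuns (d : ℕ) : Set (Ed d → ℝ) := {w | ∃ C : ℝ≥0, LipschitzWith C w}

/-- SL⁺ : Lipschitz functions sublinear from below, i.e. liminf_{|y|→∞} w(y)/|y| ≥ 0. -/
def SLplus (d : ℕ) : Set (Ed d → ℝ) :=
  {w | w ∈ LipFuns d ∧ ∀ ε : ℝ, 0 < ε → ∃ R : ℝ, ∀ y : Ed d, R ≤ ‖y‖ → -ε ≤ w y / ‖y‖}

/-- SL⁻ : Lipschitz functions sublinear from above, i.e. limsup_{|y|→∞} w(y)/|y| ≤ 0. -/
def SLminus (d : ℕ) : Set (Ed d → ℝ) :=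
  {w | w ∈ LipFuns d ∧ ∀ ε : ℝ, 0 < ε → ∃ R : ℝ, ∀ y : Ed d, R ≤ ‖y‖ → w y / ‖y‖ ≤ ε}

/-- 𝓢 : Lipschitz functions strictly sublinear at infinity. -/
def Scal (d : ℕ) : Set (Ed d → ℝ) := SLplus d ∩ SLminus d

/-- H̄₊(p) = inf_{w ∈ SL⁺} esssup_y H(p + Dw(y), y). -/
def HbarPlus (d : ℕ) (H : Ed d → Ed d → ℝ) (p : Ed d) : ℝ :=
  sInf {t | ∃ w ∈ SLplus d, t = essSup (fun y => H (p + gradient w y) y) volume}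

/-- H̄₋(p) = inf_{w ∈ SL⁻} esssup_y H(p + Dw(y), y). -/
def HbarMinus (d : ℕ) (H : Ed d → Ed d → ℝ) (p : Ed d) : ℝ :=
  sInf {t | ∃ w ∈ SLminus d, t = essSup (fun y => H (p + gradient w y) y) volume}

/-- Ĥ(p) = inf_{w ∈ 𝓢} esssup_y H(p + Dw(y), y). -/
def Hhat (d : ℕ) (H : Ed d → Ed d → ℝ) (p : Ed d) : ℝ :=
  sInf {t | ∃ w ∈ Scal d, t = essSup (fun y => H (p + gradient w y) y) volume}

/-- H̄* = inf_{w ∈ 𝓛} esssup_y H(Dw(y), y). -/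
def Hstar (d : ℕ) (H : Ed d → Ed d → ℝ) : ℝ :=
  sInf {t | ∃ w ∈ LipFuns d, t = essSup (fun y => H (gradient w y) y) volume}

/-- m_μ(y,x) = sup { w(y) − w(x) : w ∈ 𝓛, H(Dw,z) ≤ μ a.e. }. -/
def mMu (d : ℕ) (H : Ed d → Ed d → ℝ) (μ : ℝ) (y x : Ed d) : ℝ :=
  sSup {t | ∃ w ∈ LipFuns d, (∀ᵐ z ∂volume, H (gradient w z) z ≤ μ) ∧ t = w y - w x}

/-- Viscosity subsolution of F(Du, y) ≤ μ in U. -/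
def ViscSub (d : ℕ) (F : Ed d → Ed d → ℝ) (μ : ℝ) (U : Set (Ed d)) (u : Ed d → ℝ) : Prop :=
  ∀ (φ : Ed d → ℝ) (x₀ : Ed d), x₀ ∈ U → ContDiffAt ℝ 1 φ x₀ →
    IsLocalMaxOn (fun y => u y - φ y) U x₀ → F (gradient φ x₀) x₀ ≤ μ

/-- Viscosity supersolution of F(Dv, y) ≥ μ in U. -/
def ViscSuper (d : ℕ) (F : Ed d → Ed d → ℝ) (μ : ℝ) (U : Set (Ed d)) (v : Ed d → ℝ) : Prop :=
  ∀ (φ : Ed d → ℝ) (x₀ : Ed d), x₀ ∈ U → ContDiffAt ℝ 1 φ x₀ →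
    IsLocalMinOn (fun y => v y - φ y) U x₀ → μ ≤ F (gradient φ x₀) x₀ 

/-- ω-dependent H̄₊. -/
def HbarPlusOm (d : ℕ) {Ω : Type*} (H : Ed d → Ed d → Ω → ℝ) (p : Ed d) (ω : Ω) : ℝ :=
  sInf {t | ∃ w ∈ SLplus d, t = essSup (fun y => H (p + gradient w y) y ω) volume}

/-- ω-dependent H̄₋. -/
def HbarMinusOm (d : ℕ) {Ω : Type*} (H : Ed d → Ed d → Ω → ℝ) (p : Ed d) (ω : Ω) : ℝ :=
  sInf {t | ∃ w ∈ SLminus d, t = essSup (fun y => H (p + gradient w y) y ω) volume}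

/-- ω-dependent Ĥ. -/
def HhatOm (d : ℕ) {Ω : Type*} (H : Ed d → Ed d → Ω → ℝ) (p : Ed d) (ω : Ω) : ℝ :=
  sInf {t | ∃ w ∈ Scal d, t = essSup (fun y => H (p + gradient w y) y ω) volume}

/-- ω-dependent H̄*. -/
def HstarOm (d : ℕ) {Ω : Type*} (H : Ed d → Ed d → Ω → ℝ) (ω : Ω) : ℝ :=
  sInf {t | ∃ w ∈ LipFuns d, t = essSup (fun y => H (gradient w y) y ω) volume}

/-- ω-dependent metric problem solution m_μ(y,x,ω). -/
def mMuOm (d : ℕ) {Ω : Type*} (H : Ed d → Ed d → Ω → ℝ) (μ : ℝ) (y x : Ed d) (ω : Ω) : ℝ :=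
  sSup {t | ∃ w ∈ LipFuns d, (∀ᵐ z ∂volume, H (gradient w z) z ω ≤ μ) ∧ t = w y - w x}

lemma aux_sub_step {d : ℕ} {u : Ed d → ℝ} {C : ℝ≥0} (hu : LipschitzWith C u) (x v : Ed d) (a : ℝ)
    (S : Set (Ed d)) (δ : ℝ) (hδ : 0 < δ)
    (hS : ∀ t ∈ Set.Icc (0:ℝ) 1, ∀ s : Ed d, ‖s‖ < δ → s + (x + t • v) ∈ S)
    (h : ∀ᵐ z ∂(volume : Measure (Ed d)), z ∈ S → ⟪gradient u z, v⟫ ≤ a) : u (x + v) - u x ≤ a := by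
  by_contra hlt
  push Not at hlt
  obtain ⟨η, hη, hη2⟩ : ∃ η > 0, a + η < u (x + v) - u x :=
    ⟨(u (x + v) - u x - a) / 2, by linarith, by linarith⟩
  have hcont := hu.continuous
  have hg : Continuous fun s : Ed d => u (s + (x + (1:ℝ) • v)) - u (s + (x + (0:ℝ) • v)) := by fun_prop
  have hev : ∀ᶠ s in 𝓝 (0 : Ed d), a + η < u (s + (x + (1:ℝ) • v)) - u (s + (x + (0:ℝ) • v)) := by
    apply hg.continuousAt.eventually (p := fun r => a + η < r)
    apply lt_mem_nhds
    simpa using hη2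
  obtain ⟨δ₁, hδ₁, hb⟩ := Metric.eventually_nhds_iff.1 hev
  set δ' := min δ δ₁ with hδ'
  have hδ'pos : 0 < δ' := lt_min hδ hδ₁
  set B : Set (Ed d) := Metric.ball 0 δ' with hB
  have hBm : MeasurableSet B := measurableSet_ball
  set μ := (volume : Measure (Ed d)).restrict B with hμ
  have : IsFiniteMeasure μ := ⟨by
    rw [hμ, Measure.restrict_apply_univ]; exact measure_ball_lt_top⟩
  have hμpos : 0 < μ.real Set.univ := by
    rw [measureReal_def, hμ, Measure.restrict_apply_univ]
    exact ENNReal.toReal_pos (Metric.measure_ball_pos _ _ hδ'pos).ne' measure_ball_lt_top.ne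
  have hintg : ∀ t : ℝ, Integrable (fun s => u (s + (x + t • v))) μ := by
    intro t
    have h1 : IntegrableOn (fun s => u (s + (x + t • v))) (Metric.closedBall (0 : Ed d) δ') volume := by
      apply ContinuousOn.integrableOn_compact (isCompact_closedBall _ _)
      exact (by fun_prop : Continuous fun s => u (s + (x + t • v))).continuousOn
    exact h1.mono_set Metric.ball_subset_closedBall
  have hae : ∀ (t : ℝ) (p : Ed d → Prop), (∀ᵐ z ∂(volume : Measure (Ed d)), p z) →
      ∀ᵐ s ∂μ, p (s + (x + t • v)) := by
    intro t p hp
    exact ae_restrict_of_ae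
      ((measurePreserving_add_right volume (x + t • v)).quasiMeasurePreserving.ae hp)
  have hder : ∀ t : ℝ, Integrable (fun s => fderiv ℝ u (s + (x + t • v)) v) μ ∧
      HasDerivAt (fun t : ℝ => ∫ s, u (s + (x + t • v)) ∂μ)
      (∫ s, fderiv ℝ u (s + (x + t • v)) v ∂μ) t := by
    intro t
    refine hasDerivAt_integral_of_dominated_loc_of_lip (s := Set.univ)
      (bound := fun _ => (C : ℝ) * ‖v‖) Filter.univ_mem ?_ (hintg t) ?_ ?_ (integrable_const _) ?_
    · exact Filter.Eventually.of_forall fun t => (hintg t).aestronglyMeasurable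
    · apply Measurable.aestronglyMeasurable
      exact (measurable_fderiv_apply_const ℝ u v).comp (by fun_prop)
    · refine Filter.Eventually.of_forall fun s => ?_
      apply LipschitzWith.lipschitzOnWith
      apply LipschitzWith.of_dist_le_mul
      intro t₁ t₂
      refine (hu.dist_le_mul _ _).trans ?_
      rw [dist_add_left, dist_add_left, dist_eq_norm, ← sub_smul, norm_smul, Real.coe_nnabs,
        abs_of_nonneg (by positivity), dist_eq_norm]
      exact le_of_eq (by ring)
    · filter_upwards [hae t _ (hu.ae_differentiableAt (μ := volume))] with s hs
      have h2 : HasDerivAt (fun t : ℝ => s + (x + t • v)) v t := by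
        simpa using (((hasDerivAt_id t).smul_const v).const_add x).const_add s
      exact hs.hasFDerivAt.comp_hasDerivAt t h2
  obtain ⟨c, hc, hc2⟩ := exists_hasDerivAt_eq_slope (fun t : ℝ => ∫ s, u (s + (x + t • v)) ∂μ)
    (fun t => ∫ s, fderiv ℝ u (s + (x + t • v)) v ∂μ) (zero_lt_one' ℝ)
    (fun t _ => (hder t).2.continuousAt.continuousWithinAt) (fun t _ => (hder t).2)
  simp only [sub_zero, div_one] at hc2
  have h3 : ∫ s, fderiv ℝ u (s + (x + c • v)) v ∂μ ≤ ∫ s, a ∂μ := by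
    apply integral_mono_ae (hder c).1 (integrable_const _)
    have h4 : ∀ᵐ s ∂μ, s ∈ B := ae_restrict_mem hBm
    filter_upwards [hae c _ h, h4] with s hs hsB
    have := hs (hS c ⟨hc.1.le, hc.2.le⟩ s (by
      rw [hB, mem_ball_zero_iff] at hsB
      exact hsB.trans_le (min_le_left _ _)))
    rwa [gradient, InnerProductSpace.toDual_symm_apply] at this
  have h5 : ∫ s, (a + η) ∂μ ≤ ∫ s, (u (s + (x + (1:ℝ) • v)) - u (s + (x + (0:ℝ) • v))) ∂μ := by
    apply integral_mono_ae (integrable_const _) ((hintg 1).sub (hintg 0))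
    have h4 : ∀ᵐ s ∂μ, s ∈ B := ae_restrict_mem hBm
    filter_upwards [h4] with s hsB
    apply (hb _).le
    rw [hB, Metric.mem_ball] at hsB
    exact hsB.trans_le (min_le_right _ _)
  rw [integral_sub (hintg 1) (hintg 0), ← hc2] at h5
  have h6 := h5.trans h3
  rw [integral_const, integral_const, smul_eq_mul, smul_eq_mul] at h6
  nlinarith

lemma aux_sep {E : Type*} [NormedAddCommGroup E] [InnerProductSpace ℝ E] [ProperSpace E]
    (K : Set E) (hK : IsClosed K) (hne : K.Nonempty)
    (hmid : ∀ p ∈ K, ∀ q ∈ K, (1/2 : ℝ) • (p + q) ∈ K) (b : E) (hb : b ∉ K) :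
    ∃ (v : E) (c : ℝ), (∀ q ∈ K, ⟪q, v⟫ ≤ c) ∧ c < ⟪b, v⟫ := by
  obtain ⟨q0, hq0, hmin⟩ := hK.exists_infDist_eq_dist hne b
  have hmin' : ∀ q ∈ K, ‖b - q0‖ ≤ ‖b - q‖ := by
    intro q hq
    rw [← dist_eq_norm, ← dist_eq_norm, ← hmin]
    exact Metric.infDist_le_dist_of_mem hq
  refine ⟨b - q0, ⟪q0, b - q0⟫, ?_, ?_⟩
  · intro q hq
    have hk : ∀ n : ℕ, q0 + ((1/2 : ℝ)^n) • (q - q0) ∈ K := by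
      intro n
      induction n with
      | zero => simpa using hq
      | succ n ih =>
        have := hmid _ hq0 _ ih
        convert this using 1
        rw [pow_succ]
        module
    by_contra hcon
    push Not at hcon
    have hpos : 0 < ⟪q - q0, b - q0⟫ := by rw [inner_sub_left]; linarith
    have hineq : ∀ n : ℕ, 2 * ⟪q - q0, b - q0⟫ ≤ (1/2 : ℝ)^n * ‖q - q0‖^2 := by
      intro n
      have h1 := hmin' _ (hk n)
      have h2 : b - (q0 + ((1/2 : ℝ)^n) • (q - q0)) = (b - q0) - ((1/2 : ℝ)^n) • (q - q0) := by abel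
      rw [h2] at h1
      have h3 := pow_le_pow_left₀ (norm_nonneg _) h1 2
      rw [norm_sub_sq_real (b - q0) (((1/2 : ℝ)^n) • (q - q0)), norm_smul, inner_smul_right,
        real_inner_comm] at h3
      have hp : 0 < (1/2 : ℝ)^n := by positivity
      rw [Real.norm_of_nonneg hp.le] at h3
      have h4 : (1/2 : ℝ)^n * (2 * ⟪q - q0, b - q0⟫) ≤ (1/2 : ℝ)^n * ((1/2 : ℝ)^n * ‖q - q0‖^2) := by
        nlinarith
      exact le_of_mul_le_mul_left h4 hp
    have hlim : Tendsto (fun n : ℕ => (1/2 : ℝ)^n * ‖q - q0‖^2) atTop (𝓝 (0 * ‖q - q0‖^2)) :=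
      (tendsto_pow_atTop_nhds_zero_of_lt_one (by norm_num) (by norm_num)).mul_const _
    have := ge_of_tendsto' hlim hineq
    linarith
  · have hne : b - q0 ≠ 0 := by
      intro h
      rw [sub_eq_zero] at h
      exact hb (h ▸ hq0)
    have : 0 < ⟪b - q0, b - q0⟫ := real_inner_self_pos.2 hne
    rw [inner_sub_left] at this
    linarith
/-- lattice box -/
def aux_box (d : ℕ) (c : Fin d → ℤ) (k : ℕ) : Finset (Fin d → ℤ) :=
  Finset.Icc (fun i => c i - k) (fun i => c i + k)

lemma aux_box_card (d : ℕ) (c : Fin d → ℤ) (k : ℕ) : (aux_box d c k).card = (2 * k + 1) ^ d := by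
  rw [aux_box, Pi.card_Icc]
  simp only [Int.card_Icc]
  rw [Finset.prod_congr rfl (g := fun _ => 2 * k + 1)]
  · simp
  · intro i _
    omega

lemma aux_mem_box {d : ℕ} {c z : Fin d → ℤ} {k : ℕ} : z ∈ aux_box d c k ↔ dist z c ≤ k := by
  rw [aux_box, Finset.mem_Icc, dist_pi_le_iff (by positivity), Pi.le_def, Pi.le_def, ← forall_and]
  refine forall_congr' fun i => ?_
  rw [Int.dist_eq]
  rw [abs_le, ← Int.cast_sub]
  have h1 : (-(k:ℝ) ≤ ((z i - c i : ℤ) : ℝ)) ↔ -(k:ℤ) ≤ z i - c i := by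
    rw [← Int.cast_natCast (R := ℝ), ← Int.cast_neg, Int.cast_le]
  have h2 : (((z i - c i : ℤ) : ℝ) ≤ (k : ℝ)) ↔ z i - c i ≤ (k:ℤ) := by
    rw [← Int.cast_natCast (R := ℝ), Int.cast_le]
  rw [h1, h2]
  constructor <;> rintro ⟨h, h'⟩ <;> constructor <;> linarith

/-- deterministic covering count -/
lemma aux_count (d : ℕ) (k N : ℕ) (hk : 0 < k) (bad : (Fin d → ℤ) → Prop) :
    Set.encard {x : Fin d → ℤ | x ∈ aux_box d 0 N ∧ ∃ (y : Fin d → ℤ) (m : ℕ), m ≤ N ∧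
      dist y 0 ≤ m ∧ ∀ z ∈ aux_box d y (m / k), bad (z + x)} ≤
    (10 * k : ℕ) ^ d * Set.encard {x : Fin d → ℤ | x ∈ aux_box d 0 (3 * N) ∧ bad x} := by
  classical
  set t : Set (Fin d → ℤ) := {x : Fin d → ℤ | x ∈ aux_box d 0 N ∧ ∃ (y : Fin d → ℤ) (m : ℕ), m ≤ N ∧
      dist y 0 ≤ m ∧ ∀ z ∈ aux_box d y (m / k), bad (z + x)} with ht
  have htf : t.Finite := (Finset.finite_toSet (aux_box d 0 N)).subset fun x hx => hx.1
  have hch : ∀ x : Fin d → ℤ, ∃ (y : Fin d → ℤ) (m : ℕ), x ∈ t → (m ≤ N ∧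
      dist y 0 ≤ m ∧ ∀ z ∈ aux_box d y (m / k), bad (z + x)) := by
    intro x
    by_cases hx : x ∈ t
    · obtain ⟨_, y, m, h⟩ := hx
      exact ⟨y, m, fun _ => h⟩
    · exact ⟨0, 0, fun h => absurd h hx⟩
  choose Y M hYM using hch
  obtain ⟨u, hut, hdisj, hcov⟩ := Vitali.exists_disjoint_subfamily_covering_enlargement_closedBall t
    (fun x => Y x + x) (fun x => (M x : ℝ)) N (fun a ha => by exact_mod_cast (hYM a ha).1) 5 (by norm_num)
  have huf : u.Finite := htf.subset hut
  set U := huf.toFinset with hU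
  have hmemU : ∀ b, b ∈ U ↔ b ∈ u := fun b => huf.mem_toFinset
  set G : Finset (Fin d → ℤ) := (aux_box d 0 (3 * N)).filter bad with hG
  have hGe : {x : Fin d → ℤ | x ∈ aux_box d 0 (3 * N) ∧ bad x} = (G : Set (Fin d → ℤ)) := by
    ext x; simp [hG]
  set T := htf.toFinset with hT
  have hTe : t = (T : Set (Fin d → ℤ)) := by simp [hT]
  rw [hGe, hTe, Set.encard_coe_eq_coe_finsetCard, Set.encard_coe_eq_coe_finsetCard]
  have hmain : T.card ≤ (10 * k) ^ d * G.card := by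
    have h1 : T ⊆ U.biUnion fun b => aux_box d (Y b + b) (5 * M b) := by
      intro x hx
      have hxt : x ∈ t := by rw [hTe]; exact hx
      obtain ⟨b, hb, hsub⟩ := hcov x hxt
      rw [Finset.mem_biUnion]
      refine ⟨b, (hmemU b).2 hb, aux_mem_box.2 ?_⟩
      have : x ∈ Metric.closedBall (Y x + x) (M x : ℝ) := by
        rw [Metric.mem_closedBall, dist_comm]
        have := (hYM x hxt).2.1
        calc dist (Y x + x) x = dist (Y x + x) (0 + x) := by rw [zero_add]
          _ = dist (Y x) 0 := dist_add_right _ _ _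
          _ ≤ _ := this
      have := hsub this
      rw [Metric.mem_closedBall] at this
      push_cast
      exact this
    have h2 : (U.biUnion fun b => aux_box d (Y b + b) (M b / k)) ⊆ G := by
      intro z hz
      rw [Finset.mem_biUnion] at hz
      obtain ⟨b, hb, hz⟩ := hz
      have hbu := hut ((hmemU b).1 hb)
      obtain ⟨g1, g2, g3⟩ := hYM b hbu
      rw [hG, Finset.mem_filter]
      have hz' := aux_mem_box.1 hz
      constructor
      · rw [aux_mem_box]
        have e1 : dist b 0 ≤ (N:ℝ) := aux_mem_box.1 hbu.1
        have e2 : dist (Y b + b) b ≤ (M b : ℝ) := by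
          calc dist (Y b + b) b = dist (Y b + b) (0 + b) := by rw [zero_add]
            _ = dist (Y b) 0 := dist_add_right _ _ _
            _ ≤ _ := g2
        have e3 : ((M b / k : ℕ) : ℝ) ≤ N := by exact_mod_cast (Nat.div_le_self _ _).trans g1
        have e4 : (M b : ℝ) ≤ N := by exact_mod_cast g1
        have := dist_triangle4 z (Y b + b) b 0
        push_cast
        linarith
      · have := g3 (z - b) (by
          rw [aux_mem_box]
          calc dist (z - b) (Y b) = dist (z - b + b) (Y b + b) := (dist_add_right _ _ _).symm
            _ = dist z (Y b + b) := by rw [sub_add_cancel]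
            _ ≤ _ := hz')
        rwa [sub_add_cancel] at this
    have h3 : (U.biUnion fun b => aux_box d (Y b + b) (M b / k)).card
        = ∑ b ∈ U, (aux_box d (Y b + b) (M b / k)).card := by
      apply Finset.card_biUnion
      intro a ha b hb hab
      rw [Function.onFun, Finset.disjoint_left]
      intro z hza hzb
      have := hdisj ((hmemU a).1 ha) ((hmemU b).1 hb) hab
      have e : ∀ a : Fin d → ℤ, ((M a / k : ℕ) : ℝ) ≤ M a := fun a => by
        exact_mod_cast (Nat.div_le_self _ _)
      exact Set.disjoint_left.1 this ((aux_mem_box.1 hza).trans (e a)) ((aux_mem_box.1 hzb).trans (e b))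
    calc T.card ≤ _ := Finset.card_le_card h1
      _ ≤ ∑ b ∈ U, (aux_box d (Y b + b) (5 * M b)).card := Finset.card_biUnion_le
      _ ≤ ∑ b ∈ U, (10 * k) ^ d * (aux_box d (Y b + b) (M b / k)).card := by
        apply Finset.sum_le_sum
        intro b _
        rw [aux_box_card, aux_box_card, ← mul_pow]
        apply Nat.pow_le_pow_left
        have := Nat.lt_mul_div_succ (M b) hk
        generalize M b / k = e at *
        have h0 : 0 ≤ k * e := Nat.zero_le _
        rw [mul_add, mul_one] at this
        calc 2 * (5 * M b) + 1 ≤ 10 * (k * e + k) := by omega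
          _ ≤ 10 * (k * e + k) + 10 * (k * e) := Nat.le_add_right _ _
          _ = 10 * k * (2 * e + 1) := by ring
      _ = (10 * k) ^ d * ∑ b ∈ U, (aux_box d (Y b + b) (M b / k)).card := by rw [Finset.mul_sum]
      _ ≤ _ := by
        rw [← h3]
        exact Nat.mul_le_mul_left _ (Finset.card_le_card h2)
  exact_mod_cast hmain

/-- maximal inequality -/
lemma aux_maximal (d : ℕ) {Ω : Type*} [MeasurableSpace Ω] (P : Measure Ω) [IsProbabilityMeasure P]
    (T : (Fin d → ℤ) → Ω → Ω) (hT : ∀ z, MeasurePreserving (T z) P P)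
    (hadd : ∀ x y, T (x + y) = T x ∘ T y)
    (B : Set Ω) (hB : MeasurableSet B) (k N : ℕ) (hk : 0 < k) :
    P {ω | ∃ (y : Fin d → ℤ) (m : ℕ), m ≤ N ∧ dist y 0 ≤ m ∧
      ∀ z ∈ aux_box d y (m / k), T z ω ∈ B} ≤ ((30 * k) ^ d : ℕ) * P B := by
  classical
  set F := {ω | ∃ (y : Fin d → ℤ) (m : ℕ), m ≤ N ∧ dist y 0 ≤ m ∧
      ∀ z ∈ aux_box d y (m / k), T z ω ∈ B} with hF
  have hFm : MeasurableSet F := by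
    have : F = ⋃ (y : Fin d → ℤ) (m : ℕ) (_ : m ≤ N) (_ : dist y 0 ≤ m),
        ⋂ z ∈ aux_box d y (m / k), T z ⁻¹' B := by
      ext ω; simp only [hF, Set.mem_iUnion, Set.mem_iInter, Set.mem_preimage, Set.mem_ofPred_eq, exists_prop]
    rw [this]
    refine MeasurableSet.iUnion fun y => MeasurableSet.iUnion fun m => MeasurableSet.iUnion fun _ =>
      MeasurableSet.iUnion fun _ => Finset.measurableSet_biInter _ fun z _ => (hT z).measurable hB
  have hsum : ∀ (A : Set Ω), MeasurableSet A → ∀ n : ℕ,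
      ∫⁻ ω, ∑ x ∈ aux_box d 0 n, A.indicator (fun _ => (1 : ENNReal)) (T x ω) ∂P
        = ((2 * n + 1) ^ d : ℕ) * P A := by
    intro A hA n
    rw [lintegral_finsetSum]
    · rw [Finset.sum_congr rfl (g := fun _ => P A), Finset.sum_const, aux_box_card, nsmul_eq_mul]
      intro x _
      rw [(hT x).lintegral_comp (measurable_const.indicator hA), lintegral_indicator_const hA, one_mul]
    · intro x _
      exact (measurable_const.indicator hA).comp (hT x).measurable
  have hcnt : ∀ (A : Set Ω) (n : ℕ) (ω : Ω),
      ∑ x ∈ aux_box d 0 n, A.indicator (fun _ => (1 : ENNReal)) (T x ω)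
        = (((Set.encard {x : Fin d → ℤ | x ∈ aux_box d 0 n ∧ T x ω ∈ A} : ℕ∞)) : ENNReal) := by
    intro A n ω
    have : {x : Fin d → ℤ | x ∈ aux_box d 0 n ∧ T x ω ∈ A}
      = (((aux_box d 0 n).filter fun x => T x ω ∈ A : Finset (Fin d → ℤ)) : Set (Fin d → ℤ)) := by
      ext x; simp
    rw [this, Set.encard_coe_eq_coe_finsetCard]
    simp only [Set.indicator_apply, Finset.sum_boole]
    simp
  have hle : ∫⁻ ω, ∑ x ∈ aux_box d 0 N, F.indicator (fun _ => (1 : ENNReal)) (T x ω) ∂P ≤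
      ∫⁻ ω, ((10 * k) ^ d : ℕ) * ∑ x ∈ aux_box d 0 (3 * N), B.indicator (fun _ => (1 : ENNReal)) (T x ω) ∂P := by
    apply lintegral_mono
    intro ω
    simp only
    rw [hcnt, hcnt]
    have := aux_count d k N hk (fun x => T x ω ∈ B)
    have h2 : {x : Fin d → ℤ | x ∈ aux_box d 0 N ∧ T x ω ∈ F} = {x : Fin d → ℤ | x ∈ aux_box d 0 N ∧ ∃ (y : Fin d → ℤ) (m : ℕ), m ≤ N ∧
      dist y 0 ≤ m ∧ ∀ z ∈ aux_box d y (m / k), T (z + x) ω ∈ B} := by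
      ext x
      simp only [hF, Set.mem_ofPred_eq, hadd, Function.comp]
    rw [h2]
    have h3 := ENat.toENNReal_le.2 this
    simpa using h3
  rw [lintegral_const_mul' _ _ (ENNReal.natCast_ne_top _), hsum F hFm, hsum B hB] at hle
  have hpos : (((2 * N + 1) ^ d : ℕ) : ENNReal) ≠ 0 := by
    exact_mod_cast (pow_pos (Nat.succ_pos _) d).ne'
  have h5 : ((10 * k) ^ d : ℕ) * ((((2 * (3 * N) + 1) ^ d : ℕ) : ENNReal) * P B) ≤
      (((2 * N + 1) ^ d : ℕ) : ENNReal) * (((30 * k) ^ d : ℕ) * P B) := by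
    rw [← mul_assoc (((10 * k) ^ d : ℕ) : ENNReal), ← mul_assoc (((2 * N + 1) ^ d : ℕ) : ENNReal), ← Nat.cast_mul, ← Nat.cast_mul]
    refine mul_le_mul_left ?_ _
    rw [Nat.cast_le, ← mul_pow, ← mul_pow]
    apply Nat.pow_le_pow_left
    nlinarith
  exact (ENNReal.mul_le_mul_iff_right hpos (ENNReal.natCast_ne_top _)).1 (hle.trans h5)
/-- rational points -/
def aux_j {d : ℕ} (x : Fin d → ℚ) : Ed d := WithLp.toLp 2 (fun i => (x i : ℝ))

lemma aux_j_add {d : ℕ} (x y : Fin d → ℚ) : aux_j (x + y) = aux_j x + aux_j y := by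
  ext i; simp [aux_j]

lemma aux_j_zero {d : ℕ} : aux_j (0 : Fin d → ℚ) = 0 := by
  ext i; simp [aux_j]

lemma aux_j_inj {d : ℕ} : Function.Injective (aux_j (d := d)) := by
  intro x y h
  funext i
  have := congrArg (fun z : Ed d => z i) h
  simpa [aux_j] using this

lemma aux_j_dense {d : ℕ} : DenseRange (aux_j (d := d)) := by
  have h1 : DenseRange (fun (x : Fin d → ℚ) (i : Fin d) => (x i : ℝ)) :=
    DenseRange.piMap (fun _ => Rat.denseRange_cast)
  have h2 : Function.Surjective (WithLp.toLp 2 : (Fin d → ℝ) → Ed d) := WithLp.toLp_surjective 2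
  exact h2.denseRange.comp h1 (PiLp.continuous_toLp 2 _)

/-- admissible step -/
def aux_Adm {d : ℕ} (H : Ed d → Ed d → ℝ) (L r t1 : ℝ) (x x' : Fin d → ℚ) (a : ℚ) : Prop :=
  L * ‖aux_j x' - aux_j x‖ ≤ a ∨ (‖aux_j x' - aux_j x‖ < r ∧
    ∀ q : Fin d → ℚ, H (aux_j q) (aux_j x) < t1 → ⟪aux_j q, aux_j x' - aux_j x⟫ ≤ (a : ℝ))

/-- chains of admissible steps with total cost s -/
def aux_chain {d : ℕ} (H : Ed d → Ed d → ℝ) (L r t1 : ℝ) :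
    ℕ → (Fin d → ℚ) → (Fin d → ℚ) → ℚ → Prop
  | 0, x, y, s => x = y ∧ s = 0
  | n + 1, x, y, s => ∃ (x' : Fin d → ℚ) (a : ℚ), aux_Adm H L r t1 x x' a ∧
      aux_chain H L r t1 n x' y (s - a)

lemma aux_chain_meas {d : ℕ} {Ω : Type*} [MeasurableSpace Ω] (H : Ed d → Ed d → Ω → ℝ)
    (hH : ∀ q y, Measurable (H q y)) (L r t1 : ℝ) (n : ℕ) (x y : Fin d → ℚ) (s : ℚ) :
    MeasurableSet {ω | aux_chain (fun q y => H q y ω) L r t1 n x y s} := by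
  induction n generalizing x s with
  | zero => simp only [aux_chain]; exact MeasurableSet.const _
  | succ n ih =>
    simp only [aux_chain]
    have : {ω | ∃ (x' : Fin d → ℚ) (a : ℚ), aux_Adm (fun q y => H q y ω) L r t1 x x' a ∧
      aux_chain (fun q y => H q y ω) L r t1 n x' y (s - a)} =
      ⋃ (x' : Fin d → ℚ) (a : ℚ), ({ω | aux_Adm (fun q y => H q y ω) L r t1 x x' a} ∩
        {ω | aux_chain (fun q y => H q y ω) L r t1 n x' y (s - a)}) := by
      ext ω; simp
    rw [this]
    refine MeasurableSet.iUnion fun x' => MeasurableSet.iUnion fun a =>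
      MeasurableSet.inter ?_ (ih _ _)
    have h2 : {ω | aux_Adm (fun q y => H q y ω) L r t1 x x' a} =
      {ω | L * ‖aux_j x' - aux_j x‖ ≤ a} ∪ ({ω | ‖aux_j x' - aux_j x‖ < r} ∩
        ⋂ q : Fin d → ℚ, ({ω | H (aux_j q) (aux_j x) ω < t1}ᶜ ∪ {ω | ⟪aux_j q, aux_j x' - aux_j x⟫ ≤ (a : ℝ)})) := by
      ext ω
      simp only [aux_Adm, Set.mem_union, Set.mem_inter_iff, Set.mem_iInter, Set.mem_compl_iff,
        Set.mem_ofPred_eq, imp_iff_not_or]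
    rw [h2]
    refine (MeasurableSet.const _).union ((MeasurableSet.const _).inter
      (MeasurableSet.iInter fun q => MeasurableSet.union ?_ (MeasurableSet.const _)))
    exact (measurableSet_lt (hH _ _) measurable_const).compl

lemma aux_chain_shift {d : ℕ} (H H' : Ed d → Ed d → ℝ) (z : Fin d → ℚ)
    (h : ∀ q y, H' q y = H q (y + aux_j z)) (L r t1 : ℝ) (n : ℕ) (x y : Fin d → ℚ) (s : ℚ) :
    aux_chain H L r t1 n (x + z) (y + z) s → aux_chain H' L r t1 n x y s := by
  induction n generalizing x s with
  | zero => simp [aux_chain]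
  | succ n ih =>
    rintro ⟨x', a, hA, hC⟩
    refine ⟨x' - z, a, ?_, ih _ _ (by rwa [sub_add_cancel])⟩
    have e : aux_j x' - aux_j (x + z) = aux_j (x' - z) - aux_j x := by
      have : x' = (x' - z) + z := by simp
      conv_lhs => rw [this]
      rw [aux_j_add, aux_j_add]; abel
    unfold aux_Adm at hA ⊢
    rw [e] at hA
    simp only [h]
    rw [← aux_j_add]
    exact hA

lemma aux_sub_chain {d : ℕ} (H : Ed d → Ed d → ℝ) (L r t0 t1 : ℝ)
    (hHc : ∀ x, Continuous fun q => H q x)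
    (hL : ∀ q y, H q y ≤ t0 → ‖q‖ ≤ L)
    (hr : ∀ q x z, ‖q‖ ≤ L → ‖z - x‖ < r → H q z ≤ t0 → H q x < t1)
    {u : Ed d → ℝ} {C : ℝ≥0} (hu : LipschitzWith C u)
    (hsub : ∀ᵐ z ∂(volume : Measure (Ed d)), H (gradient u z) z ≤ t0)
    (n : ℕ) (x y : Fin d → ℚ) (s : ℚ) (hc : aux_chain H L r t1 n x y s) :
    u (aux_j y) - u (aux_j x) ≤ s := by
  induction n generalizing x s with
  | zero =>
    obtain ⟨rfl, rfl⟩ := hc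
    simp
  | succ n ih =>
    obtain ⟨x', a, hA, hC⟩ := hc
    have h1 := ih _ _ hC
    have h2 : u (aux_j x') - u (aux_j x) ≤ a := by
      set v := aux_j x' - aux_j x with hv
      have e : aux_j x' = aux_j x + v := by rw [hv]; abel
      rw [e]
      rcases hA with hA | ⟨hA1, hA2⟩
      · refine aux_sub_step hu _ _ _ Set.univ 1 one_pos (fun _ _ _ _ => Set.mem_univ _) ?_
        filter_upwards [hsub] with z hz _
        calc ⟪gradient u z, v⟫ ≤ ‖gradient u z‖ * ‖v‖ := real_inner_le_norm _ _
          _ ≤ L * ‖v‖ := by gcongr; exact hL _ _ hz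
          _ ≤ a := hA
      · refine aux_sub_step hu _ _ _ (Metric.ball (aux_j x) r) (r - ‖v‖) (by linarith) ?_ ?_
        · intro t ht s hs
          rw [mem_ball_iff_norm]
          have : s + (aux_j x + t • v) - aux_j x = s + t • v := by abel
          rw [this]
          calc ‖s + t • v‖ ≤ ‖s‖ + ‖t • v‖ := norm_add_le _ _
            _ ≤ ‖s‖ + ‖v‖ := by
              rw [norm_smul, Real.norm_of_nonneg ht.1]
              have := mul_le_mul_of_nonneg_right ht.2 (norm_nonneg v)
              linarith
            _ < r := by linarith
        · filter_upwards [hsub] with z hz hzb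
          have hlt : H (gradient u z) (aux_j x) < t1 :=
            hr _ _ _ (hL _ _ hz) (mem_ball_iff_norm.1 hzb) hz
          by_contra hcon
          push Not at hcon
          have hopen : IsOpen {q : Ed d | H q (aux_j x) < t1 ∧ (a : ℝ) < ⟪q, v⟫} := by
            apply IsOpen.and
            · exact isOpen_lt (hHc _) continuous_const
            · exact isOpen_lt continuous_const (by fun_prop)
          obtain ⟨q, hq⟩ := aux_j_dense.exists_mem_open hopen ⟨_, hlt, hcon⟩
          exact absurd (hA2 q hq.1) (not_le.2 hq.2)
    push_cast at h1
    linarith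

lemma aux_le_of_rat {b c : ℝ} (h : ∀ a : ℚ, c ≤ a → b ≤ a) : b ≤ c := by
  by_contra hcon
  push Not at hcon
  obtain ⟨a, h1, h2⟩ := exists_rat_btwn hcon
  exact absurd (h a h1.le) (not_le.2 h2)

lemma aux_construct {d : ℕ} (H : Ed d → Ed d → ℝ) (L r t0 t1 t : ℝ) (hL0 : 0 ≤ L)
    (hr0 : 0 < r) (h01 : t0 ≤ t) (h1t : t1 ≤ t)
    (hHc : ∀ x, Continuous fun q => H q x)
    (hL : ∀ q y, H q y ≤ t → ‖q‖ ≤ L)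
    (hr : ∀ q x z, ‖q‖ ≤ L → ‖z - x‖ < r → H q z ≤ t0 → H q x < t1)
    (hr2 : ∀ q x z, ‖q‖ ≤ L → ‖z - x‖ < r → H q z < t1 → H q x ≤ t)
    (hqc : ∀ p q y, H ((1/2 : ℝ) • (p + q)) y ≤ max (H p y) (H q y))
    {u : Ed d → ℝ} {C : ℝ≥0} (hu : LipschitzWith C u)
    (hsub : ∀ᵐ z ∂(volume : Measure (Ed d)), H (gradient u z) z ≤ t0) :
    ∃ w : Ed d → ℝ, (∃ C : ℝ≥0, LipschitzWith C w) ∧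
      (∀ᵐ z ∂(volume : Measure (Ed d)), H (gradient w z) z ≤ t) ∧
      ∀ (y : Fin d → ℚ) (c : ℝ), (∀ n s, aux_chain H L r t1 n y 0 s → -c ≤ s) → w (aux_j y) ≤ c := by
  classical
  have hlow := aux_sub_chain H L r t0 t1 hHc (fun q y h => hL q y (h.trans h01)) hr hu hsub
  set S : (Fin d → ℚ) → Set ℝ := fun y => {b | ∃ n s, aux_chain H L r t1 n y 0 s ∧ b = -(s : ℝ)} with hS
  have hbdd : ∀ y, BddAbove (S y) := by
    intro y
    refine ⟨u (aux_j y) - u (aux_j 0), ?_⟩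
    rintro b ⟨n, s, hc, rfl⟩
    have := hlow n y 0 s hc
    linarith
  have hne : ∀ y, (S y).Nonempty := by
    intro y
    obtain ⟨a, ha⟩ := exists_rat_gt (L * ‖aux_j 0 - aux_j y‖)
    exact ⟨-(a : ℝ), 1, a, ⟨0, a, Or.inl ha.le, by simp [aux_chain]⟩, rfl⟩
  set W : (Fin d → ℚ) → ℝ := fun y => sSup (S y) with hW
  have hstep : ∀ x x' a, aux_Adm H L r t1 x x' a → W x' - W x ≤ a := by
    intro x x' a hA
    have : W x' ≤ W x + a := by
      apply csSup_le (hne x')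
      rintro b ⟨n, s, hc, rfl⟩
      have : -((s + a : ℚ) : ℝ) ≤ W x := by
        apply le_csSup (hbdd x)
        exact ⟨n + 1, s + a, ⟨x', a, hA, by simpa using hc⟩, rfl⟩
      push_cast at this
      linarith
    linarith
  have hLip : ∀ x x', W x' - W x ≤ L * ‖aux_j x' - aux_j x‖ := by
    intro x x'
    exact aux_le_of_rat fun a ha => hstep x x' a (Or.inl ha)
  have hf : LipschitzOnWith (Real.toNNReal L) (fun X => W (Function.invFun aux_j X)) (Set.range (aux_j (d := d))) := by
    apply LipschitzOnWith.of_le_add_mul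
    rintro _ ⟨x, rfl⟩ _ ⟨y, rfl⟩
    rw [Function.leftInverse_invFun aux_j_inj x, Function.leftInverse_invFun aux_j_inj y, dist_eq_norm]
    have := hLip y x
    have e : ((Real.toNNReal L : ℝ≥0) : ℝ) = L := Real.coe_toNNReal L hL0
    rw [e]
    linarith
  obtain ⟨g, hg, hEq⟩ := hf.extend_real
  have hgj : ∀ x, g (aux_j x) = W x := by
    intro x
    rw [← hEq ⟨x, rfl⟩]
    simp only [Function.leftInverse_invFun aux_j_inj x]
  refine ⟨g, ⟨_, hg⟩, ?_, ?_⟩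
  · filter_upwards [hsub, hg.ae_differentiableAt (μ := volume)] with z hz hdiff
    by_contra hcon
    obtain ⟨v, c, hvc, hcb⟩ := aux_sep {q | H q z ≤ t} (isClosed_le (hHc z) continuous_const)
      ⟨_, hz.trans h01⟩ (fun p hp q hq => (hqc p q z).trans (max_le hp hq)) (gradient g z) hcon
    have hgc := hg.continuous
    have hclaim : ∀ h : ℝ, 0 < h → h * ‖v‖ < r → g (z + h • v) - g z ≤ h * c := by
      intro h hh hhr
      by_contra hlt
      push Not at hlt
      have hopen : IsOpen {X : Ed d × Ed d | (‖X.1 - z‖ < r ∧ ‖X.2 - X.1‖ < r) ∧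
          h * c + L * ‖X.2 - X.1 - h • v‖ < g X.2 - g X.1} := by
        apply IsOpen.and
        · exact (isOpen_lt (by fun_prop) (by fun_prop)).and (isOpen_lt (by fun_prop) (by fun_prop))
        · exact isOpen_lt (by fun_prop) (by fun_prop)
      have hd2 : DenseRange (Prod.map (aux_j (d := d)) (aux_j (d := d))) := aux_j_dense.prodMap aux_j_dense
      obtain ⟨⟨x, x'⟩, ⟨h1, h2⟩, h3⟩ := hd2.exists_mem_open hopen ⟨(z, z + h • v), by
        refine ⟨⟨by simpa using hr0, ?_⟩, ?_⟩
        · simpa [norm_smul, abs_of_pos hh] using hhr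
        · simpa using hlt⟩
      simp only [Prod.map_apply] at h1 h2 h3
      rw [hgj, hgj] at h3
      refine absurd (aux_le_of_rat fun a ha => hstep x x' a (Or.inr ⟨h2, ?_⟩)) (not_le.2 h3)
      intro q hq
      have hqL := hL _ _ (hq.le.trans h1t)
      have hqv : ⟪aux_j q, v⟫ ≤ c := hvc _ (hr2 _ _ _ hqL h1 hq)
      have e : aux_j x' - aux_j x = h • v + (aux_j x' - aux_j x - h • v) := by abel
      rw [e, inner_add_right, inner_smul_right]
      have i1 : ⟪aux_j q, aux_j x' - aux_j x - h • v⟫ ≤ L * ‖aux_j x' - aux_j x - h • v‖ :=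
        (real_inner_le_norm _ _).trans (by gcongr)
      have i2 : h * ⟪aux_j q, v⟫ ≤ h * c := by gcongr
      linarith
    have hder : HasDerivAt (fun h : ℝ => g (z + h • v)) ⟪gradient g z, v⟫ 0 := by
      have h2 : HasDerivAt (fun h : ℝ => z + h • v) v 0 := by
        simpa using ((hasDerivAt_id (0:ℝ)).smul_const v).const_add z
      have h3 : HasFDerivAt g (fderiv ℝ g z) (z + (0:ℝ) • v) := by simpa using hdiff.hasFDerivAt
      have := h3.comp_hasDerivAt (0:ℝ) h2
      rw [gradient, InnerProductSpace.toDual_symm_apply]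
      exact this
    have hlim := hder.tendsto_slope_zero_right
    have : ⟪gradient g z, v⟫ ≤ c := by
      apply le_of_tendsto hlim
      have hev : ∀ᶠ h : ℝ in 𝓝[>] 0, h * ‖v‖ < r := by
        apply nhdsWithin_le_nhds
        have hc : Continuous fun h : ℝ => h * ‖v‖ := by fun_prop
        exact hc.continuousAt.eventually (p := fun y => y < r) (by simpa using gt_mem_nhds hr0)
      filter_upwards [hev, self_mem_nhdsWithin] with h hh hpos
      have hpos' : 0 < h := hpos
      have := hclaim h hpos' hh
      simp only [zero_add, zero_smul, add_zero, smul_eq_mul]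
      rw [inv_mul_le_iff₀ hpos']
      exact this
    linarith
  · intro y c hc
    rw [hgj]
    apply csSup_le (hne y)
    rintro b ⟨n, s, hs, rfl⟩
    have := hc n s hs
    linarith
lemma aux_norm_le {d : ℕ} (x : Ed d) (c : ℝ) (h : ∀ i, |x i| ≤ c) : ‖x‖ ≤ d * c := by
  have h0 : ‖x‖ ≤ ∑ i, |x i| := by
    rw [EuclideanSpace.norm_eq]
    apply Real.sqrt_le_iff.2
    constructor
    · positivity
    · simpa using Finset.sum_sq_le_sq_sum_of_nonneg (s := Finset.univ) (f := fun i => |x i|) (fun i _ => abs_nonneg _)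
  refine h0.trans ((Finset.sum_le_sum fun i _ => h i).trans ?_)
  simp

/-- integer points as rational points -/
def aux_i {d : ℕ} (z : Fin d → ℤ) : Fin d → ℚ := fun i => (z i : ℚ)

lemma aux_geom {d : ℕ} (k : ℕ) (hk : 0 < k) (y : Fin d → ℚ) (good : (Fin d → ℤ) → Prop)
    (h : ∀ (y : Fin d → ℤ) (m : ℕ), dist y 0 ≤ m → ∃ z ∈ aux_box d y (m / k), good z) :
    ∃ z, good z ∧ ‖aux_j y - aux_j (aux_i z)‖ ≤ d + d * ((‖aux_j y‖ + d + 1) / k) := by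
  set yt : Fin d → ℤ := fun i => ⌊y i⌋ with hyt
  obtain ⟨z, hz, hgood⟩ := h yt ⌈dist yt 0⌉₊ (Nat.le_ceil _)
  refine ⟨z, hgood, ?_⟩
  have h1 : ‖aux_j y - aux_j (aux_i yt)‖ ≤ d * 1 := by
    apply aux_norm_le
    intro i
    have e : (aux_j y - aux_j (aux_i yt)) i = (y i : ℝ) - (yt i : ℝ) := by
      simp [aux_j, aux_i]
    rw [e, abs_le]
    have a1 : ((yt i : ℚ) : ℝ) ≤ (y i : ℝ) := Rat.cast_le.2 (Int.floor_le (y i))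
    have a2 : (y i : ℝ) < ((yt i + 1 : ℚ) : ℝ) := Rat.cast_lt.2 (Int.lt_floor_add_one (y i))
    push_cast at a1 a2
    constructor <;> linarith
  have h2 : ‖aux_j (aux_i yt) - aux_j (aux_i z)‖ ≤ d * dist z yt := by
    apply aux_norm_le
    intro i
    have e : (aux_j (aux_i yt) - aux_j (aux_i z)) i = (yt i : ℝ) - (z i : ℝ) := by
      simp [aux_j, aux_i]
    rw [e, ← Int.dist_eq, dist_comm]
    exact dist_le_pi_dist z yt i
  have h3 : dist yt 0 ≤ ‖aux_j (aux_i yt)‖ := by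
    rw [dist_pi_le_iff (norm_nonneg _)]
    intro i
    have := PiLp.norm_apply_le (aux_j (aux_i yt)) i
    refine le_trans (le_of_eq ?_) this
    rw [Int.dist_eq]
    simp [aux_j, aux_i]
  have h4 : ‖aux_j (aux_i yt)‖ ≤ ‖aux_j y‖ + d := by
    have := norm_sub_norm_le (aux_j (aux_i yt)) (aux_j y)
    rw [norm_sub_rev] at this
    linarith
  have h5 : dist z yt ≤ (‖aux_j y‖ + d + 1) / k := by
    have a1 := aux_mem_box.1 hz
    refine a1.trans (Nat.cast_div_le.trans ?_)
    gcongr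
    have := (Nat.ceil_lt_add_one (dist_nonneg (x := yt) (y := 0))).le
    linarith
  calc ‖aux_j y - aux_j (aux_i z)‖ ≤ ‖aux_j y - aux_j (aux_i yt)‖ + ‖aux_j (aux_i yt) - aux_j (aux_i z)‖ :=
        norm_sub_le_norm_sub_add_norm_sub _ _ _
    _ ≤ d * 1 + d * dist z yt := add_le_add h1 h2
    _ ≤ _ := by rw [mul_one]; gcongr

lemma aux_prob {d : ℕ} {Ω : Type*} [MeasurableSpace Ω] (P : Measure Ω) [IsProbabilityMeasure P]
    (τ : Ed d → Ω → Ω)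
    (hτmp : ∀ y : Ed d, MeasurePreserving (τ y) P P)
    (hτgrp : ∀ x y : Ed d, τ (x + y) = τ x ∘ τ y)
    (H : Ed d → Ed d → Ω → ℝ) (hH : ∀ q y, Measurable (H q y))
    (hHstat : ∀ (p y z : Ed d) (ω : Ω), H p y (τ z ω) = H p (y + z) ω)
    (L r t1 : ℝ) (hL0 : 0 ≤ L)
    (h : ∀ᵐ ω ∂P, ∀ ε : ℝ, 0 < ε → ∃ n : ℕ, ∀ N y s, aux_chain (fun q y => H q y ω) L r t1 N 0 y s →
      (n : ℝ) ≤ ‖aux_j y‖ → -ε * ‖aux_j y‖ ≤ s) :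
    ∀ᵐ ω ∂P, ∀ ε : ℝ, 0 < ε → ∃ R : ℝ, ∀ N y s, aux_chain (fun q y => H q y ω) L r t1 N y 0 s →
      R ≤ ‖aux_j y‖ → -ε * ‖aux_j y‖ ≤ s := by
  have hred : ∀ ε : ℝ, 0 < ε → ∀ᵐ ω ∂P, ∃ R : ℝ, ∀ N y s,
      aux_chain (fun q y => H q y ω) L r t1 N y 0 s → R ≤ ‖aux_j y‖ → -ε * ‖aux_j y‖ ≤ s := by
    intro ε hε
    set δ : ℝ := min (1/4) (ε / (4 * (L + 1))) with hδ
    have hδ0 : 0 < δ := by positivity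
    have hδ1 : δ ≤ 1/4 := min_le_left _ _
    have hδ2 : L * δ ≤ ε / 4 := by
      calc L * δ ≤ (L + 1) * (ε / (4 * (L + 1))) := by
            gcongr
            · linarith
            · exact min_le_right _ _
        _ = ε / 4 := by field_simp
    obtain ⟨k, hk⟩ := exists_nat_gt ((d : ℝ) / δ)
    have hkpos : 0 < k := by
      have : (0:ℝ) < k := lt_of_le_of_lt (by positivity) hk
      exact_mod_cast this
    have hkR : (0:ℝ) < k := by exact_mod_cast hkpos
    have hdk : (d : ℝ) / k ≤ δ := by
      rw [div_le_iff₀ hkR]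
      rw [div_lt_iff₀ hδ0] at hk
      linarith
    set G : ℕ → Set Ω := fun n => {ω | ∀ N y s, aux_chain (fun q y => H q y ω) L r t1 N 0 y s →
      (n : ℝ) ≤ ‖aux_j y‖ → -(ε/4) * ‖aux_j y‖ ≤ s} with hG
    have hGm : ∀ n, MeasurableSet (G n) := by
      intro n
      have : G n = ⋂ (N : ℕ) (y : Fin d → ℚ) (s : ℚ),
          ({ω | aux_chain (fun q y => H q y ω) L r t1 N 0 y s}ᶜ ∪
            {ω | (n : ℝ) ≤ ‖aux_j y‖ → -(ε/4) * ‖aux_j y‖ ≤ s}) := by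
        ext ω
        simp only [hG, Set.mem_iInter, Set.mem_union, Set.mem_compl_iff, Set.mem_ofPred_eq,
          imp_iff_not_or]
      rw [this]
      exact MeasurableSet.iInter fun N => MeasurableSet.iInter fun y => MeasurableSet.iInter fun s =>
        (aux_chain_meas H hH L r t1 N 0 y s).compl.union (MeasurableSet.const _)
    have hGmono : Monotone G := by
      intro a b hab ω hω N y s hc hn
      exact hω N y s hc (le_trans (by exact_mod_cast hab) hn)
    have hlim : Tendsto (fun n => P (G n)ᶜ) atTop (𝓝 0) := by
      have h1 := tendsto_measure_iInter_atTop (μ := P) (s := fun n => (G n)ᶜ)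
        (fun n => (hGm n).compl.nullMeasurableSet)
        (fun a b hab => Set.compl_subset_compl.2 (hGmono hab)) ⟨0, measure_ne_top _ _⟩
      have h2 : P (⋂ n, (G n)ᶜ) = 0 := by
        rw [← Set.compl_iUnion]
        have : ∀ᵐ ω ∂P, ω ∈ ⋃ n, G n := by
          filter_upwards [h] with ω hω
          obtain ⟨n, hn⟩ := hω (ε/4) (by positivity)
          exact Set.mem_iUnion.2 ⟨n, hn⟩
        exact this
      rwa [h2] at h1
    set T : (Fin d → ℤ) → Ω → Ω := fun z => τ (aux_j (aux_i z)) with hT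
    have hTadd : ∀ x y, T (x + y) = T x ∘ T y := by
      intro x y
      simp only [hT]
      rw [← hτgrp, ← aux_j_add]
      congr 2
      ext i
      simp [aux_i]
    have hmax : ∀ n, P {ω | ∃ (y : Fin d → ℤ) (m : ℕ), dist y 0 ≤ m ∧
        ∀ z ∈ aux_box d y (m / k), T z ω ∈ (G n)ᶜ} ≤ ((30 * k) ^ d : ℕ) * P (G n)ᶜ := by
      intro n
      have e : {ω | ∃ (y : Fin d → ℤ) (m : ℕ), dist y 0 ≤ m ∧
        ∀ z ∈ aux_box d y (m / k), T z ω ∈ (G n)ᶜ} = ⋃ N : ℕ, {ω | ∃ (y : Fin d → ℤ) (m : ℕ), m ≤ N ∧ dist y 0 ≤ m ∧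
        ∀ z ∈ aux_box d y (m / k), T z ω ∈ (G n)ᶜ} := by
        ext ω
        simp only [Set.mem_iUnion, Set.mem_ofPred_eq]
        constructor
        · rintro ⟨y, m, h1, h2⟩
          exact ⟨m, y, m, le_rfl, h1, h2⟩
        · rintro ⟨_, y, m, _, h1, h2⟩
          exact ⟨y, m, h1, h2⟩
      rw [e, Monotone.measure_iUnion]
      · apply iSup_le
        intro N
        exact aux_maximal d P T (fun z => hτmp _) hTadd _ (hGm n).compl k N hkpos
      · rintro a b hab ω ⟨y, m, h1, h2⟩
        exact ⟨y, m, h1.trans hab, h2⟩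
    have hfail : ∀ n, {ω | ¬ ∃ R : ℝ, ∀ N y s,
      aux_chain (fun q y => H q y ω) L r t1 N y 0 s → R ≤ ‖aux_j y‖ → -ε * ‖aux_j y‖ ≤ s} ⊆
        {ω | ∃ (y : Fin d → ℤ) (m : ℕ), dist y 0 ≤ m ∧
        ∀ z ∈ aux_box d y (m / k), T z ω ∈ (G n)ᶜ} := by
      intro n ω hω
      by_contra hcon
      apply hω
      have hcon' : ∀ (y : Fin d → ℤ) (m : ℕ), dist y 0 ≤ m →
          ∃ z ∈ aux_box d y (m / k), T z ω ∈ G n := by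
        intro y m hm
        by_contra hno
        push Not at hno
        exact hcon ⟨y, m, hm, hno⟩
      refine ⟨max (2 * n) ((d + δ * (d + 1)) / δ), ?_⟩
      intro N y s hc hR
      obtain ⟨z, hz, hd⟩ := aux_geom k hkpos y (fun z => T z ω ∈ G n) hcon'
      have hR1 := (le_max_left _ _).trans hR
      have hR2 := (le_max_right _ _).trans hR
      rw [div_le_iff₀ hδ0] at hR2
      have hdist : ‖aux_j y - aux_j (aux_i z)‖ ≤ 2 * δ * ‖aux_j y‖ := by
        refine hd.trans ?_
        have : (d : ℝ) * ((‖aux_j y‖ + d + 1) / k) = (d / k) * (‖aux_j y‖ + d + 1) := by ring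
        rw [this]
        have : (d / k : ℝ) * (‖aux_j y‖ + d + 1) ≤ δ * (‖aux_j y‖ + d + 1) := by gcongr
        linarith
      have hny := norm_nonneg (aux_j y)
      have hdist2 : ‖aux_j y - aux_j (aux_i z)‖ ≤ ‖aux_j y‖ / 2 := by nlinarith
      have hZ1 : ‖aux_j y‖ / 2 ≤ ‖aux_j (aux_i z)‖ := by
        have := norm_sub_norm_le (aux_j y) (aux_j (aux_i z))
        linarith
      have hZ2 : ‖aux_j (aux_i z)‖ ≤ 2 * ‖aux_j y‖ := by
        have := norm_sub_norm_le (aux_j (aux_i z)) (aux_j y)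
        rw [norm_sub_rev] at this
        linarith
      have hkey : -(s : ℝ) - (ε/4) * ‖aux_j (aux_i z)‖ ≤ L * ‖aux_j y - aux_j (aux_i z)‖ := by
        apply aux_le_of_rat
        intro a ha
        have hch : aux_chain (fun q y => H q y ω) L r t1 (N + 1) (aux_i z) 0 (s + a) :=
          ⟨y, a, Or.inl ha, by simpa using hc⟩
        have hch2 : aux_chain (fun q y => H q y (T z ω)) L r t1 (N + 1) 0 (-aux_i z) (s + a) := by
          apply aux_chain_shift (fun q y => H q y ω) _ (aux_i z) (fun q y => hHstat q y _ ω)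
          simpa using hch
        have hnorm : ‖aux_j (-aux_i z)‖ = ‖aux_j (aux_i z)‖ := by
          have : aux_j (-aux_i z) = - aux_j (aux_i z) := by
            ext i; simp [aux_j]
          rw [this, norm_neg]
        have := hz _ _ _ hch2 (by rw [hnorm]; linarith)
        rw [hnorm] at this
        push_cast at this
        linarith
      have b1 : L * ‖aux_j y - aux_j (aux_i z)‖ ≤ L * (2 * δ * ‖aux_j y‖) := by gcongr
      have b2 : L * δ * ‖aux_j y‖ ≤ ε / 4 * ‖aux_j y‖ := by gcongr
      have b3 : (ε/4) * ‖aux_j (aux_i z)‖ ≤ (ε/4) * (2 * ‖aux_j y‖) := by gcongr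
      linarith
    have hz : P {ω | ¬ ∃ R : ℝ, ∀ N y s,
      aux_chain (fun q y => H q y ω) L r t1 N y 0 s → R ≤ ‖aux_j y‖ → -ε * ‖aux_j y‖ ≤ s} ≤ 0 := by
      have hl2 : Tendsto (fun n => (((30 * k) ^ d : ℕ) : ENNReal) * P (G n)ᶜ) atTop
          (𝓝 ((((30 * k) ^ d : ℕ) : ENNReal) * 0)) :=
        ENNReal.Tendsto.const_mul hlim (Or.inr (ENNReal.natCast_ne_top _))
      rw [mul_zero] at hl2
      exact ge_of_tendsto' hl2 fun n => (measure_mono (hfail n)).trans (hmax n)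
    exact nonpos_iff_eq_zero.1 hz
  have hall : ∀ᵐ ω ∂P, ∀ m : ℕ, ∃ R : ℝ, ∀ N y s,
      aux_chain (fun q y => H q y ω) L r t1 N y 0 s → R ≤ ‖aux_j y‖ →
        -(1 / ((m : ℝ) + 1)) * ‖aux_j y‖ ≤ s :=
    ae_all_iff.2 fun m => hred _ (by positivity)
  filter_upwards [hall] with ω hω ε hε
  obtain ⟨m, hm⟩ := exists_nat_one_div_lt hε
  obtain ⟨R, hR⟩ := hω m
  refine ⟨R, fun N y s hc hn => ?_⟩
  have h1 := hR N y s hc hn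
  have h2 : 1 / ((m : ℝ) + 1) * ‖aux_j y‖ ≤ ε * ‖aux_j y‖ := by gcongr
  linarith

lemma aux_core {d : ℕ} {Ω : Type*} [MeasurableSpace Ω] (P : Measure Ω) [IsProbabilityMeasure P]
    (τ : Ed d → Ω → Ω)
    (hτmp : ∀ y : Ed d, MeasurePreserving (τ y) P P)
    (hτgrp : ∀ x y : Ed d, τ (x + y) = τ x ∘ τ y)
    (H : Ed d → Ed d → Ω → ℝ) (hH : ∀ q y, Measurable (H q y))
    (hHstat : ∀ (p y z : Ed d) (ω : Ω), H p y (τ z ω) = H p (y + z) ω)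
    (hHcont : ∀ (ω : Ω) (y : Ed d), Continuous fun q : Ed d => H q y ω)
    (hreg_uc : ∀ R : ℝ, 0 < R → ∀ ε : ℝ, 0 < ε → ∃ δ : ℝ, 0 < δ ∧ ∀ (ω : Ω) (p y y' : Ed d),
      ‖p‖ ≤ R → ‖y - y'‖ < δ → |H p y ω - H p y' ω| < ε)
    (hcoer : ∀ M : ℝ, ∃ R : ℝ, ∀ (ω : Ω) (p y : Ed d), R ≤ ‖p‖ → M ≤ H p y ω)
    (hqc : ∀ (ω : Ω) (p q y : Ed d), H ((1/2 : ℝ) • (p + q)) y ω ≤ max (H p y ω) (H q y ω))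
    (t0 t : ℝ) (ht : t0 < t)
    (hu : ∀ᵐ ω ∂P, ∃ u ∈ SLplus d, ∀ᵐ z, H (gradient u z) z ω ≤ t0) :
    ∀ᵐ ω ∂P, ∃ w ∈ SLminus d, ∀ᵐ z, H (gradient w z) z ω ≤ t := by
  obtain ⟨R0, hR0⟩ := hcoer (t + 1)
  set L : ℝ := max R0 0 with hLdef
  have hL0 : 0 ≤ L := le_max_right _ _
  have hLt : ∀ ω q y, H q y ω ≤ t → ‖q‖ ≤ L := by
    intro ω q y hq
    by_contra hcon
    have := hR0 ω q y ((le_max_left _ _).trans (not_le.1 hcon).le)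
    linarith
  obtain ⟨r, hr0, hr⟩ := hreg_uc (L + 1) (by linarith) ((t - t0) / 2) (by linarith)
  set t1 : ℝ := (t0 + t) / 2 with ht1
  have hr1 : ∀ ω q x z, ‖q‖ ≤ L → ‖z - x‖ < r → H q z ω ≤ t0 → H q x ω < t1 := by
    intro ω q x z hq hz h
    have := (abs_lt.1 (hr ω q z x (by linarith) hz)).1
    linarith
  have hr2 : ∀ ω q x z, ‖q‖ ≤ L → ‖z - x‖ < r → H q z ω < t1 → H q x ω ≤ t := by
    intro ω q x z hq hz h
    have := (abs_lt.1 (hr ω q z x (by linarith) hz)).1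
    linarith
  have hP := aux_prob P τ hτmp hτgrp H hH hHstat L r t1 hL0 (by
    filter_upwards [hu] with ω hω ε hε
    obtain ⟨u, ⟨⟨C, hC⟩, hus⟩, hsub⟩ := hω
    obtain ⟨R, hR⟩ := hus (ε / 2) (by linarith)
    obtain ⟨n, hn⟩ := exists_nat_ge (max R (max 1 (2 * |u 0| / ε)))
    refine ⟨n, fun N y s hc hy => ?_⟩
    have h1 := (le_max_left _ _).trans (hn.trans hy)
    have h23 := (le_max_right _ _).trans (hn.trans hy)
    have h2 := (le_max_left _ _).trans h23
    have h3 := (le_max_right _ _).trans h23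
    have hch := aux_sub_chain (fun q y => H q y ω) L r t0 t1 (hHcont ω)
      (fun q y hq => hLt ω q y (hq.trans ht.le)) (hr1 ω) hC hsub N 0 y s hc
    rw [aux_j_zero] at hch
    have h4 := hR _ h1
    rw [le_div_iff₀ (by linarith)] at h4
    rw [div_le_iff₀ hε] at h3
    have h5 := le_abs_self (u 0)
    linarith)
  filter_upwards [hu, hP] with ω hω hPω
  obtain ⟨u, ⟨⟨C, hC⟩, hus⟩, hsub⟩ := hω
  obtain ⟨w, hwl, hwsub, hw⟩ := aux_construct (fun q y => H q y ω) L r t0 t1 t hL0 hr0 ht.le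
    (by linarith) (hHcont ω) (hLt ω) (hr1 ω) (hr2 ω) (hqc ω) hC hsub
  refine ⟨w, ⟨hwl, fun ε hε => ?_⟩, hwsub⟩
  obtain ⟨R, hR⟩ := hPω ε hε
  have hwc : Continuous w := by
    obtain ⟨C, hC⟩ := hwl
    exact hC.continuous
  refine ⟨max R 0 + 1, fun y hy => ?_⟩
  have hR' : R ≤ max R 0 := le_max_left _ _
  have hR'' : 0 ≤ max R 0 := le_max_right _ _
  rw [div_le_iff₀ (by linarith)]
  by_contra hcon
  push Not at hcon
  have hopen : IsOpen {X : Ed d | R < ‖X‖ ∧ ε * ‖X‖ < w X} :=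
    (isOpen_lt continuous_const continuous_norm).inter
      (isOpen_lt (continuous_const.mul continuous_norm) hwc)
  obtain ⟨x, hX⟩ := aux_j_dense.exists_mem_open hopen ⟨y, by linarith, hcon⟩
  have := hw x (ε * ‖aux_j x‖) (fun n s hc => by
    have := hR n x s hc hX.1.le
    linarith)
  exact absurd hX.2 (not_lt.2 this)

lemma aux_grad_le {d : ℕ} {C : ℝ≥0} {w : Ed d → ℝ} (hw : LipschitzWith C w) (y : Ed d) :
    ‖gradient w y‖ ≤ C := by
  unfold gradient
  rw [LinearIsometryEquiv.norm_map]
  exact norm_fderiv_le_of_lipschitz ℝ hw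

lemma aux_ess {d : ℕ} (F : Ed d → ℝ) (M : ℝ) (hF : ∀ y, |F y| ≤ M) :
    (∀ᵐ y, F y ≤ essSup F volume) ∧ (∀ t, (∀ᵐ y, F y ≤ t) → essSup F volume ≤ t) ∧
      (∀ b, (∀ y, b ≤ F y) → b ≤ essSup F volume) := by
  have hb : IsBoundedUnder (· ≤ ·) (ae (volume : Measure (Ed d))) F :=
    isBoundedUnder_of ⟨M, fun y => (abs_le.1 (hF y)).2⟩
  have hb' : IsBoundedUnder (· ≥ ·) (ae (volume : Measure (Ed d))) F :=
    isBoundedUnder_of ⟨-M, fun y => (abs_le.1 (hF y)).1⟩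
  have h1 : ∀ᵐ y, F y ≤ essSup F volume := ae_le_essSup hb
  refine ⟨h1, fun t ht => ?_, fun b hb => ?_⟩
  · exact limsup_le_of_le hb'.isCoboundedUnder_le ht
  · obtain ⟨y, hy⟩ := h1.exists
    exact (hb y).trans hy

lemma aux_sInf {d : ℕ} {Ω : Type*} (H : Ed d → Ed d → Ω → ℝ) (ω : Ω) (p : Ed d)
    (hreg_bdd : ∀ R : ℝ, 0 < R → ∃ M : ℝ, ∀ (ω : Ω) (p y : Ed d), ‖p‖ ≤ R → |H p y ω| ≤ M)
    (hcoer : ∀ M : ℝ, ∃ R : ℝ, ∀ (ω : Ω) (p y : Ed d), R ≤ ‖p‖ → M ≤ H p y ω)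
    (S : Set (Ed d → ℝ)) (hS : S ⊆ LipFuns d) (h0 : (0 : Ed d → ℝ) ∈ S) :
    (∀ t, sInf {t | ∃ w ∈ S, t = essSup (fun y => H (p + gradient w y) y ω) volume} < t →
      ∃ w ∈ S, ∀ᵐ y, H (p + gradient w y) y ω ≤ t) ∧
    (∀ t, (∃ w ∈ S, ∀ᵐ y, H (p + gradient w y) y ω ≤ t) →
      sInf {t | ∃ w ∈ S, t = essSup (fun y => H (p + gradient w y) y ω) volume} ≤ t) := by
  have hbd : ∀ w ∈ S, ∃ M : ℝ, ∀ y, |H (p + gradient w y) y ω| ≤ M := by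
    intro w hw
    obtain ⟨C, hC⟩ := hS hw
    obtain ⟨M, hM⟩ := hreg_bdd (‖p‖ + C + 1) (by positivity)
    refine ⟨M, fun y => hM _ _ _ ?_⟩
    have := norm_add_le p (gradient w y)
    have := aux_grad_le hC y
    linarith
  obtain ⟨R, hR⟩ := hcoer 0
  obtain ⟨M, hM⟩ := hreg_bdd (max R 1) (by positivity)
  have hlow : ∀ q y, min (-M) 0 ≤ H q y ω := by
    intro q y
    rcases le_total R ‖q‖ with h | h
    · exact (min_le_right _ _).trans (hR _ _ _ h)
    · exact (min_le_left _ _).trans (abs_le.1 (hM ω q y (h.trans (le_max_left _ _)))).1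
  constructor
  · intro t ht
    have hne : Set.Nonempty
        {t | ∃ w ∈ S, t = essSup (fun y => H (p + gradient w y) y ω) volume} :=
      ⟨_, 0, h0, rfl⟩
    obtain ⟨a, ⟨w, hw, rfl⟩, ha⟩ := exists_lt_of_csInf_lt hne ht
    obtain ⟨M', hM'⟩ := hbd w hw
    refine ⟨w, hw, ?_⟩
    filter_upwards [(aux_ess _ M' hM').1] with y hy
    exact hy.trans ha.le
  · rintro t ⟨w, hw, hwt⟩
    obtain ⟨M', hM'⟩ := hbd w hw
    have hbb : BddBelow
        {t | ∃ w ∈ S, t = essSup (fun y => H (p + gradient w y) y ω) volume} := by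
      refine ⟨min (-M) 0, ?_⟩
      rintro a ⟨v, hv, rfl⟩
      obtain ⟨M'', hM''⟩ := hbd v hv
      exact (aux_ess _ M'' hM'').2.2 _ (fun y => hlow _ y)
    have hmem : essSup (fun y => H (p + gradient w y) y ω) volume ∈
        {t | ∃ w ∈ S, t = essSup (fun y => H (p + gradient w y) y ω) volume} := ⟨w, hw, rfl⟩
    exact (csInf_le hbb hmem).trans ((aux_ess _ M' hM').2.1 t hwt)

lemma aux_zero_plus (d : ℕ) : (0 : Ed d → ℝ) ∈ SLplus d :=
  ⟨⟨0, LipschitzWith.const 0⟩, fun ε hε => ⟨0, fun y _ => by simp [hε.le]⟩⟩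

lemma aux_zero_minus (d : ℕ) : (0 : Ed d → ℝ) ∈ SLminus d :=
  ⟨⟨0, LipschitzWith.const 0⟩, fun ε hε => ⟨0, fun y _ => by simp [hε.le]⟩⟩

lemma aux_neg_minus {d : ℕ} {w : Ed d → ℝ} (hw : w ∈ SLminus d) : (fun y => - w y) ∈ SLplus d := by
  obtain ⟨⟨C, hC⟩, h⟩ := hw
  refine ⟨⟨C, hC.neg⟩, fun ε hε => ?_⟩
  obtain ⟨R, hR⟩ := h ε hε
  refine ⟨R, fun y hy => ?_⟩
  have := hR y hy
  rw [neg_div]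
  linarith

lemma aux_neg_plus {d : ℕ} {w : Ed d → ℝ} (hw : w ∈ SLplus d) : (fun y => - w y) ∈ SLminus d := by
  obtain ⟨⟨C, hC⟩, h⟩ := hw
  refine ⟨⟨C, hC.neg⟩, fun ε hε => ?_⟩
  obtain ⟨R, hR⟩ := h ε hε
  refine ⟨R, fun y hy => ?_⟩
  have := hR y hy
  rw [neg_div]
  linarith

lemma aux_grad_neg {d : ℕ} (w : Ed d → ℝ) (y : Ed d) :
    gradient (fun y => - w y) y = - gradient w y := by
  unfold gradient
  rw [fderiv_fun_neg, map_neg]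

lemma aux_neg_plus_iff {d : ℕ} {w : Ed d → ℝ} (hw : (fun y => - w y) ∈ SLminus d) : w ∈ SLplus d := by
  simpa using aux_neg_minus hw

/-- the deterministic values of H̄₊ and H̄₋ coincide. -/
theorem statement_16
    (d : ℕ) (hd : 0 < d)
    {Ω : Type*} [MeasurableSpace Ω] (P : Measure Ω) [IsProbabilityMeasure P]
    (τ : Ed d → Ω → Ω)
    (hτmeas : ∀ y : Ed d, Measurable (τ y))
    (hτmp : ∀ y : Ed d, MeasurePreserving (τ y) P P)
    (hτgrp : ∀ x y : Ed d, τ (x + y) = τ x ∘ τ y)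
    (hτzero : τ 0 = id)
    (hτerg : ∀ A : Set Ω, MeasurableSet A → (∀ z : Ed d, τ z ⁻¹' A = A) → P A = 0 ∨ P A = 1)
    (H : Ed d → Ed d → Ω → ℝ)
    (hHmeas : Measurable fun x : Ed d × Ed d × Ω => H x.1 x.2.1 x.2.2)
    (hHstat : ∀ (p y z : Ed d) (ω : Ω), H p y (τ z ω) = H p (y + z) ω)
    (hHcont : ∀ ω : Ω, Continuous fun q : Ed d × Ed d => H q.1 q.2 ω)
    (hreg_bdd : ∀ R : ℝ, 0 < R → ∃ M : ℝ, ∀ (ω : Ω) (p y : Ed d), ‖p‖ ≤ R → |H p y ω| ≤ M)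
    (hreg_uc : ∀ R : ℝ, 0 < R → ∀ ε : ℝ, 0 < ε → ∃ δ : ℝ, 0 < δ ∧ ∀ (ω : Ω) (p p' y y' : Ed d),
      ‖p‖ ≤ R → ‖p'‖ ≤ R → ‖p - p'‖ < δ → ‖y - y'‖ < δ → |H p y ω - H p' y' ω| < ε)
    (hcoer : ∀ M : ℝ, ∃ R : ℝ, ∀ (ω : Ω) (p y : Ed d), R ≤ ‖p‖ → M ≤ H p y ω)
    (hqc : ∀ (ω : Ω) (p q y : Ed d), H ((1/2 : ℝ) • (p + q)) y ω ≤ max (H p y ω) (H q y ω))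
    (Λ : ℝ → ℝ → ℝ)
    (hΛcont : Continuous fun m : ℝ × ℝ => Λ m.1 m.2)
    (hΛmono : ∀ a b a' b' : ℝ, a ≤ a' → b ≤ b' → Λ a b ≤ Λ a' b')
    (hΛstrict : ∀ a b : ℝ, a ≠ b → Λ a b < max a b)
    (hsqc : ∀ (ω : Ω) (p q y : Ed d), H ((1/2 : ℝ) • (p + q)) y ω ≤ Λ (H p y ω) (H q y ω))
    (HbarP HbarM : Ed d → ℝ)
    (hHbarP : ∀ p : Ed d, ∀ᵐ ω ∂P, HbarPlusOm d H p ω = HbarP p)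
    (hHbarM : ∀ p : Ed d, ∀ᵐ ω ∂P, HbarMinusOm d H p ω = HbarM p) :
    ∀ p : Ed d, HbarP p = HbarM p ∧
      ∀ᵐ ω ∂P, HbarPlusOm d H p ω = HbarMinusOm d H p ω := by
  intro p
  have hmH : ∀ q y, Measurable (H q y) := fun q y =>
    hHmeas.comp (measurable_const.prodMk (measurable_const.prodMk measurable_id))
  have hcq : ∀ (ω : Ω) (y : Ed d), Continuous fun q : Ed d => H q y ω := fun ω y =>
    (hHcont ω).comp (continuous_id.prodMk continuous_const)
  have hplus : ∀ ω, _ := fun ω => aux_sInf H ω p hreg_bdd hcoer (SLplus d) (fun w hw => hw.1)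
    (aux_zero_plus d)
  have hminus : ∀ ω, _ := fun ω => aux_sInf H ω p hreg_bdd hcoer (SLminus d) (fun w hw => hw.1)
    (aux_zero_minus d)
  have key1 : HbarM p ≤ HbarP p := by
    refine le_of_forall_gt_imp_ge_of_dense fun t ht => ?_
    obtain ⟨t0, ht0, ht0t⟩ := exists_between ht
    have hc := aux_core P τ hτmp hτgrp (fun q y ω => H (p + q) y ω) (fun q y => hmH _ _)
      (fun q y z ω => hHstat _ y z ω)
      (fun ω y => (hcq ω y).comp (continuous_const.add continuous_id))
      (fun R hR ε hε => by
        obtain ⟨δ, hδ, hh⟩ := hreg_uc (‖p‖ + R) (by positivity) ε hε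
        refine ⟨δ, hδ, fun ω q y y' hq hy => ?_⟩
        have hn : ‖p + q‖ ≤ ‖p‖ + R := (norm_add_le _ _).trans (by linarith)
        exact hh ω _ _ y y' hn hn (by simpa using hδ) hy)
      (fun M => by
        obtain ⟨R, hR⟩ := hcoer M
        refine ⟨R + ‖p‖, fun ω q y hq => hR ω _ y ?_⟩
        have := norm_sub_le (p + q) p
        rw [add_sub_cancel_left] at this
        linarith)
      (fun ω a b y => by
        have := hqc ω (p + a) (p + b) y
        have e : (1/2 : ℝ) • ((p + a) + (p + b)) = p + (1/2 : ℝ) • (a + b) := by module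
        rwa [e] at this)
      t0 t ht0t (by
        filter_upwards [hHbarP p] with ω hω
        exact (hplus ω).1 t0 (by rw [← hω] at ht0; exact ht0))
    obtain ⟨ω, h1, h2⟩ := (hc.and (hHbarM p)).exists
    rw [← h2]
    exact (hminus ω).2 t h1
  have key2 : HbarP p ≤ HbarM p := by
    refine le_of_forall_gt_imp_ge_of_dense fun t ht => ?_
    obtain ⟨t0, ht0, ht0t⟩ := exists_between ht
    have hc := aux_core P τ hτmp hτgrp (fun q y ω => H (p - q) y ω) (fun q y => hmH _ _)
      (fun q y z ω => hHstat _ y z ω)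
      (fun ω y => (hcq ω y).comp (continuous_const.sub continuous_id))
      (fun R hR ε hε => by
        obtain ⟨δ, hδ, hh⟩ := hreg_uc (‖p‖ + R) (by positivity) ε hε
        refine ⟨δ, hδ, fun ω q y y' hq hy => ?_⟩
        have hn : ‖p - q‖ ≤ ‖p‖ + R := (norm_sub_le _ _).trans (by linarith)
        exact hh ω _ _ y y' hn hn (by simpa using hδ) hy)
      (fun M => by
        obtain ⟨R, hR⟩ := hcoer M
        refine ⟨R + ‖p‖, fun ω q y hq => hR ω _ y ?_⟩
        have := norm_sub_le p (p - q)
        rw [sub_sub_cancel] at this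
        linarith)
      (fun ω a b y => by
        have := hqc ω (p - a) (p - b) y
        have e : (1/2 : ℝ) • ((p - a) + (p - b)) = p - (1/2 : ℝ) • (a + b) := by module
        rwa [e] at this)
      t0 t ht0t (by
        filter_upwards [hHbarM p] with ω hω
        obtain ⟨w, hw, hwt⟩ := (hminus ω).1 t0 (by rw [← hω] at ht0; exact ht0)
        refine ⟨_, aux_neg_minus hw, ?_⟩
        filter_upwards [hwt] with y hy
        rw [aux_grad_neg, sub_neg_eq_add]
        exact hy)
    obtain ⟨ω, ⟨w, hw, hwt⟩, h2⟩ := (hc.and (hHbarP p)).exists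
    rw [← h2]
    refine (hplus ω).2 t ⟨_, aux_neg_minus hw, ?_⟩
    filter_upwards [hwt] with y hy
    rw [aux_grad_neg, ← sub_eq_add_neg]
    exact hy
  have heq := le_antisymm key2 key1
  refine ⟨heq, ?_⟩
  filter_upwards [hHbarP p, hHbarM p] with ω h1 h2
  rw [h1, h2, heq]
end
end

section
/- Write H̄ := H̄₊. For every μ > H̄*: m̄_μ(0) = 0, m̄_μ is a viscosity subsolution of H̄(Du) ≤ μ in ℝ^d and a viscosity supersolution of H̄(Du) ≥ μ in ℝ^d ∖ {0}, and m̄_μ is maximal in the sense that every w ∈ 𝓛 with H̄(Dw(y)) ≤ μ for almost every y satisfies w(y) − w(0) ≤ m̄_μ(y) for all y ∈ ℝ^d. -/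
open MeasureTheory Filter Topology Bornology
open scoped RealInnerProductSpace NNReal

noncomputable section

lemma hasDerivAt_line {d : ℕ} {w : Ed d → ℝ} {x v : Ed d} {t : ℝ}
    (hd : DifferentiableAt ℝ w (x + t • v)) :
    HasDerivAt (fun s : ℝ => w (x + s • v)) (⟪gradient w (x + t • v), v⟫) t := by
  have hl : HasDerivAt (fun t : ℝ => x + t • v) v t := by
    simpa using ((hasDerivAt_id t).smul_const v).const_add x
  have e : ⟪gradient w (x + t • v), v⟫ = fderiv ℝ w (x + t • v) v :=
    hd.hasGradientAt.fderiv_apply.symm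
  rw [e]
  exact hd.hasFDerivAt.comp_hasDerivAt t hl

/-- Increment bound along a direction from an a.e. bound on the directional derivative. -/
lemma FL {d : ℕ} {w : Ed d → ℝ} {C : ℝ≥0} (hw : LipschitzWith C w) {U : Set (Ed d)}
    (hUo : IsOpen U) (hUc : Convex ℝ U) {v : Ed d} {α : ℝ}
    (hG : ∀ᵐ z ∂(volume : Measure (Ed d)), z ∈ U → ⟪gradient w z, v⟫ ≤ α)
    {z : Ed d} (hz : z ∈ U) (hzv : z + v ∈ U) : w (z + v) - w z ≤ α := by
  have hG2 : ∀ᵐ z ∂(volume : Measure (Ed d)),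
      z ∈ U → DifferentiableAt ℝ w z ∧ ⟪gradient w z, v⟫ ≤ α := by
    filter_upwards [hG, hw.ae_differentiableAt] with z h1 h2 h3 using ⟨h2, h1 h3⟩
  set S : Set (Ed d) := toMeasurable volume
    {z | ¬ (z ∈ U → DifferentiableAt ℝ w z ∧ ⟪gradient w z, v⟫ ≤ α)} with hS
  have hSm : MeasurableSet S := measurableSet_toMeasurable _ _
  have hS0 : (volume : Measure (Ed d)) S = 0 := by
    rw [hS, measure_toMeasurable]; exact hG2
  have hSg : ∀ z, z ∉ S → z ∈ U → DifferentiableAt ℝ w z ∧ ⟪gradient w z, v⟫ ≤ α := by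
    intro z h
    by_contra hcon
    exact h (subset_toMeasurable _ _ hcon)
  have hmeas : MeasurableSet {x : Ed d × ℝ | x.1 + x.2 • v ∉ S} := by
    have : Measurable (fun x : Ed d × ℝ => x.1 + x.2 • v) := by fun_prop
    exact (this hSm).compl
  have hae : ∀ᵐ x ∂(volume : Measure (Ed d)), ∀ᵐ t ∂(volume : Measure ℝ), x + t • v ∉ S := by
    refine (Measure.ae_ae_comm (p := fun (x : Ed d) (t : ℝ) => x + t • v ∉ S) hmeas).2 ?_
    refine Eventually.of_forall fun t => ?_
    have : (volume : Measure (Ed d)) ((fun x => x + t • v) ⁻¹' S) = 0 := by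
      rw [measure_preimage_add_right]; exact hS0
    rw [ae_iff]
    simpa [Set.preimage] using this
  have hdense : Dense {x : Ed d | ∀ᵐ t ∂(volume : Measure ℝ), x + t • v ∉ S} :=
    Measure.dense_of_ae hae
  have hW : IsOpen {x : Ed d | x ∈ U ∧ x + v ∈ U} :=
    hUo.inter (hUo.preimage (by fun_prop))
  have hcl : z ∈ closure ({x : Ed d | x ∈ U ∧ x + v ∈ U} ∩
      {x : Ed d | ∀ᵐ t ∂(volume : Measure ℝ), x + t • v ∉ S}) :=
    hdense.open_subset_closure_inter hW ⟨hz, hzv⟩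
  have hclosed : IsClosed {x : Ed d | w (x + v) - w x ≤ α} := by
    have := hw.continuous
    exact isClosed_le (by fun_prop) continuous_const
  refine closure_minimal ?_ hclosed hcl
  rintro x ⟨⟨hx, hxv⟩, hxt⟩
  simp only [Set.mem_ofPred_eq] at hxt ⊢
  set g : ℝ → ℝ := fun t => w (x + t • v) with hg
  have hgl : LipschitzWith (C * ‖v‖₊) g := by
    refine LipschitzWith.of_dist_le_mul fun s t => ?_
    refine (hw.dist_le_mul _ _).trans ?_
    simp only [dist_add_left, NNReal.coe_mul, coe_nnnorm]
    rw [dist_eq_norm, ← sub_smul, norm_smul, Real.dist_eq, Real.norm_eq_abs]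
    apply le_of_eq; ring
  have hac : AbsolutelyContinuousOnInterval g 0 1 :=
    (hgl.lipschitzOnWith (s := Set.uIcc 0 1)).absolutelyContinuousOnInterval
  have h1 := hac.integral_deriv_eq_sub
  have h2 : ∫ t in (0:ℝ)..1, deriv g t ≤ ∫ t in (0:ℝ)..1, α := by
    refine intervalIntegral.integral_mono_ae_restrict (by norm_num) hac.intervalIntegrable_deriv
      (by simp) ?_
    filter_upwards [ae_restrict_of_ae hxt, ae_restrict_mem measurableSet_Icc] with t ht htI
    have hmem : x + t • v ∈ U := by
      have := hUc hx hxv (a := 1 - t) (b := t) (by linarith [htI.2]) htI.1 (by ring)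
      convert this using 1
      module
    obtain ⟨hd, hle⟩ := hSg _ ht hmem
    have hder : HasDerivAt g (⟪gradient w (x + t • v), v⟫) t := hasDerivAt_line hd
    rw [hder.deriv]; exact hle
  have e1 : g 1 = w (x + v) := by simp [hg]
  have e0 : g 0 = w x := by simp [hg]
  rw [h1, e1, e0] at h2
  simpa using h2

/-- A closed midpoint-convex set is convex. -/
lemma convex_of_midpoint {d : ℕ} {S : Set (Ed d)} (hc : IsClosed S)
    (hm : ∀ p ∈ S, ∀ q ∈ S, (1/2 : ℝ) • (p + q) ∈ S) : Convex ℝ S := by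
  rw [convex_iff_forall_pos]
  intro p hp q hq a b ha hb hab
  by_contra hcon
  set L : ℝ → Ed d := fun t => (1 - t) • p + t • q with hL
  have hLc : Continuous L := by fun_prop
  have hTc : IsClosed (L ⁻¹' S) := hc.preimage hLc
  have hb' : L b = a • p + b • q := by simp only [hL]; rw [← hab]; simp
  have hbT : b ∉ L ⁻¹' S := by simp only [Set.mem_preimage]; rw [hb']; exact hcon
  have hLm : ∀ s t, s ∈ L ⁻¹' S → t ∈ L ⁻¹' S → (s + t) / 2 ∈ L ⁻¹' S := by
    intro s t hs ht
    have := hm _ hs _ ht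
    simp only [Set.mem_preimage]
    convert this using 1
    simp only [hL]; module
  have h0 : (0 : ℝ) ∈ L ⁻¹' S := by simpa [hL] using hp
  have h1 : (1 : ℝ) ∈ L ⁻¹' S := by simpa [hL] using hq
  have k1 : IsCompact (L ⁻¹' S ∩ Set.Icc 0 b) := isCompact_Icc.inter_left hTc
  have k2 : IsCompact (L ⁻¹' S ∩ Set.Icc b 1) := isCompact_Icc.inter_left hTc
  obtain ⟨s, hs, hsm⟩ := k1.exists_isGreatest ⟨0, h0, le_refl _, hb.le⟩
  obtain ⟨t, ht, htm⟩ := k2.exists_isLeast ⟨1, h1, by linarith, le_refl _⟩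
  have hsb : s < b := lt_of_le_of_ne hs.2.2 (fun h => hbT (h ▸ hs.1))
  have hbt : b < t := lt_of_le_of_ne ht.2.1 (fun h => hbT (h ▸ ht.1))
  have hmid := hLm s t hs.1 ht.1
  rcases le_total ((s + t) / 2) b with h | h
  · have := hsm ⟨hmid, by linarith [hs.2.1], h⟩
    linarith
  · have := htm ⟨hmid, h, by linarith [ht.2.2]⟩
    linarith

/-- Lipschitz a.e. subsolutions. -/
def SubAE {d : ℕ} (h : Ed d → Ed d → ℝ) (μ : ℝ) (w : Ed d → ℝ) : Prop :=
  w ∈ LipFuns d ∧ ∀ᵐ z ∂(volume : Measure (Ed d)), h (gradient w z) z ≤ μ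

/-- Subsolutions characterized by local increments. -/
def Inc {d : ℕ} (h : Ed d → Ed d → ℝ) (μ : ℝ) (r : ℝ → ℝ) (w : Ed d → ℝ) : Prop :=
  ∀ ε : ℝ, 0 < ε → ∀ (x v : Ed d) (α : ℝ), (∀ q, h q x ≤ μ + ε → ⟪q, v⟫ ≤ α) →
    ∀ z, dist z x < r ε → dist (z + v) x < r ε → w (z + v) - w z ≤ α

lemma SubAE.incr_le {d : ℕ} {h : Ed d → Ed d → ℝ} {μ K : ℝ} {w : Ed d → ℝ}
    (hw : SubAE h μ w) (hK : ∀ q x, h q x ≤ μ → ‖q‖ ≤ K) (x y : Ed d) :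
    w y - w x ≤ K * ‖y - x‖ := by
  obtain ⟨⟨C, hC⟩, hae⟩ := hw
  have := FL hC isOpen_univ convex_univ (v := y - x) (α := K * ‖y - x‖) (z := x) (by
    filter_upwards [hae] with z hz _
    exact (real_inner_le_norm _ _).trans
      (mul_le_mul_of_nonneg_right (hK _ _ hz) (norm_nonneg _))) trivial trivial
  simpa using this

lemma SubAE.inc {d : ℕ} {h : Ed d → Ed d → ℝ} {μ K : ℝ} {r : ℝ → ℝ} {w : Ed d → ℝ}
    (hw : SubAE h μ w) (hK : ∀ q x, h q x ≤ μ → ‖q‖ ≤ K)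
    (hr : ∀ ε, 0 < ε → ∀ q x z, ‖q‖ ≤ K → dist z x < r ε → h q x ≤ h q z + ε) :
    Inc h μ r w := by
  obtain ⟨⟨C, hC⟩, hae⟩ := hw
  intro ε hε x v α hα z hz hzv
  refine FL hC (U := Metric.ball x (r ε)) Metric.isOpen_ball (convex_ball _ _) ?_ hz hzv
  filter_upwards [hae] with y hy hyU
  apply hα
  have := hr ε hε _ x y (hK _ _ hy) hyU
  linarith

lemma Inc.subAE {d : ℕ} {h : Ed d → Ed d → ℝ} {μ : ℝ} {r : ℝ → ℝ} {w : Ed d → ℝ}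
    (hw : Inc h μ r w) (hwL : w ∈ LipFuns d) (hr : ∀ ε, 0 < ε → 0 < r ε)
    (hcont : ∀ x, Continuous fun q => h q x)
    (hqc : ∀ p q x, h ((1/2 : ℝ) • (p + q)) x ≤ max (h p x) (h q x)) : SubAE h μ w := by
  refine ⟨hwL, ?_⟩
  obtain ⟨C, hC⟩ := hwL
  filter_upwards [hC.ae_differentiableAt] with x hx
  by_contra hcon
  push Not at hcon
  obtain ⟨ε, hε, hε2⟩ : ∃ ε, 0 < ε ∧ μ + ε < h (gradient w x) x :=
    ⟨(h (gradient w x) x - μ) / 2, by linarith, by linarith⟩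
  have hcl : IsClosed {q | h q x ≤ μ + ε} := isClosed_le (hcont x) continuous_const
  have hcv : Convex ℝ {q | h q x ≤ μ + ε} :=
    convex_of_midpoint hcl fun p hp q hq => (hqc p q x).trans (max_le hp hq)
  obtain ⟨f, u, hf1, hf2⟩ := geometric_hahn_banach_closed_point hcv hcl
    (x := gradient w x) (by simpa using hε2)
  set v := (InnerProductSpace.toDual ℝ (Ed d)).symm f with hv
  have hfv : ∀ q, f q = ⟪q, v⟫ := by
    intro q
    rw [real_inner_comm, hv, InnerProductSpace.toDual_symm_apply]
  have hder : HasDerivAt (fun t : ℝ => w (x + t • v)) (⟪gradient w x, v⟫) 0 := by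
    simpa using hasDerivAt_line (t := 0) (v := v) (x := x) (w := w) (by simpa using hx)
  have hlim := hder.tendsto_slope_zero_right
  have hle : ⟪gradient w x, v⟫ ≤ u := by
    refine le_of_tendsto hlim ?_
    have hnear : ∀ᶠ t : ℝ in 𝓝[>] 0, dist (x + t • v) x < r ε := by
      have : Tendsto (fun t : ℝ => dist (x + t • v) x) (𝓝[>] 0) (𝓝 0) := by
        have : Continuous (fun t : ℝ => dist (x + t • v) x) := by fun_prop
        have := this.tendsto 0
        simp only [zero_smul, add_zero, dist_self] at this
        exact this.mono_left nhdsWithin_le_nhds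
      exact this.eventually (gt_mem_nhds (hr ε hε))
    filter_upwards [hnear, self_mem_nhdsWithin] with t ht ht0
    have ht0' : 0 < t := ht0
    have := hw ε hε x (t • v) (t * u) (fun q hq => by
      rw [real_inner_smul_right, ← hfv]
      exact mul_le_mul_of_nonneg_left (hf1 q hq).le ht0'.le) x (by simpa using hr ε hε) ht
    simp only [zero_add, zero_smul, add_zero, smul_eq_mul]
    rw [inv_mul_le_iff₀ ht0']
    exact this
  rw [hfv] at hf2
  linarith

/-- The standing deterministic assumptions, uniformly in ω. -/
structure HH {d : ℕ} {Ω : Type*} (H : Ed d → Ed d → Ω → ℝ) : Prop where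
  cont : ∀ ω : Ω, Continuous fun q : Ed d × Ed d => H q.1 q.2 ω
  bdd : ∀ R : ℝ, 0 < R → ∃ M : ℝ, ∀ (ω : Ω) (p y : Ed d), ‖p‖ ≤ R → |H p y ω| ≤ M
  uc : ∀ R : ℝ, 0 < R → ∀ ε : ℝ, 0 < ε → ∃ δ : ℝ, 0 < δ ∧ ∀ (ω : Ω) (p p' y y' : Ed d),
      ‖p‖ ≤ R → ‖p'‖ ≤ R → ‖p - p'‖ < δ → ‖y - y'‖ < δ → |H p y ω - H p' y' ω| < ε
  coer : ∀ M : ℝ, ∃ R : ℝ, ∀ (ω : Ω) (p y : Ed d), R ≤ ‖p‖ → M ≤ H p y ω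
  qc : ∀ (ω : Ω) (p q y : Ed d), H ((1/2 : ℝ) • (p + q)) y ω ≤ max (H p y ω) (H q y ω)

section
variable {d : ℕ} {Ω : Type*} {H : Ed d → Ed d → Ω → ℝ}

lemma HH.exK (hH : HH H) (μ : ℝ) :
    ∃ K : ℝ, 0 < K ∧ ∀ ω q x, H q x ω ≤ μ → ‖q‖ ≤ K := by
  obtain ⟨R, hR⟩ := hH.coer (μ + 1)
  refine ⟨max R 1, by positivity, fun ω q x h => ?_⟩
  by_contra hcon
  push Not at hcon
  have := hR ω q x ((le_max_left _ _).trans hcon.le)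
  linarith

lemma HH.exr (hH : HH H) {K : ℝ} (hK : 0 < K) :
    ∃ r : ℝ → ℝ, (∀ ε, 0 < ε → 0 < r ε) ∧ ∀ ε, 0 < ε → ∀ ω q x z, ‖q‖ ≤ K →
      dist z x < r ε → H q x ω ≤ H q z ω + ε := by
  choose δ hδ hδ2 using fun ε : {ε : ℝ // 0 < ε} => hH.uc K hK ε.1 ε.2
  refine ⟨fun ε => if h : 0 < ε then δ ⟨ε, h⟩ else 1, ?_, ?_⟩
  · intro ε hε
    simp only [hε, dite_true]
    exact hδ _
  · intro ε hε ω q x z hq hz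
    simp only [hε, dite_true] at hz
    have := hδ2 ⟨ε, hε⟩ ω q q x z hq hq (by simpa using hδ _)
      (by rwa [← dist_eq_norm, dist_comm])
    have := (abs_lt.1 this).2
    simp only at this
    linarith

lemma HH.lower (hH : HH H) : ∃ m : ℝ, ∀ ω q x, m ≤ H q x ω := by
  obtain ⟨R, hR⟩ := hH.coer 0
  obtain ⟨M, hM⟩ := hH.bdd (max R 1) (by positivity)
  refine ⟨-|M|, fun ω q x => ?_⟩
  rcases le_total R ‖q‖ with h | h
  · exact (neg_nonpos.2 (abs_nonneg _)).trans (hR ω q x h)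
  · have h1 := hM ω q x (h.trans (le_max_left _ _))
    have h2 := (abs_le.1 h1).1
    have h3 := le_abs_self M
    linarith

lemma norm_gradient_le {w : Ed d → ℝ} {C : ℝ≥0} (hw : LipschitzWith C w) (y : Ed d) :
    ‖gradient w y‖ ≤ C := by
  have : ‖gradient w y‖ = ‖fderiv ℝ w y‖ := by
    rw [← toDual_gradient, LinearIsometryEquiv.norm_map]
  rw [this]
  exact norm_fderiv_le_of_lipschitz ℝ hw

lemma HH.ess_ae (hH : HH H) {w : Ed d → ℝ} (hw : w ∈ LipFuns d) (p : Ed d) (ω : Ω) :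
    ∀ᵐ y ∂(volume : Measure (Ed d)), H (p + gradient w y) y ω ≤
      essSup (fun y => H (p + gradient w y) y ω) volume := by
  obtain ⟨C, hC⟩ := hw
  obtain ⟨M, hM⟩ := hH.bdd (‖p‖ + C + 1) (by positivity)
  have hb : ∀ y, H (p + gradient w y) y ω ≤ M := fun y =>
    (le_abs_self _).trans (hM _ _ _ ((norm_add_le _ _).trans
      (by linarith [norm_gradient_le hC y])))
  exact ae_le_essSup ⟨M, by simpa using Eventually.of_forall hb⟩

lemma HH.ess_le (hH : HH H) {w : Ed d → ℝ} (p : Ed d) (ω : Ω) {μ : ℝ}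
    (h : ∀ᵐ y ∂(volume : Measure (Ed d)), H (p + gradient w y) y ω ≤ μ) :
    essSup (fun y => H (p + gradient w y) y ω) volume ≤ μ := by
  obtain ⟨m, hm⟩ := hH.lower
  refine essSup_le_of_ae_le _ h ?_
  exact IsBoundedUnder.isCoboundedUnder_le ⟨m, by simpa using Eventually.of_forall fun y => hm _ _ _⟩

lemma HH.le_ess (hH : HH H) : ∃ m : ℝ, ∀ (w : Ed d → ℝ) (_ : w ∈ LipFuns d) (p : Ed d) (ω : Ω),
    m ≤ essSup (fun y => H (p + gradient w y) y ω) volume := by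
  obtain ⟨m, hm⟩ := hH.lower
  refine ⟨m, fun w hw p ω => ?_⟩
  obtain ⟨y, hy⟩ := (hH.ess_ae hw p ω).exists
  exact (hm _ _ _).trans hy

lemma const_mem_SLplus : (fun _ => (0:ℝ)) ∈ SLplus d :=
  ⟨⟨0, LipschitzWith.const 0⟩, fun ε hε => ⟨0, fun y _ => by simpa using hε.le⟩⟩

lemma HH.hbar_le (hH : HH H) {w : Ed d → ℝ} (hw : w ∈ SLplus d) (p : Ed d) (ω : Ω) {μ : ℝ}
    (h : ∀ᵐ y ∂(volume : Measure (Ed d)), H (p + gradient w y) y ω ≤ μ) :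
    HbarPlusOm d H p ω ≤ μ := by
  obtain ⟨m, hm⟩ := hH.le_ess
  have hb : BddBelow {t | ∃ w ∈ SLplus d,
      t = essSup (fun y => H (p + gradient w y) y ω) volume} := by
    refine ⟨m, ?_⟩
    rintro t ⟨w, hw, rfl⟩
    exact hm w hw.1 p ω
  exact (csInf_le hb ⟨w, hw, rfl⟩).trans (hH.ess_le p ω h)

lemma HH.hbar_lt (hH : HH H) {p : Ed d} {ω : Ω} {μ : ℝ} (h : HbarPlusOm d H p ω < μ) :
    ∃ w ∈ SLplus d, ∃ μ' < μ, ∀ᵐ y ∂(volume : Measure (Ed d)), H (p + gradient w y) y ω ≤ μ' := by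
  have hne : {t | ∃ w ∈ SLplus d,
      t = essSup (fun y => H (p + gradient w y) y ω) volume}.Nonempty :=
    ⟨_, _, const_mem_SLplus, rfl⟩
  obtain ⟨t, ⟨w, hw, rfl⟩, ht⟩ := exists_lt_of_csInf_lt hne h
  exact ⟨w, hw, _, ht, hH.ess_ae hw.1 p ω⟩

lemma HH.hstar_lt (hH : HH H) {ω : Ω} {μ : ℝ} (h : HstarOm d H ω < μ) :
    ∃ w, ∃ μ' < μ, SubAE (fun q x => H q x ω) μ' w := by
  have hne : {t | ∃ w ∈ LipFuns d,
      t = essSup (fun y => H (gradient w y) y ω) volume}.Nonempty :=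
    ⟨_, _, const_mem_SLplus.1, rfl⟩
  obtain ⟨t, ⟨w, hw, rfl⟩, ht⟩ := exists_lt_of_csInf_lt hne h
  refine ⟨w, _, ht, hw, ?_⟩
  simpa using hH.ess_ae hw 0 ω

lemma lip_of_incr {w : Ed d → ℝ} {K : ℝ} (hK : 0 < K)
    (h : ∀ x y, w y - w x ≤ K * ‖y - x‖) : w ∈ LipFuns d := by
  refine ⟨K.toNNReal, LipschitzWith.of_le_add_mul _ fun x y => ?_⟩
  have := h y x
  rw [← dist_eq_norm] at this
  rw [Real.coe_toNNReal _ hK.le]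
  linarith

/-- The sequence of values of H on a countable dense set. -/
def Phi (H : Ed d → Ed d → Ω → ℝ) (ω : Ω) (n : ℕ) : ℝ :=
  H (TopologicalSpace.denseSeq (Ed d × Ed d) n).1 (TopologicalSpace.denseSeq (Ed d × Ed d) n).2 ω

lemma HH.unif (hH : HH H) {ωs : ℕ → Ω} {ω : Ω}
    (hlim : Tendsto (fun n => Phi H (ωs n)) atTop (𝓝 (Phi H ω))) {K : ℝ} (hK : 0 < K) (x : Ed d)
    {ε : ℝ} (hε : 0 < ε) :
    ∀ᶠ n in atTop, ∀ q, ‖q‖ ≤ K → |H q x (ωs n) - H q x ω| ≤ ε := by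
  obtain ⟨δ, hδ, hδ2⟩ := hH.uc (K + 1) (by linarith) (ε / 3) (by linarith)
  set δ' := min δ 1 with hδ'
  have hδ'0 : 0 < δ' := by positivity
  have hD := TopologicalSpace.denseRange_denseSeq (Ed d × Ed d)
  have hex : ∀ q : Ed d, ∃ k, dist (q, x) (TopologicalSpace.denseSeq (Ed d × Ed d) k) < δ' / 2 :=
    fun q => hD.exists_dist_lt _ (by linarith)
  choose k hk using hex
  obtain ⟨t, -, ht⟩ := (isCompact_closedBall (0 : Ed d) K).elim_nhds_subcover
    (fun q => Metric.ball q (δ' / 2)) (fun q _ => Metric.ball_mem_nhds _ (by linarith))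
  have hev : ∀ᶠ n in atTop, ∀ q ∈ t, |Phi H (ωs n) (k q) - Phi H ω (k q)| < ε / 3 := by
    rw [Filter.eventually_all_finset]
    intro q _
    have := (tendsto_pi_nhds.1 hlim) (k q)
    exact (Metric.tendsto_nhds.1 this (ε / 3) (by linarith))
  filter_upwards [hev] with n hn q hq
  have hqm := ht (by simpa using hq : q ∈ Metric.closedBall (0 : Ed d) K)
  simp only [Set.mem_iUnion] at hqm
  obtain ⟨q0, hq0, hqq0⟩ := hqm
  have h1 := hn q0 hq0
  have hk0 := hk q0
  rw [Prod.dist_eq, max_lt_iff] at hk0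
  set D := TopologicalSpace.denseSeq (Ed d × Ed d) (k q0) with hDdef
  have hd1 : dist q D.1 < δ' := by
    have := dist_triangle q q0 D.1
    have h3 : dist q q0 < δ' / 2 := hqq0
    linarith [hk0.1]
  have hd2 : dist x D.2 < δ' := by linarith [hk0.2]
  have hDn : ‖D.1‖ ≤ K + 1 := by
    have : ‖D.1‖ ≤ ‖q‖ + ‖D.1 - q‖ := by
      have := norm_add_le q (D.1 - q); simpa using this
    rw [← dist_eq_norm, dist_comm] at this
    have h4 : δ' ≤ 1 := min_le_right _ _
    linarith
  have hδδ : δ' ≤ δ := min_le_left _ _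
  have key : ∀ ω', |H q x ω' - H D.1 D.2 ω'| < ε / 3 := fun ω' =>
    hδ2 ω' q D.1 x D.2 (by linarith) hDn (by rw [← dist_eq_norm]; linarith)
      (by rw [← dist_eq_norm]; linarith)
  have k1 := abs_lt.1 (key (ωs n))
  have k2 := abs_lt.1 (key ω)
  have k3 : |H D.1 D.2 (ωs n) - H D.1 D.2 ω| < ε / 3 := h1
  have k3 := abs_lt.1 k3
  rw [abs_le]
  constructor <;> linarith [k1.1, k1.2, k2.1, k2.2, k3.1, k3.2]

/-- The event that some subsolution has a large increment. -/
def Gset (H : Ed d → Ed d → Ω → ℝ) (μ : ℝ) (y : Ed d) (a : ℝ) : Set Ω :=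
  {ω | ∃ w, SubAE (fun q x => H q x ω) μ w ∧ a ≤ w y - w 0}

lemma HH.Gset_closed (hH : HH H) (μ : ℝ) (y : Ed d) (a : ℝ) :
    Gset H μ y a = Phi H ⁻¹' closure (Phi H '' Gset H μ y a) := by
  refine Set.Subset.antisymm (fun ω hω => subset_closure ⟨ω, hω, rfl⟩) fun ω hω => ?_
  obtain ⟨xs, hxs, hlim⟩ := mem_closure_iff_seq_limit.1 hω
  choose ωs hωs hΦ using hxs
  obtain rfl : xs = fun n => Phi H (ωs n) := funext fun n => (hΦ n).symm
  choose w hw hwa using hωs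
  obtain ⟨K, hK0, hK⟩ := hH.exK μ
  obtain ⟨K', hK0', hK'⟩ := hH.exK (μ + 1)
  obtain ⟨r, hr0, hr⟩ := hH.exr hK0
  have hlip : ∀ n x y, w n y - w n x ≤ K * ‖y - x‖ := fun n x y =>
    (hw n).incr_le (fun q x => hK _ q x) x y
  have hinc : ∀ n, Inc (fun q x => H q x (ωs n)) μ r (w n) := fun n =>
    (hw n).inc (fun q x => hK _ q x) (fun ε hε q x z => hr ε hε _ q x z)
  set F : Ultrafilter ℕ := hyperfilter ℕ with hF
  have hFle : (F : Filter ℕ) ≤ atTop := Nat.hyperfilter_le_atTop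
  have hexW : ∀ x, ∃ L, Tendsto (fun n => w n x - w n 0) F (𝓝 L) := by
    intro x
    have hmem : ∀ n, w n x - w n 0 ∈ Set.Icc (-(K * ‖x‖)) (K * ‖x‖) := by
      intro n
      have h1 := hlip n 0 x
      have h2 := hlip n x 0
      simp only [sub_zero, zero_sub, norm_neg] at h1 h2
      constructor <;> linarith
    obtain ⟨L, -, hL⟩ := isCompact_Icc.ultrafilter_le_nhds (F.map fun n => w n x - w n 0)
      (by
        rw [le_principal_iff]
        exact Ultrafilter.mem_map.2 (Filter.mem_of_superset Filter.univ_mem (fun n _ => hmem n)))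
    exact ⟨L, hL⟩
  choose W hW using hexW
  have hWd : ∀ x y, Tendsto (fun n => w n y - w n x) F (𝓝 (W y - W x)) := by
    intro x y
    have := (hW y).sub (hW x)
    simpa using this
  refine ⟨W, Inc.subAE (r := fun ε => r (min (ε / 2) 1)) ?_ ?_ (fun ε hε => hr0 _ (by positivity)) ?_ ?_, ?_⟩
  · intro ε hε x v α hα z hz hzv
    set ε' := min (ε / 2) 1 with hε'
    have hε'0 : 0 < ε' := by positivity
    refine le_of_tendsto (hWd z (z + v)) ?_
    have := hFle (hH.unif hlim hK0' x hε'0)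
    filter_upwards [this] with n hn
    refine hinc n ε' hε'0 x v α (fun q hq => hα q ?_) z hz hzv
    have h1 : ε' ≤ 1 := min_le_right _ _
    have h2 : ε' ≤ ε / 2 := min_le_left _ _
    have hq' := hK' (ωs n) q x (by linarith)
    have := (abs_le.1 (hn q hq')).1
    linarith
  · exact lip_of_incr hK0 fun x y => le_of_tendsto (hWd x y) (Eventually.of_forall fun n => hlip n x y)
  · intro x
    exact (hH.cont ω).comp (by fun_prop : Continuous fun q : Ed d => (q, x))
  · exact fun p q x => hH.qc ω p q x
  · exact ge_of_tendsto (hWd 0 y) (Eventually.of_forall fun n => hwa n)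

lemma HH.Gset_meas [MeasurableSpace Ω] (hH : HH H)
    (hm : Measurable fun x : Ed d × Ed d × Ω => H x.1 x.2.1 x.2.2) (μ : ℝ) (y : Ed d) (a : ℝ) :
    MeasurableSet (Gset H μ y a) := by
  rw [hH.Gset_closed μ y a]
  have : Measurable (Phi H) := by
    refine measurable_pi_iff.2 fun n => ?_
    exact hm.comp (by fun_prop : Measurable fun ω : Ω =>
      ((TopologicalSpace.denseSeq (Ed d × Ed d) n).1,
        (TopologicalSpace.denseSeq (Ed d × Ed d) n).2, ω))
  exact this isClosed_closure.measurableSet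

end

section
variable {d : ℕ} {Ω : Type*} {H : Ed d → Ed d → Ω → ℝ}

lemma SubAE.mono {h : Ed d → Ed d → ℝ} {μ μ' : ℝ} {w : Ed d → ℝ} (hw : SubAE h μ w)
    (hμ : μ ≤ μ') : SubAE h μ' w :=
  ⟨hw.1, hw.2.mono fun _ hz => hz.trans hμ⟩

lemma HH.le_m (hH : HH H) {μ : ℝ} {ω : Ω} {w : Ed d → ℝ} (hw : SubAE (fun q x => H q x ω) μ w)
    (y x : Ed d) : w y - w x ≤ mMuOm d H μ y x ω := by
  obtain ⟨K, hK0, hK⟩ := hH.exK μ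
  have hb : BddAbove {t | ∃ w ∈ LipFuns d,
      (∀ᵐ z ∂volume, H (gradient w z) z ω ≤ μ) ∧ t = w y - w x} := by
    refine ⟨K * ‖y - x‖, ?_⟩
    rintro t ⟨w, h1, h2, rfl⟩
    exact SubAE.incr_le (h := fun q x => H q x ω) ⟨h1, h2⟩ (fun q x => hK _ q x) x y
  exact le_csSup hb ⟨w, hw.1, hw.2, rfl⟩

lemma m_le {μ : ℝ} {ω : Ω} (hex : ∃ w, SubAE (fun q x => H q x ω) μ w) {y x : Ed d} {c : ℝ}
    (h : ∀ w, SubAE (fun q x => H q x ω) μ w → w y - w x ≤ c) : mMuOm d H μ y x ω ≤ c := by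
  obtain ⟨w, hw⟩ := hex
  have hne : {t | ∃ w ∈ LipFuns d,
      (∀ᵐ z ∂volume, H (gradient w z) z ω ≤ μ) ∧ t = w y - w x}.Nonempty :=
    ⟨_, w, hw.1, hw.2, rfl⟩
  refine csSup_le hne ?_
  rintro t ⟨w, h1, h2, rfl⟩
  exact h w ⟨h1, h2⟩

lemma HH.m_incr (hH : HH H) {μ : ℝ} {ω : Ω} (hex : ∃ w, SubAE (fun q x => H q x ω) μ w)
    {x y : Ed d} {α : ℝ} (h : ∀ w, SubAE (fun q x => H q x ω) μ w → w y - w x ≤ α) :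
    mMuOm d H μ y 0 ω - mMuOm d H μ x 0 ω ≤ α := by
  have : mMuOm d H μ y 0 ω ≤ mMuOm d H μ x 0 ω + α := by
    refine m_le hex fun w hw => ?_
    have h1 := h w hw
    have h2 := hH.le_m hw x 0
    linarith
  linarith

lemma HH.m_sub (hH : HH H) {μ : ℝ} {ω : Ω} (hex : ∃ w, SubAE (fun q x => H q x ω) μ w) :
    SubAE (fun q x => H q x ω) μ (fun y => mMuOm d H μ y 0 ω) := by
  obtain ⟨K, hK0, hK⟩ := hH.exK μ
  obtain ⟨r, hr0, hr⟩ := hH.exr hK0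
  refine Inc.subAE (r := r) ?_ ?_ hr0 ?_ ?_
  · intro ε hε x v α hα z hz hzv
    exact hH.m_incr hex fun w hw => (hw.inc (fun q x => hK _ q x)
      (fun ε hε q x z => hr ε hε _ q x z)) ε hε x v α hα z hz hzv
  · exact lip_of_incr hK0 fun x y => hH.m_incr hex fun w hw => hw.incr_le (fun q x => hK _ q x) x y
  · intro x
    exact (hH.cont ω).comp (by fun_prop : Continuous fun q : Ed d => (q, x))
  · exact fun p q x => hH.qc ω p q x

lemma hasGradientAt_comb {f g : Ed d → ℝ} {f' g' x : Ed d} (a b : ℝ) (hf : HasGradientAt f f' x)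
    (hg : HasGradientAt g g' x) :
    HasGradientAt (fun y => a * f y + b * g y) (a • f' + b • g') x := by
  rw [hasGradientAt_iff_hasFDerivAt] at *
  have := (hf.const_mul a).add (hg.const_mul b)
  have e : InnerProductSpace.toDual ℝ (Ed d) (a • f' + b • g') =
      a • InnerProductSpace.toDual ℝ (Ed d) f' + b • InnerProductSpace.toDual ℝ (Ed d) g' := by
    ext v
    simp [inner_add_left, real_inner_smul_left]
  rw [e]
  exact this

lemma hasGradientAt_inner (p x : Ed d) : HasGradientAt (fun y : Ed d => ⟪p, y⟫) p x := by
  rw [hasGradientAt_iff_hasFDerivAt]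
  exact (InnerProductSpace.toDual ℝ (Ed d) p).hasFDerivAt

lemma lip_comb {f g : Ed d → ℝ} (a b : ℝ) (hf : f ∈ LipFuns d) (hg : g ∈ LipFuns d) :
    (fun y => a * f y + b * g y) ∈ LipFuns d := by
  obtain ⟨C, hC⟩ := hf
  obtain ⟨D, hD⟩ := hg
  refine ⟨‖a‖₊ * C + ‖b‖₊ * D, ?_⟩
  have h1 : LipschitzWith (‖a‖₊ * C) (fun y => a * f y) := by
    refine LipschitzWith.of_dist_le_mul fun x y => ?_
    have := hC.dist_le_mul x y
    rw [Real.dist_eq] at this ⊢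
    rw [← mul_sub, abs_mul]
    simp only [NNReal.coe_mul, coe_nnnorm, Real.norm_eq_abs]
    rw [mul_assoc]
    gcongr
  have h2 : LipschitzWith (‖b‖₊ * D) (fun y => b * g y) := by
    refine LipschitzWith.of_dist_le_mul fun x y => ?_
    have := hD.dist_le_mul x y
    rw [Real.dist_eq] at this ⊢
    rw [← mul_sub, abs_mul]
    simp only [NNReal.coe_mul, coe_nnnorm, Real.norm_eq_abs]
    rw [mul_assoc]
    gcongr
  exact h1.add h2

lemma lip_inner (p : Ed d) : (fun y : Ed d => ⟪p, y⟫) ∈ LipFuns d :=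
  ⟨_, (InnerProductSpace.toDual ℝ (Ed d) p).lipschitz⟩

lemma ae_comb {f g : Ed d → ℝ} (a b : ℝ) (hf : f ∈ LipFuns d) (hg : g ∈ LipFuns d) :
    ∀ᵐ y ∂(volume : Measure (Ed d)), gradient (fun y => a * f y + b * g y) y =
      a • gradient f y + b • gradient g y := by
  obtain ⟨C, hC⟩ := hf
  obtain ⟨D, hD⟩ := hg
  filter_upwards [hC.ae_differentiableAt, hD.ae_differentiableAt] with y h1 h2
  exact (hasGradientAt_comb a b h1.hasGradientAt h2.hasGradientAt).gradient

lemma gradient_inner (p x : Ed d) : gradient (fun y : Ed d => ⟪p, y⟫) x = p :=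
  (hasGradientAt_inner p x).gradient

/-- If `m̄` dominates the linear function of slope `p`, then `H̄(p) ≤ μ`. -/
lemma claimA [MeasurableSpace Ω] {P : Measure Ω} [IsProbabilityMeasure P] (hH : HH H) {μ : ℝ}
    (hex : ∀ᵐ ω ∂P, ∃ w, SubAE (fun q x => H q x ω) μ w) {m : Ed d → ℝ}
    (hm : ∀ y : Ed d, ∀ᵐ ω ∂P,
      Tendsto (fun t : ℝ => t⁻¹ * mMuOm d H μ (t • y) 0 ω) atTop (𝓝 (m y)))
    {p : Ed d} {c : ℝ} (hc : ∀ᵐ ω ∂P, HbarPlusOm d H p ω = c) (hp : ∀ y, ⟪p, y⟫ ≤ m y) :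
    c ≤ μ := by
  set D := TopologicalSpace.denseSeq (Ed d) with hDdef
  have hD : DenseRange D := TopologicalSpace.denseRange_denseSeq (Ed d)
  have hall : ∀ᵐ ω ∂P, ∀ n, Tendsto (fun t : ℝ => t⁻¹ * mMuOm d H μ (t • D n) 0 ω) atTop
      (𝓝 (m (D n))) := ae_all_iff.2 fun n => hm (D n)
  obtain ⟨ω, hexω, hlim, hcω⟩ := (hex.and (hall.and hc)).exists
  rw [← hcω]
  have hM := hH.m_sub hexω
  set M : Ed d → ℝ := fun y => mMuOm d H μ y 0 ω with hMdef
  obtain ⟨K, hK0, hK⟩ := hH.exK μ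
  have hMl : ∀ x y, M y - M x ≤ K * ‖y - x‖ := fun x y => hM.incr_le (fun q x => hK _ q x) x y
  refine hH.hbar_le (w := fun y => 1 * M y + (-1) * ⟪p, y⟫) ⟨lip_comb _ _ hM.1 (lip_inner p), ?_⟩ p ω ?_
  · intro ε hε
    set η := ε / (2 * (K + ‖p‖)) with hη
    have hKp : 0 < K + ‖p‖ := by positivity
    have hη0 : 0 < η := by positivity
    obtain ⟨t, ht⟩ := (isCompact_sphere (0 : Ed d) 1).elim_finite_subcover
      (fun k => Metric.ball (D k) η) (fun k => Metric.isOpen_ball) (fun e _ => by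
        obtain ⟨k, hk⟩ := hD.exists_dist_lt e hη0
        exact Set.mem_iUnion.2 ⟨k, hk⟩)
    have hev : ∀ᶠ s : ℝ in atTop, ∀ k ∈ t, m (D k) - ε / 2 < s⁻¹ * M (s • D k) := by
      rw [Filter.eventually_all_finset]
      intro k _
      exact (hlim k).eventually (lt_mem_nhds (by linarith))
    obtain ⟨R, hR⟩ := eventually_atTop.1 hev
    refine ⟨max R 1, fun y hy => ?_⟩
    have hy1 : 0 < ‖y‖ := lt_of_lt_of_le one_pos ((le_max_right _ _).trans hy)
    rw [le_div_iff₀ hy1]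
    set s := ‖y‖ with hs
    set e := s⁻¹ • y with he
    have hye : y = s • e := by rw [he, smul_smul, mul_inv_cancel₀ hy1.ne', one_smul]
    have hesph : e ∈ Metric.sphere (0 : Ed d) 1 := by
      rw [mem_sphere_zero_iff_norm, he, norm_smul, norm_inv, norm_norm, ← hs, inv_mul_cancel₀ hy1.ne']
    obtain ⟨k, hk, hek⟩ := Set.mem_iUnion₂.1 (ht hesph)
    have h1 := hR s ((le_max_left _ _).trans hy) k hk
    rw [← div_eq_inv_mul, lt_div_iff₀ hy1] at h1
    have h2 := hMl y (s • D k)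
    have hdk : ‖D k - e‖ < η := by rw [← dist_eq_norm, dist_comm]; exact hek
    have h3 : ‖s • D k - y‖ = s * ‖D k - e‖ := by
      conv_lhs => rw [hye]
      rw [← smul_sub, norm_smul, Real.norm_of_nonneg hy1.le]
    have h4 : ⟪p, y⟫ = s * ⟪p, D k⟫ - s * ⟪p, D k - e⟫ := by
      conv_lhs => rw [hye]
      rw [real_inner_smul_right, inner_sub_right]; ring
    have h5 : |⟪p, D k - e⟫| ≤ ‖p‖ * ‖D k - e‖ := abs_real_inner_le_norm _ _
    have h5' := (abs_le.1 h5).1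
    have h6 := hp (D k)
    have h7 : (K + ‖p‖) * ‖D k - e‖ ≤ ε / 2 := by
      calc (K + ‖p‖) * ‖D k - e‖ ≤ (K + ‖p‖) * η := by gcongr
        _ = ε / 2 := by rw [hη]; field_simp
    rw [h3] at h2
    show -ε * s ≤ 1 * M y + -1 * ⟪p, y⟫
    rw [h4]
    have h8 : s * ⟪p, D k⟫ ≤ s * m (D k) := by gcongr
    have h9 : s * ((K + ‖p‖) * ‖D k - e‖) ≤ s * (ε / 2) := by gcongr
    have h10 : s * (-(‖p‖ * ‖D k - e‖)) ≤ s * ⟪p, D k - e⟫ := by gcongr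
    nlinarith
  · filter_upwards [hM.2, ae_comb 1 (-1) hM.1 (lip_inner p)] with y h1 h2
    rw [h2, gradient_inner]
    convert h1 using 2
    module

lemma avg {Λ : ℝ → ℝ → ℝ}
    (hΛmono : ∀ a b a' b' : ℝ, a ≤ a' → b ≤ b' → Λ a b ≤ Λ a' b') {h : Ed d → Ed d → ℝ}
    (hsqc : ∀ (p q y : Ed d), h ((1/2 : ℝ) • (p + q)) y ≤ Λ (h p y) (h q y)) {a b : ℝ}
    {f g : Ed d → ℝ} (hf : SubAE h a f) (hg : SubAE h b g) :
    SubAE h (Λ a b) (fun y => (1/2) * f y + (1/2) * g y) := by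
  refine ⟨lip_comb _ _ hf.1 hg.1, ?_⟩
  filter_upwards [hf.2, hg.2, ae_comb (1/2) (1/2) hf.1 hg.1] with y h1 h2 h3
  rw [h3, ← smul_add]
  exact (hsqc _ _ _).trans (hΛmono _ _ _ _ h1 h2)

lemma comb_n {Λ : ℝ → ℝ → ℝ} (hΛcont : Continuous fun m : ℝ × ℝ => Λ m.1 m.2)
    (hΛmono : ∀ a b a' b' : ℝ, a ≤ a' → b ≤ b' → Λ a b ≤ Λ a' b')
    (hΛstrict : ∀ a b : ℝ, a ≠ b → Λ a b < max a b) {h : Ed d → Ed d → ℝ}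
    (hsqc : ∀ (p q y : Ed d), h ((1/2 : ℝ) • (p + q)) y ≤ Λ (h p y) (h q y)) {μ μ' : ℝ}
    (hμ : μ' < μ) {u : Ed d → ℝ} (hu : SubAE h μ' u) (n : ℕ) :
    ∃ ε > 0, ∃ l < μ, ∀ φ, SubAE h (μ + ε) φ →
      SubAE h l (fun y => (1 - (1/2 : ℝ)^n) * φ y + (1/2 : ℝ)^n * u y) := by
  induction n with
  | zero => exact ⟨1, one_pos, μ', hμ, fun φ _ => by simpa using hu⟩
  | succ n ih =>
    obtain ⟨ε, hε, l, hl, ih⟩ := ih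
    have h0 : Λ (μ + 0) l < μ := by
      have := hΛstrict μ l hl.ne'
      rw [max_eq_left hl.le] at this
      simpa using this
    have hc : Continuous fun e : ℝ => Λ (μ + e) l :=
      hΛcont.comp (by fun_prop : Continuous fun e : ℝ => (μ + e, l))
    have hev : ∀ᶠ e in 𝓝 (0:ℝ), Λ (μ + e) l < μ := (hc.tendsto 0).eventually (gt_mem_nhds h0)
    obtain ⟨e, he, he0⟩ := ((hev.filter_mono nhdsWithin_le_nhds).and
      (self_mem_nhdsWithin : Set.Ioi (0:ℝ) ∈ 𝓝[>] (0:ℝ))).exists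
    have he0' : 0 < e := he0
    refine ⟨min e ε, by positivity, Λ (μ + e) l, he, fun φ hφ => ?_⟩
    have h1 := ih φ (hφ.mono (by gcongr; exact min_le_right _ _))
    have h2 := avg hΛmono hsqc (hφ.mono (by gcongr; exact min_le_left _ _ : μ + min e ε ≤ μ + e)) h1
    convert h2 using 2
    ring

/-- If `H̄(p) ≤ μ` then `m̄` dominates the linear function of slope `p`. -/
lemma claimB [MeasurableSpace Ω] {P : Measure Ω} [IsProbabilityMeasure P] (hH : HH H) 
    {Λ : ℝ → ℝ → ℝ} (hΛcont : Continuous fun m : ℝ × ℝ => Λ m.1 m.2)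
    (hΛmono : ∀ a b a' b' : ℝ, a ≤ a' → b ≤ b' → Λ a b ≤ Λ a' b')
    (hΛstrict : ∀ a b : ℝ, a ≠ b → Λ a b < max a b)
    (hsqc : ∀ (ω : Ω) (p q y : Ed d), H ((1/2 : ℝ) • (p + q)) y ω ≤ Λ (H p y ω) (H q y ω))
    {μ : ℝ} (hex : ∀ᵐ ω ∂P, ∃ w, ∃ μ' < μ, SubAE (fun q x => H q x ω) μ' w) {m : Ed d → ℝ}
    (hm : ∀ y : Ed d, ∀ᵐ ω ∂P,
      Tendsto (fun t : ℝ => t⁻¹ * mMuOm d H μ (t • y) 0 ω) atTop (𝓝 (m y)))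
    (hm0 : m 0 = 0)
    {p : Ed d} {c : ℝ} (hc : ∀ᵐ ω ∂P, HbarPlusOm d H p ω = c) (hp : c ≤ μ) (y : Ed d) :
    ⟪p, y⟫ ≤ m y := by
  rcases eq_or_ne y 0 with rfl | hy
  · simp [hm0]
  have hy0 : 0 < ‖y‖ := norm_pos_iff.2 hy
  obtain ⟨ω, ⟨u, μ', hμ', hu⟩, hlim, hcω⟩ := (hex.and ((hm y).and hc)).exists
  obtain ⟨C, hC⟩ := hu.1
  have key : ∀ n : ℕ, (1 - (1/2 : ℝ)^n) * (⟪p, y⟫ - (1/2 : ℝ)^n * ‖y‖) - (1/2 : ℝ)^n * (C * ‖y‖)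
      ≤ m y := by
    intro n
    obtain ⟨ε, hε, l, hl, hcomb⟩ := comb_n hΛcont hΛmono hΛstrict (h := fun q x => H q x ω)
      (fun p q x => hsqc ω p q x) hμ' hu n
    obtain ⟨w, hw, μ'', hμ'', hwae⟩ := hH.hbar_lt (p := p) (ω := ω) (μ := μ + ε) (by rw [hcω]; linarith)
    have hφ : SubAE (fun q x => H q x ω) (μ + ε) (fun y => 1 * ⟪p, y⟫ + 1 * w y) := by
      refine ⟨lip_comb _ _ (lip_inner p) hw.1, ?_⟩
      filter_upwards [hwae, ae_comb 1 1 (lip_inner p) hw.1] with y h1 h2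
      rw [h2, gradient_inner, one_smul, one_smul]
      exact h1.trans hμ''.le
    have hψ := (hcomb _ hφ).mono hl.le
    set s : ℝ := (1/2 : ℝ)^n with hs
    have hs0 : 0 < s := by positivity
    have hs1 : s ≤ 1 := pow_le_one₀ (by norm_num) (by norm_num)
    obtain ⟨R, hR⟩ := hw.2 s hs0
    have hlim2 : Tendsto (fun t : ℝ => (1 - s) * (⟪p, y⟫ - s * ‖y‖ - t⁻¹ * w 0) - s * (C * ‖y‖)) atTop
        (𝓝 ((1 - s) * (⟪p, y⟫ - s * ‖y‖ - 0 * w 0) - s * (C * ‖y‖))) := by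
      exact (((tendsto_const_nhds.sub (tendsto_inv_atTop_zero.mul_const _)).const_mul _).sub_const _)
    simp only [zero_mul, sub_zero] at hlim2
    refine le_of_tendsto_of_tendsto hlim2 hlim ?_
    filter_upwards [eventually_gt_atTop 0, eventually_ge_atTop (R / ‖y‖)] with t ht0 htR
    have h1 := hH.le_m hψ (t • y) 0
    have hty : ‖t • y‖ = t * ‖y‖ := by rw [norm_smul, Real.norm_of_nonneg ht0.le]
    have h2 := hR (t • y) (by rw [hty]; rwa [div_le_iff₀ hy0] at htR)
    rw [hty, le_div_iff₀ (by positivity)] at h2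
    have h3 := hC.dist_le_mul 0 (t • y)
    rw [Real.dist_eq, dist_zero_left, hty] at h3
    have h3 := (abs_le.1 h3).2
    rw [← div_eq_inv_mul, ← div_eq_inv_mul, le_div_iff₀ ht0]
    refine le_trans ?_ h1
    simp only [real_inner_smul_right, inner_zero_right]
    have h4 : s * (u 0 - u (t • y)) ≤ s * (C * (t * ‖y‖)) := by gcongr
    have h5 : (1 - s) * (-s * (t * ‖y‖)) ≤ (1 - s) * w (t • y) :=
      mul_le_mul_of_nonneg_left h2 (by linarith)
    have h6 : w 0 / t * t = w 0 := by field_simp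
    have h7 : ((1 - s) * (⟪p, y⟫ - s * ‖y‖ - w 0 / t) - s * (C * ‖y‖)) * t =
      (1 - s) * (⟪p, y⟫ * t - s * ‖y‖ * t - w 0 / t * t) - s * (C * ‖y‖) * t := by ring
    rw [h7, h6]
    linarith
  have hpow : Tendsto (fun n : ℕ => (1/2 : ℝ)^n) atTop (𝓝 0) :=
    tendsto_pow_atTop_nhds_zero_of_lt_one (by norm_num) (by norm_num)
  have hfin : Tendsto (fun n : ℕ => (1 - (1/2 : ℝ)^n) * (⟪p, y⟫ - (1/2 : ℝ)^n * ‖y‖)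
      - (1/2 : ℝ)^n * (C * ‖y‖)) atTop (𝓝 ((1 - 0) * (⟪p, y⟫ - 0 * ‖y‖) - 0 * (C * ‖y‖))) :=
    ((hpow.const_sub 1).mul ((hpow.mul_const _).const_sub _)).sub (hpow.mul_const _)
  simp only [sub_zero, zero_mul, one_mul] at hfin
  exact le_of_tendsto hfin (Eventually.of_forall key)

lemma SubAE.shift {τ : Ed d → Ω → Ω}
    (hHstat : ∀ (p y z : Ed d) (ω : Ω), H p y (τ z ω) = H p (y + z) ω) {μ : ℝ} {ω : Ω}
    {w : Ed d → ℝ} (hw : SubAE (fun q x => H q x ω) μ w) (s : Ed d) :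
    SubAE (fun q x => H q x (τ s ω)) μ (fun x => w (x + s)) := by
  obtain ⟨⟨C, hC⟩, hae⟩ := hw
  refine ⟨⟨C, LipschitzWith.of_dist_le_mul fun x y => ?_⟩, ?_⟩
  · simpa using hC.dist_le_mul (x + s) (y + s)
  · have := (measurePreserving_add_right (volume : Measure (Ed d)) s).quasiMeasurePreserving.ae hae
    filter_upwards [this] with x hx
    have hg : gradient (fun x => w (x + s)) x = gradient w (x + s) := by
      unfold gradient
      rw [fderiv_comp_add_right]
    rw [hg, hHstat]
    exact hx

lemma tendsto_G_zero [MeasurableSpace Ω] {P : Measure Ω} [IsProbabilityMeasure P] (hH : HH H)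
    (hmeas : Measurable fun x : Ed d × Ed d × Ω => H x.1 x.2.1 x.2.2) {μ : ℝ} {y : Ed d} {c c' : ℝ}
    (hm : ∀ᵐ ω ∂P, Tendsto (fun t : ℝ => t⁻¹ * mMuOm d H μ (t • y) 0 ω) atTop (𝓝 c))
    (hc : c < c') :
    Tendsto (fun n : ℕ => P (Gset H μ ((n : ℝ) • y) (n * c'))) atTop (𝓝 0) := by
  rw [← measure_empty (μ := P)]
  refine tendsto_measure_of_ae_tendsto_indicator_of_isFiniteMeasure _ MeasurableSet.empty
    (fun n => hH.Gset_meas hmeas _ _ _) ?_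
  filter_upwards [hm] with ω hω
  filter_upwards [(hω.comp tendsto_natCast_atTop_atTop).eventually (gt_mem_nhds hc),
    eventually_gt_atTop 0] with n hn hn0
  simp only [Set.mem_empty_iff_false, iff_false]
  rintro ⟨w, hw, hwa⟩
  have h1 := hH.le_m hw ((n : ℝ) • y) 0
  have hn0' : (0 : ℝ) < n := by exact_mod_cast hn0
  simp only [Function.comp] at hn
  rw [← div_eq_inv_mul, div_lt_iff₀ hn0'] at hn
  linarith

lemma tendsto_G_one [MeasurableSpace Ω] {P : Measure Ω} [IsProbabilityMeasure P] (hH : HH H)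
    (hmeas : Measurable fun x : Ed d × Ed d × Ω => H x.1 x.2.1 x.2.2) {μ : ℝ} {y : Ed d} {c c' : ℝ}
    (hex : ∀ᵐ ω ∂P, ∃ w, SubAE (fun q x => H q x ω) μ w)
    (hm : ∀ᵐ ω ∂P, Tendsto (fun t : ℝ => t⁻¹ * mMuOm d H μ (t • y) 0 ω) atTop (𝓝 c))
    (hc : c' < c) :
    Tendsto (fun n : ℕ => P (Gset H μ ((n : ℝ) • y) (n * c'))ᶜ) atTop (𝓝 0) := by
  rw [← measure_empty (μ := P)]
  refine tendsto_measure_of_ae_tendsto_indicator_of_isFiniteMeasure _ MeasurableSet.empty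
    (fun n => (hH.Gset_meas hmeas _ _ _).compl) ?_
  filter_upwards [hm, hex] with ω hω hexω
  filter_upwards [(hω.comp tendsto_natCast_atTop_atTop).eventually (lt_mem_nhds hc),
    eventually_gt_atTop 0] with n hn hn0
  simp only [Set.mem_empty_iff_false, iff_false, Set.mem_compl_iff, not_not]
  by_contra hcon
  have hn0' : (0 : ℝ) < n := by exact_mod_cast hn0
  simp only [Function.comp] at hn
  rw [← div_eq_inv_mul, lt_div_iff₀ hn0'] at hn
  have : mMuOm d H μ ((n : ℝ) • y) 0 ω ≤ n * c' := by
    refine m_le hexω fun w hw => ?_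
    by_contra h
    exact hcon ⟨w, hw, by linarith⟩
  linarith

/-- `m̄` is subadditive. -/
lemma subadd [MeasurableSpace Ω] {P : Measure Ω} [IsProbabilityMeasure P] (hH : HH H)
    (hmeas : Measurable fun x : Ed d × Ed d × Ω => H x.1 x.2.1 x.2.2)
    {τ : Ed d → Ω → Ω} (hτmp : ∀ y : Ed d, MeasurePreserving (τ y) P P)
    (hHstat : ∀ (p y z : Ed d) (ω : Ω), H p y (τ z ω) = H p (y + z) ω) {μ : ℝ}
    (hex : ∀ᵐ ω ∂P, ∃ w, SubAE (fun q x => H q x ω) μ w) {m : Ed d → ℝ}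
    (hm : ∀ y : Ed d, ∀ᵐ ω ∂P,
      Tendsto (fun t : ℝ => t⁻¹ * mMuOm d H μ (t • y) 0 ω) atTop (𝓝 (m y))) (y z : Ed d) :
    m (y + z) ≤ m y + m z := by
  refine le_of_forall_pos_le_add fun ε hε => ?_
  have hA := tendsto_G_one (c' := m (y + z) - ε / 3) hH hmeas hex (hm (y + z)) (by linarith)
  have hB := tendsto_G_zero (c' := m y + ε / 3) hH hmeas (hm y) (by linarith)
  have hC := tendsto_G_zero (c' := m z + ε / 3) hH hmeas (hm z) (by linarith)
  have hsum := (hA.add hB).add hC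
  simp only [add_zero] at hsum
  obtain ⟨n, hn, hn0⟩ := ((hsum.eventually (gt_mem_nhds one_pos)).and (eventually_gt_atTop 0)).exists
  have hn0' : (0 : ℝ) < n := by exact_mod_cast hn0
  have hpre : P (τ ((n : ℝ) • y) ⁻¹' Gset H μ ((n : ℝ) • z) (n * (m z + ε / 3))) =
      P (Gset H μ ((n : ℝ) • z) (n * (m z + ε / 3))) :=
    (hτmp _).measure_preimage (hH.Gset_meas hmeas _ _ _).nullMeasurableSet
  rw [← hpre] at hn
  have hlt : P (((Gset H μ ((n : ℝ) • (y + z)) (n * (m (y + z) - ε / 3)))ᶜ ∪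
      Gset H μ ((n : ℝ) • y) (n * (m y + ε / 3))) ∪
      τ ((n : ℝ) • y) ⁻¹' Gset H μ ((n : ℝ) • z) (n * (m z + ε / 3))) < 1 :=
    ((measure_union_le _ _).trans (by gcongr; exact measure_union_le _ _)).trans_lt hn
  have hne : ∃ ω, ω ∉ (((Gset H μ ((n : ℝ) • (y + z)) (n * (m (y + z) - ε / 3)))ᶜ ∪
      Gset H μ ((n : ℝ) • y) (n * (m y + ε / 3))) ∪
      τ ((n : ℝ) • y) ⁻¹' Gset H μ ((n : ℝ) • z) (n * (m z + ε / 3))) := by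
    by_contra hcon
    push Not at hcon
    rw [Set.eq_univ_of_forall hcon, measure_univ] at hlt
    exact lt_irrefl _ hlt
  obtain ⟨ω, hω⟩ := hne
  simp only [Set.mem_union, Set.mem_compl_iff, Set.mem_preimage, not_or, not_not] at hω
  obtain ⟨⟨⟨w, hw, hwa⟩, hb⟩, hc⟩ := hω
  have h1 : w ((n : ℝ) • y) - w 0 < n * (m y + ε / 3) := by
    by_contra h
    exact hb ⟨w, hw, not_lt.1 h⟩
  have h2 : w ((n : ℝ) • z + (n : ℝ) • y) - w (0 + (n : ℝ) • y) < n * (m z + ε / 3) := by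
    by_contra h
    exact hc ⟨_, hw.shift hHstat _, not_lt.1 h⟩
  rw [zero_add, ← smul_add, add_comm z y] at h2
  have h3 : n * (m (y + z) - ε / 3) < n * ((m y + ε / 3) + (m z + ε / 3)) := by linarith
  have := lt_of_mul_lt_mul_left h3 hn0'.le
  linarith

end

section
variable {d : ℕ} {Ω : Type*} {H : Ed d → Ed d → Ω → ℝ}

lemma mbar_zero [MeasurableSpace Ω] {P : Measure Ω} [IsProbabilityMeasure P] (hH : HH H) {μ : ℝ}
    (hex : ∀ᵐ ω ∂P, ∃ w, SubAE (fun q x => H q x ω) μ w) {m : Ed d → ℝ}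
    (hm : ∀ y : Ed d, ∀ᵐ ω ∂P,
      Tendsto (fun t : ℝ => t⁻¹ * mMuOm d H μ (t • y) 0 ω) atTop (𝓝 (m y))) : m 0 = 0 := by
  obtain ⟨ω, hexω, hlim⟩ := (hex.and (hm 0)).exists
  have h0 : mMuOm d H μ 0 0 ω = 0 := by
    apply le_antisymm
    · exact m_le hexω fun w _ => by simp
    · obtain ⟨w, hw⟩ := hexω
      simpa using hH.le_m hw 0 0
  simp only [smul_zero, h0, mul_zero] at hlim
  exact tendsto_nhds_unique hlim tendsto_const_nhds

lemma mbar_hom [MeasurableSpace Ω] {P : Measure Ω} [IsProbabilityMeasure P] {μ : ℝ}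
    {m : Ed d → ℝ}
    (hm : ∀ y : Ed d, ∀ᵐ ω ∂P,
      Tendsto (fun t : ℝ => t⁻¹ * mMuOm d H μ (t • y) 0 ω) atTop (𝓝 (m y)))
    (s : ℝ) (hs : 0 < s) (x : Ed d) : m (s • x) = s * m x := by
  obtain ⟨ω, h1, h2⟩ := ((hm (s • x)).and (hm x)).exists
  have h3 := (h2.comp (tendsto_id.atTop_mul_const hs)).const_mul s
  refine tendsto_nhds_unique h1 (h3.congr' ?_)
  filter_upwards [eventually_gt_atTop 0] with t ht
  simp only [Function.comp, id, smul_smul]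
  field_simp

lemma touch_above {m φ : Ed d → ℝ} {x₀ : Ed d} (hsub : ∀ y z, m (y + z) ≤ m y + m z)
    (hhom : ∀ s : ℝ, 0 < s → ∀ x, m (s • x) = s * m x) (hφ : DifferentiableAt ℝ φ x₀)
    (hmax : IsLocalMax (fun y => m y - φ y) x₀) (h : Ed d) : ⟪gradient φ x₀, h⟫ ≤ m h := by
  have hd := hasDerivAt_line (w := φ) (x := x₀) (v := -h) (t := 0) (by simpa using hφ)
  have hs := hd.tendsto_slope_zero_right
  have hc : Tendsto (fun t : ℝ => x₀ + t • (-h)) (𝓝[>] 0) (𝓝 x₀) := by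
    have : Continuous fun t : ℝ => x₀ + t • (-h) := by fun_prop
    have := this.tendsto 0
    simp only [zero_smul, add_zero] at this
    exact this.mono_left nhdsWithin_le_nhds
  simp only [zero_smul, add_zero, zero_add, inner_neg_right, smul_eq_mul] at hs
  have : -(m h) ≤ -⟪gradient φ x₀, h⟫ := by
    refine ge_of_tendsto hs ?_
    filter_upwards [hc.eventually hmax, self_mem_nhdsWithin] with t ht ht0
    have ht0 : 0 < t := ht0
    have h1 := hsub (x₀ + t • (-h)) (t • h)
    rw [hhom t ht0, smul_neg, neg_add_cancel_right] at h1
    rw [smul_neg] at ht ⊢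
    rw [← div_eq_inv_mul, le_div_iff₀ ht0]
    linarith
  linarith

lemma touch_below {m φ : Ed d → ℝ} {x₀ : Ed d}
    (hhom : ∀ s : ℝ, 0 < s → ∀ x, m (s • x) = s * m x) (hφ : DifferentiableAt ℝ φ x₀)
    (hmin : IsLocalMin (fun y => m y - φ y) x₀) : ⟪gradient φ x₀, x₀⟫ = m x₀ := by
  have hd := hasDerivAt_line (w := φ) (x := 0) (v := x₀) (t := 1) (by simpa using hφ)
  simp only [zero_add, one_smul] at hd
  have h2 := ((hasDerivAt_id (1:ℝ)).mul_const (m x₀)).sub hd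
  have hc : Tendsto (fun t : ℝ => t • x₀) (𝓝 1) (𝓝 x₀) := by
    have : Continuous fun t : ℝ => t • x₀ := by fun_prop
    simpa using this.tendsto 1
  have hl : IsLocalMin ((fun t : ℝ => id t * m x₀) - fun t : ℝ => φ (t • x₀)) 1 := by
    filter_upwards [hc.eventually hmin, lt_mem_nhds (zero_lt_one : (0:ℝ) < 1)] with t ht ht0
    rw [hhom t ht0] at ht
    simpa using ht
  have := hl.hasDerivAt_eq_zero h2
  linarith

lemma hbar_open [MeasurableSpace Ω] {P : Measure Ω} [IsProbabilityMeasure P] (hH : HH H)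
    {HbarP : Ed d → ℝ} (hc : ∀ p : Ed d, ∀ᵐ ω ∂P, HbarPlusOm d H p ω = HbarP p) {μ : ℝ}
    {p : Ed d} (hp : HbarP p < μ) (x : Ed d) : ∃ η : ℝ, 0 < η ∧ HbarP (p + η • x) ≤ μ := by
  set μ₂ := (HbarP p + μ) / 2 with hμ₂
  obtain ⟨K, hK0, hK⟩ := hH.exK μ
  obtain ⟨δ, hδ, hδ2⟩ := hH.uc (K + 1) (by linarith) (μ - μ₂) (by linarith)
  have hc0 : Tendsto (fun t : ℝ => ‖t • x‖) (𝓝[>] 0) (𝓝 0) := by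
    have : Continuous fun t : ℝ => ‖t • x‖ := by fun_prop
    have := this.tendsto 0
    simp only [zero_smul, norm_zero] at this
    exact this.mono_left nhdsWithin_le_nhds
  obtain ⟨η, h1, h2⟩ := ((hc0.eventually (gt_mem_nhds (by positivity : 0 < min δ 1))).and
    self_mem_nhdsWithin).exists
  refine ⟨η, h2, ?_⟩
  obtain ⟨ω, hω1, hω2⟩ := ((hc p).and (hc (p + η • x))).exists
  obtain ⟨w, hw, μ', hμ', hae⟩ := hH.hbar_lt (p := p) (ω := ω) (μ := μ₂) (by rw [hω1]; linarith)
  rw [← hω2]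
  refine hH.hbar_le hw _ _ ?_
  filter_upwards [hae] with y hy
  have hn := hK ω _ y (by linarith : H (p + gradient w y) y ω ≤ μ)
  have e : p + η • x + gradient w y = (p + gradient w y) + η • x := by abel
  rw [e]
  have h3 := hδ2 ω ((p + gradient w y) + η • x) (p + gradient w y) y y
    ((norm_add_le _ _).trans (by linarith [h1.trans_le (min_le_right _ _)])) (by linarith)
    (by rw [add_sub_cancel_left]; exact h1.trans_le (min_le_left _ _)) (by simpa using hδ)
  have := (abs_lt.1 h3).2
  linarith

end

/-- m̄_μ is the maximal solution of the homogenized metric problem. -/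
theorem statement_17
    (d : ℕ) (hd : 0 < d)
    {Ω : Type*} [MeasurableSpace Ω] (P : Measure Ω) [IsProbabilityMeasure P]
    (τ : Ed d → Ω → Ω)
    (hτmeas : ∀ y : Ed d, Measurable (τ y))
    (hτmp : ∀ y : Ed d, MeasurePreserving (τ y) P P)
    (hτgrp : ∀ x y : Ed d, τ (x + y) = τ x ∘ τ y)
    (hτzero : τ 0 = id)
    (hτerg : ∀ A : Set Ω, MeasurableSet A → (∀ z : Ed d, τ z ⁻¹' A = A) → P A = 0 ∨ P A = 1)
    (H : Ed d → Ed d → Ω → ℝ)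
    (hHmeas : Measurable fun x : Ed d × Ed d × Ω => H x.1 x.2.1 x.2.2)
    (hHstat : ∀ (p y z : Ed d) (ω : Ω), H p y (τ z ω) = H p (y + z) ω)
    (hHcont : ∀ ω : Ω, Continuous fun q : Ed d × Ed d => H q.1 q.2 ω)
    (hreg_bdd : ∀ R : ℝ, 0 < R → ∃ M : ℝ, ∀ (ω : Ω) (p y : Ed d), ‖p‖ ≤ R → |H p y ω| ≤ M)
    (hreg_uc : ∀ R : ℝ, 0 < R → ∀ ε : ℝ, 0 < ε → ∃ δ : ℝ, 0 < δ ∧ ∀ (ω : Ω) (p p' y y' : Ed d),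
      ‖p‖ ≤ R → ‖p'‖ ≤ R → ‖p - p'‖ < δ → ‖y - y'‖ < δ → |H p y ω - H p' y' ω| < ε)
    (hcoer : ∀ M : ℝ, ∃ R : ℝ, ∀ (ω : Ω) (p y : Ed d), R ≤ ‖p‖ → M ≤ H p y ω)
    (hqc : ∀ (ω : Ω) (p q y : Ed d), H ((1/2 : ℝ) • (p + q)) y ω ≤ max (H p y ω) (H q y ω))
    (Λ : ℝ → ℝ → ℝ)
    (hΛcont : Continuous fun m : ℝ × ℝ => Λ m.1 m.2)
    (hΛmono : ∀ a b a' b' : ℝ, a ≤ a' → b ≤ b' → Λ a b ≤ Λ a' b')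
    (hΛstrict : ∀ a b : ℝ, a ≠ b → Λ a b < max a b)
    (hsqc : ∀ (ω : Ω) (p q y : Ed d), H ((1/2 : ℝ) • (p + q)) y ω ≤ Λ (H p y ω) (H q y ω))
    (HbarP : Ed d → ℝ) (hHbarP : ∀ p : Ed d, ∀ᵐ ω ∂P, HbarPlusOm d H p ω = HbarP p)
    (Hs : ℝ) (hHs : ∀ᵐ ω ∂P, HstarOm d H ω = Hs)
    (mbar : ℝ → Ed d → ℝ)
    (hmbar : ∀ μ : ℝ, Hs < μ → ∀ y : Ed d, ∀ᵐ ω ∂P,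
      Tendsto (fun t : ℝ => t⁻¹ * mMuOm d H μ (t • y) 0 ω) atTop (𝓝 (mbar μ y))) :
    ∀ μ : ℝ, Hs < μ →
      mbar μ 0 = 0 ∧
      ViscSub d (fun q _ => HbarP q) μ Set.univ (mbar μ) ∧
      ViscSuper d (fun q _ => HbarP q) μ ({(0 : Ed d)}ᶜ) (mbar μ) ∧
      ∀ w ∈ LipFuns d, (∀ᵐ y ∂volume, HbarP (gradient w y) ≤ μ) →
        ∀ y : Ed d, w y - w 0 ≤ mbar μ y := by
  have hH : HH H := ⟨hHcont, hreg_bdd, hreg_uc, hcoer, hqc⟩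
  intro μ hμ
  have hm := hmbar μ hμ
  have hex : ∀ᵐ ω ∂P, ∃ w, ∃ μ' < μ, SubAE (fun q x => H q x ω) μ' w := by
    filter_upwards [hHs] with ω hω
    exact hH.hstar_lt (by rw [hω]; exact hμ)
  have hex' : ∀ᵐ ω ∂P, ∃ w, SubAE (fun q x => H q x ω) μ w := by
    filter_upwards [hex] with ω hω
    obtain ⟨w, μ', h1, h2⟩ := hω
    exact ⟨w, h2.mono h1.le⟩
  have hm0 : mbar μ 0 = 0 := mbar_zero hH hex' hm
  have hhom := mbar_hom hm
  have hB : ∀ p, HbarP p ≤ μ → ∀ y, ⟪p, y⟫ ≤ mbar μ y := fun p hp y =>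
    claimB hH hΛcont hΛmono hΛstrict hsqc hex hm hm0 (hHbarP p) hp y
  refine ⟨hm0, ?_, ?_, ?_⟩
  · intro φ x₀ _ hφ hmax
    refine claimA hH hex' hm (hHbarP _) ?_
    exact touch_above (subadd hH hHmeas hτmp hHstat hex' hm) hhom
      (hφ.differentiableAt one_ne_zero) (by rwa [isLocalMaxOn_univ_iff] at hmax)
  · intro φ x₀ hx₀ hφ hmin
    by_contra hcon
    push Not at hcon
    have hmin' : IsLocalMin (fun y => mbar μ y - φ y) x₀ :=
      hmin.isLocalMin (isOpen_compl_singleton.mem_nhds hx₀)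
    have h1 := touch_below hhom (hφ.differentiableAt one_ne_zero) hmin'
    have hx0 : x₀ ≠ 0 := hx₀
    obtain ⟨η, hη, h2⟩ := hbar_open hH hHbarP hcon x₀
    have h3 := hB _ h2 x₀
    rw [inner_add_left, real_inner_smul_left, real_inner_self_eq_norm_sq, h1] at h3
    have : 0 < η * ‖x₀‖ ^ 2 := by
      have := norm_pos_iff.2 hx0
      positivity
    linarith
  · rintro w ⟨C, hC⟩ hw y
    have := FL hC isOpen_univ convex_univ (v := y) (α := mbar μ y) (z := 0) (by
      filter_upwards [hw] with z hz _
      exact hB _ hz y) trivial trivial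
    simpa using this
end
end

section
/- Fix p ∈ ℝ^d and C > 0. Suppose that for each δ > 0, v^δ : ℝ^d × Ω → ℝ is jointly measurable and, for every ω ∈ Ω: v^δ(·,ω) is Lipschitz with constant C, |δ v^δ(y,ω)| ≤ C for all y, v^δ(·,ω) is a viscosity solution of δ v + H(p+Dv, y, ω) = 0 in ℝ^d, and v^δ(y+z, ω) = v^δ(y, τ_z ω) for all y, z. Define h_*(p,ω) := liminf_{δ→0} (−δ v^δ(0,ω)) and h^*(p,ω) := limsup_{δ→0} (−δ v^δ(0,ω)). Then h_*(p,·) and h^*(p,·) are almost surely equal to constants h_*(p) and h^*(p), and there is an event Ω₂ ∈ 𝓕 of full probability such that for every ω ∈ Ω₂ and every R > 0: h_*(p) = liminf_{δ→0} inf_{|y| ≤ R/δ} (−δ v^δ(y,ω)) and h^*(p) = limsup_{δ→0} sup_{|y| ≤ R/δ} (−δ v^δ(y,ω)). -/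
open MeasureTheory Filter Topology Bornology
open scoped RealInnerProductSpace NNReal

noncomputable section

/-- Viscosity subsolution property for δ v + G(Dv,y) ≤ 0 in ℝ^d. -/
def ViscSubDelta (d : ℕ) (G : Ed d → Ed d → ℝ) (δ : ℝ) (v : Ed d → ℝ) : Prop :=
  ∀ (φ : Ed d → ℝ) (x₀ : Ed d), ContDiffAt ℝ 1 φ x₀ →
    IsLocalMax (fun y => v y - φ y) x₀ → δ * v x₀ + G (gradient φ x₀) x₀ ≤ 0

/-- Viscosity supersolution property for δ v + G(Dv,y) ≥ 0 in ℝ^d. -/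
def ViscSuperDelta (d : ℕ) (G : Ed d → Ed d → ℝ) (δ : ℝ) (v : Ed d → ℝ) : Prop :=
  ∀ (φ : Ed d → ℝ) (x₀ : Ed d), ContDiffAt ℝ 1 φ x₀ →
    IsLocalMin (fun y => v y - φ y) x₀ → 0 ≤ δ * v x₀ + G (gradient φ x₀) x₀

theorem hgrad_aux {d : ℕ} (a b : ℝ) (y x₀ x : Ed d) :
    HasGradientAt (fun z : Ed d => a * ‖z - y‖ ^ 2 + b * ‖z - x₀‖ ^ 2)
      ((2 * a) • (x - y) + (2 * b) • (x - x₀)) x := by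
  rw [hasGradientAt_iff_hasFDerivAt]
  have h1 : ∀ (c : ℝ) (w : Ed d), HasFDerivAt (fun z : Ed d => c * ‖z - w‖ ^ 2)
      (c • (2 • (innerSL ℝ (x - w)))) x := by
    intro c w
    have h := (HasFDerivAt.norm_sq ((hasFDerivAt_id x).sub_const w)).const_mul c
    refine h.congr_fderiv ?_
    ext v
    simp
  refine ((h1 a y).add (h1 b x₀)).congr_fderiv ?_
  ext v
  simp
  ring

theorem grad_contDiff {d : ℕ} (a b : ℝ) (y x₀ x : Ed d) :
    ContDiffAt ℝ 1 (fun z : Ed d => a * ‖z - y‖ ^ 2 + b * ‖z - x₀‖ ^ 2) x := by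
  apply ContDiff.contDiffAt
  have h : ∀ w : Ed d, ContDiff ℝ 1 (fun z : Ed d => ‖z - w‖ ^ 2) :=
    fun w => (contDiff_id.sub contDiff_const).norm_sq ℝ
  exact (contDiff_const.mul (h y)).add (contDiff_const.mul (h x₀))

theorem exists_max_aux {d : ℕ} (u w : Ed d → ℝ) (hu : Continuous u) (hw : Continuous w)
    (M : ℝ) (hM : ∀ x y, u x - w y ≤ M) (a α : ℝ) (ha : 0 < a) (hα : 0 < α) (x₀ : Ed d) :
    ∃ x y : Ed d, ∀ x' y' : Ed d, u x' - w y' - a * ‖x' - y'‖ ^ 2 - α * ‖x' - x₀‖ ^ 2 ≤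
      u x - w y - a * ‖x - y‖ ^ 2 - α * ‖x - x₀‖ ^ 2 := by
  set Φ : Ed d × Ed d → ℝ := fun q =>
    u q.1 - w q.2 - a * ‖q.1 - q.2‖ ^ 2 - α * ‖q.1 - x₀‖ ^ 2 with hΦ
  have hc : Continuous Φ := by fun_prop
  set D : ℝ := M - Φ (x₀, x₀) with hD
  obtain ⟨r, hr0, hr⟩ : ∃ r : ℝ, 0 < r ∧ D < a * r ^ 2 ∧ D < α * r ^ 2 := by
    have t1 : Tendsto (fun r : ℝ => a * r ^ 2) atTop atTop :=
      (tendsto_pow_atTop (two_ne_zero)).const_mul_atTop ha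
    have t2 : Tendsto (fun r : ℝ => α * r ^ 2) atTop atTop :=
      (tendsto_pow_atTop (two_ne_zero)).const_mul_atTop hα
    exact ((eventually_gt_atTop 0).and ((t1.eventually_gt_atTop D).and
      (t2.eventually_gt_atTop D))).exists
  have hcomp : IsCompact (Metric.closedBall x₀ r ×ˢ Metric.closedBall x₀ (2 * r)) :=
    (isCompact_closedBall _ _).prod (isCompact_closedBall _ _)
  obtain ⟨q, -, hq⟩ := hcomp.exists_isMaxOn ⟨(x₀, x₀), by
    simp [hr0.le]⟩ hc.continuousOn
  refine ⟨q.1, q.2, fun x' y' => ?_⟩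
  by_cases hin : (x', y') ∈ Metric.closedBall x₀ r ×ˢ Metric.closedBall x₀ (2 * r)
  · exact hq hin
  have h0 : Φ (x₀, x₀) ≤ Φ q := hq (by simp [hr0.le])
  have h1 : Φ (x', y') ≤ Φ (x₀, x₀) := by
    have hMM := hM x' y'
    by_cases hx : ‖x' - x₀‖ ≤ r
    · have hy : r ≤ ‖x' - y'‖ := by
        by_contra! hlt
        apply hin
        refine ⟨by simpa [dist_eq_norm] using hx, ?_⟩
        simp only [Metric.mem_closedBall, dist_eq_norm]
        calc ‖y' - x₀‖ = ‖(x' - x₀) - (x' - y')‖ := by congr 1; abel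
          _ ≤ _ := norm_sub_le _ _
          _ ≤ 2 * r := by linarith
      have : a * r ^ 2 ≤ a * ‖x' - y'‖ ^ 2 := by gcongr
      have : 0 ≤ α * ‖x' - x₀‖ ^ 2 := by positivity
      simp only [hΦ] at hD ⊢
      linarith [hr.1]
    · push Not at hx
      have : α * r ^ 2 ≤ α * ‖x' - x₀‖ ^ 2 := by gcongr
      have : 0 ≤ a * ‖x' - y'‖ ^ 2 := by positivity
      simp only [hΦ] at hD ⊢
      linarith [hr.2]
  exact h1.trans h0

theorem comparison_aux {d : ℕ} (H : Ed d → Ed d → ℝ) (p : Ed d) (C : ℝ≥0) (hC : 0 < C)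
    (hreg_uc : ∀ R : ℝ, 0 < R → ∀ ε : ℝ, 0 < ε → ∃ δ : ℝ, 0 < δ ∧ ∀ (p p' y y' : Ed d),
      ‖p‖ ≤ R → ‖p'‖ ≤ R → ‖p - p'‖ < δ → ‖y - y'‖ < δ → |H p y - H p' y'| < ε)
    (δ δ' : ℝ) (hδ : 0 < δ) (hδ' : 0 < δ') (u w : Ed d → ℝ)
    (hu : Continuous u) (hw : LipschitzWith C w)
    (hub : ∀ y, |δ * u y| ≤ C) (hwb : ∀ y, |δ' * w y| ≤ C)
    (hsub : ViscSubDelta d (fun q y => H (p + q) y) δ u)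
    (hsuper : ViscSuperDelta d (fun q y => H (p + q) y) δ' w) (x₀ : Ed d) :
    δ * (u x₀ - w x₀) ≤ |δ' - δ| * (C / δ') := by
  have hub' : ∀ y, |u y| ≤ C / δ := by
    intro y
    rw [le_div_iff₀ hδ, mul_comm]
    simpa [abs_mul, abs_of_pos hδ] using hub y
  have hwb' : ∀ y, |w y| ≤ C / δ' := by
    intro y
    rw [le_div_iff₀ hδ', mul_comm]
    simpa [abs_mul, abs_of_pos hδ'] using hwb y
  have hCr : (0 : ℝ) < C := hC
  apply le_of_forall_pos_le_add
  intro η hη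
  obtain ⟨ρ, hρ, hH⟩ := hreg_uc (‖p‖ + 2 * C + 1) (by positivity) η hη
  -- parameters
  obtain ⟨ε, hε, hερ⟩ : ∃ ε : ℝ, 0 < ε ∧ 2 * C * ε < ρ :=
    ⟨ρ / (4 * C), by positivity, by field_simp; linarith⟩
  set M : ℝ := C / δ + C / δ' with hMdef
  have hMpos : 0 < M := by positivity
  have hM : ∀ x y, u x - w y ≤ M := fun x y => by
    have := abs_le.1 (hub' x); have := abs_le.1 (hwb' y); linarith
  have hM' : ∀ x y, -M ≤ u x - w y := fun x y => by
    have := abs_le.1 (hub' x); have := abs_le.1 (hwb' y); linarith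
  obtain ⟨κ, hκ, hκρ, hκ1⟩ : ∃ κ : ℝ, 0 < κ ∧ κ < ρ ∧ κ ≤ 1 :=
    ⟨min (ρ / 2) 1, by positivity, (min_le_left _ _).trans_lt (by linarith), min_le_right _ _⟩
  set α : ℝ := κ ^ 2 / (8 * M) with hαdef
  have hα : 0 < α := by positivity
  obtain ⟨x, y, hmax⟩ := exists_max_aux u w hu hw.continuous M hM (1 / (2 * ε)) α
    (by positivity) hα x₀
  have hm0 := hmax x₀ x₀
  simp only [sub_self, norm_zero] at hm0
  have hpos1 : 0 ≤ 1 / (2 * ε) * ‖x - y‖ ^ 2 := by positivity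
  have hpos2 : 0 ≤ α * ‖x - x₀‖ ^ 2 := by positivity
  -- bound on the penalty gradient
  have hpen : ‖(2 * α) • (x - x₀)‖ ≤ κ := by
    have h1 : α * ‖x - x₀‖ ^ 2 ≤ 2 * M := by
      have := hM x y; have := hM' x₀ x₀; linarith
    rw [norm_smul, Real.norm_of_nonneg (by positivity)]
    apply le_of_sq_le_sq _ hκ.le
    calc (2 * α * ‖x - x₀‖) ^ 2 = 4 * α * (α * ‖x - x₀‖ ^ 2) := by ring
      _ ≤ 4 * α * (2 * M) := by gcongr
      _ = κ ^ 2 := by rw [hαdef]; field_simp; ring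
  have hxy : ‖x - y‖ ≤ 2 * C * ε := by
    have h1 := hmax x x
    simp only [sub_self, norm_zero] at h1
    have h2 : w x - w y ≤ C * ‖x - y‖ := by
      have := hw.dist_le_mul x y
      rw [Real.dist_eq, dist_eq_norm] at this
      exact (le_abs_self _).trans this
    have h3 : 1 / (2 * ε) * ‖x - y‖ ^ 2 ≤ C * ‖x - y‖ := by linarith
    by_contra! hlt
    have hn : 0 < ‖x - y‖ := lt_of_le_of_lt (by positivity) hlt
    have h4 : ‖x - y‖ ^ 2 ≤ C * ‖x - y‖ * (2 * ε) := by
      rw [div_mul_eq_mul_div, one_mul, div_le_iff₀ (by positivity)] at h3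
      exact h3
    nlinarith
  set q : Ed d := (1 / ε) • (x - y) with hq
  have hqn : ‖q‖ ≤ 2 * C := by
    rw [hq, norm_smul, Real.norm_of_nonneg (by positivity), div_mul_eq_mul_div, one_mul,
      div_le_iff₀ hε]
    exact hxy
  -- subsolution test
  have hs := hsub (fun z => (1 / (2 * ε)) * ‖z - y‖ ^ 2 + α * ‖z - x₀‖ ^ 2) x
    (grad_contDiff _ _ _ _ _) (Eventually.of_forall fun z => by
      have := hmax z y; linarith)
  rw [(hgrad_aux (1 / (2 * ε)) α y x₀ x).gradient] at hs
  have hS := hsuper (fun z => (-(1 / (2 * ε))) * ‖z - x‖ ^ 2 + 0 * ‖z - x₀‖ ^ 2) y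
    (grad_contDiff _ _ _ _ _) (Eventually.of_forall fun z => by
      have := hmax x z
      simp only [norm_sub_rev z x, norm_sub_rev y x]
      linarith)
  rw [(hgrad_aux (-(1 / (2 * ε))) 0 x x₀ y).gradient] at hS
  have e1 : (2 * (1 / (2 * ε))) • (x - y) = q := by
    rw [hq]; congr 1; field_simp
  have e2 : (2 * (-(1 / (2 * ε)))) • (y - x) + (2 * (0 : ℝ)) • (y - x₀) = q := by
    rw [← e1, ← neg_sub x y, mul_neg, neg_smul, smul_neg, neg_neg, mul_zero, zero_smul, add_zero]
  rw [e1] at hs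
  rw [e2] at hS
  have hHH := hH (p + q) (p + (q + (2 * α) • (x - x₀))) y x
    ((norm_add_le _ _).trans (by linarith))
    ((norm_add_le _ _).trans (by have := norm_add_le q ((2 * α) • (x - x₀)); linarith))
    (by
      have : p + q - (p + (q + (2 * α) • (x - x₀))) = -((2 * α) • (x - x₀)) := by abel
      rw [this, norm_neg]; linarith)
    (by rw [norm_sub_rev]; linarith)
  have hHH' := (abs_lt.1 hHH).2
  have key : δ * u x - δ' * w y ≤ η := by linarith
  have h5 : (δ' - δ) * w y ≤ |δ' - δ| * (C / δ') := by
    calc (δ' - δ) * w y ≤ |(δ' - δ) * w y| := le_abs_self _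
      _ = |δ' - δ| * |w y| := abs_mul _ _
      _ ≤ _ := by gcongr; exact hwb' y
  have h6 : u x₀ - w x₀ ≤ u x - w y := by linarith
  have h7 := mul_le_mul_of_nonneg_left h6 hδ.le
  linarith

/-- Vitali-type covering estimate. -/
theorem covering_aux {d : ℕ} (S T : Set (Ed d)) (K M N : ℝ) (hK : 0 ≤ K)
    (hTN : T ⊆ Metric.closedBall 0 N)
    (hT : ∀ x ∈ T, ∃ r : ℝ, 0 < r ∧ r ≤ M ∧ ∃ y : Ed d, ‖y‖ ≤ K * r ∧
      ∀ z : Ed d, ‖z - (y + x)‖ ≤ r → z ∈ S) :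
    volume T ≤ ENNReal.ofReal ((4 * (K + 1)) ^ d) *
      volume (S ∩ Metric.closedBall 0 (N + (K + 1) * M)) := by
  choose! r hr0 hrM y hyK hyS using hT
  obtain ⟨u, huT, hdisj, hcov⟩ := Vitali.exists_disjoint_subfamily_covering_enlargement_closedBall
    T (fun x => x) (fun x => (K + 1) * r x) ((K + 1) * M)
    (fun a ha => by have := hrM a ha; gcongr) 4 (by norm_num)
  have hsub : ∀ x ∈ u, Metric.closedBall (y x + x) (r x) ⊆ Metric.closedBall x ((K + 1) * r x) := by
    intro x hx
    apply Metric.closedBall_subset_closedBall'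
    have := hyK x (huT hx)
    rw [dist_eq_norm, add_sub_cancel_right]
    linarith
  have hdisj' : u.PairwiseDisjoint (fun x => Metric.closedBall (y x + x) (r x)) := by
    intro a ha b hb hab
    exact (hdisj ha hb hab).mono (hsub a ha) (hsub b hb)
  have hcount : u.Countable := by
    apply hdisj'.countable_of_nonempty_interior
    intro x hx
    refine ⟨y x + x, ?_⟩
    exact Metric.ball_subset_interior_closedBall (Metric.mem_ball_self (hr0 x (huT hx)))
  have hvol : ∀ x ∈ u, volume (Metric.closedBall x (4 * ((K + 1) * r x))) =
      ENNReal.ofReal ((4 * (K + 1)) ^ d) * volume (Metric.closedBall (y x + x) (r x)) := by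
    intro x hx
    have h0 := hr0 x (huT hx)
    rw [Measure.addHaar_closedBall volume x (by positivity),
      Measure.addHaar_closedBall volume (y x + x) h0.le]
    simp only [finrank_euclideanSpace, Fintype.card_fin]
    rw [← mul_assoc (ENNReal.ofReal ((4 * (K + 1)) ^ d)), ← ENNReal.ofReal_mul (by positivity),
      ← mul_pow, ← mul_assoc 4]
  calc volume T ≤ volume (⋃ x ∈ u, Metric.closedBall x (4 * ((K + 1) * r x))) := by
        apply measure_mono
        intro x hx
        obtain ⟨b, hb, hxb⟩ := hcov x hx
        simp only [Set.mem_iUnion]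
        refine ⟨b, hb, hxb (Metric.mem_closedBall_self ?_)⟩
        have := hr0 x hx
        positivity
    _ ≤ ∑' x : u, volume (Metric.closedBall (x : Ed d) (4 * ((K + 1) * r x))) :=
        measure_biUnion_le _ hcount _
    _ = ∑' x : u, ENNReal.ofReal ((4 * (K + 1)) ^ d) *
          volume (Metric.closedBall (y x + x) (r x)) := by
        congr 1; ext x; exact hvol x x.2
    _ = ENNReal.ofReal ((4 * (K + 1)) ^ d) *
          ∑' x : u, volume (Metric.closedBall (y x + x) (r x)) := ENNReal.tsum_mul_left
    _ = ENNReal.ofReal ((4 * (K + 1)) ^ d) *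
          volume (⋃ x ∈ u, Metric.closedBall (y x + x) (r x)) := by
        rw [measure_biUnion hcount hdisj' (fun x _ => Metric.isClosed_closedBall.measurableSet)]
    _ ≤ _ := by
        gcongr
        intro z hz
        simp only [Set.mem_iUnion] at hz
        obtain ⟨x, hx, hz⟩ := hz
        refine ⟨hyS x (huT hx) z (by simpa [dist_eq_norm] using hz), ?_⟩
        have h1 := hsub x hx hz
        have h2 := hTN (huT hx)
        have h3 := hrM x (huT hx)
        rw [Metric.mem_closedBall] at h1 h2 ⊢
        have h4 : (K + 1) * r x ≤ (K + 1) * M := by gcongr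
        linarith [dist_triangle z x 0]

/-- Maximal inequality by transference. -/
theorem transfer_aux {d : ℕ} {Ω : Type*} [MeasurableSpace Ω] (P : Measure Ω)
    [IsProbabilityMeasure P] (E B : Set (Ed d × Ω))
    (hE : MeasurableSet E) (hB : MeasurableSet B) (e b : ENNReal)
    (hEe : ∀ x, P {ω | (x, ω) ∈ E} = e) (hBb : ∀ x, P {ω | (x, ω) ∈ B} = b)
    (K M : ℝ) (hK : 0 ≤ K) (hM : 0 < M)
    (hEB : ∀ ω x, (x, ω) ∈ E → ∃ r : ℝ, 0 < r ∧ r ≤ M ∧ ∃ y : Ed d, ‖y‖ ≤ K * r ∧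
      ∀ z : Ed d, ‖z - (y + x)‖ ≤ r → (z, ω) ∈ B) :
    e ≤ ENNReal.ofReal ((8 * (K + 1)) ^ d) * b := by
  have sw : ∀ (A : Set (Ed d × Ω)) (a : ENNReal) (N : ℝ), MeasurableSet A →
      (∀ x, P {ω | (x, ω) ∈ A} = a) →
      ∫⁻ ω, volume ({x | (x, ω) ∈ A} ∩ Metric.closedBall 0 N) ∂P
        = a * volume (Metric.closedBall (0 : Ed d) N) := by
    intro A a N hA ha
    have hm : MeasurableSet (A ∩ (Metric.closedBall 0 N ×ˢ Set.univ)) :=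
      hA.inter (Metric.isClosed_closedBall.measurableSet.prod MeasurableSet.univ)
    have h1 := Measure.prod_apply (μ := (volume : Measure (Ed d))) (ν := P) hm
    have h2 := Measure.prod_apply_symm (μ := (volume : Measure (Ed d))) (ν := P) hm
    rw [h2] at h1
    have e1 : ∀ ω, (fun x => (x, ω)) ⁻¹' (A ∩ (Metric.closedBall (0 : Ed d) N ×ˢ Set.univ)) =
        {x | (x, ω) ∈ A} ∩ Metric.closedBall 0 N := by
      intro ω; ext x; simp
    simp only [e1] at h1
    rw [h1]
    have e2 : ∀ x, P (Prod.mk x ⁻¹' (A ∩ (Metric.closedBall (0 : Ed d) N ×ˢ Set.univ))) =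
        (Metric.closedBall (0 : Ed d) N).indicator (fun _ => a) x := by
      intro x
      by_cases hx : x ∈ Metric.closedBall (0 : Ed d) N
      · rw [Set.indicator_of_mem hx, ← ha x]
        congr 1; ext ω
        simp only [Set.mem_preimage, Set.mem_inter_iff, Set.mem_prod, Set.mem_univ, hx, and_true,
          Set.mem_ofPred_eq]
      · rw [Set.indicator_of_notMem hx, ← measure_empty (μ := P)]
        congr 1; ext ω
        simp only [Set.mem_preimage, Set.mem_inter_iff, Set.mem_prod, Set.mem_univ, hx, and_true,
          and_false, Set.mem_empty_iff_false]
    simp only [e2]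
    rw [lintegral_indicator Metric.isClosed_closedBall.measurableSet, setLIntegral_const]
  set N : ℝ := (K + 1) * M with hN
  have hNpos : 0 < N := by positivity
  have h1 := sw E e N hE hEe
  have h2 := sw B b (N + N) hB hBb
  have h3 : e * volume (Metric.closedBall (0 : Ed d) N) ≤ ENNReal.ofReal ((4 * (K + 1)) ^ d) *
      (b * volume (Metric.closedBall (0 : Ed d) (N + N))) := by
    rw [← h1, ← h2, ← lintegral_const_mul' _ _ ENNReal.ofReal_ne_top]
    apply lintegral_mono
    intro ω
    exact covering_aux {x | (x, ω) ∈ B} _ K M N hK Set.inter_subset_right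
      (fun x hx => hEB ω x hx.1)
  have h4 : volume (Metric.closedBall (0 : Ed d) (N + N)) =
      ENNReal.ofReal (2 ^ d) * volume (Metric.closedBall (0 : Ed d) N) := by
    have := Measure.addHaar_closedBall_mul volume (0 : Ed d) (r := 2) (by norm_num) hNpos.le
    rw [two_mul] at this
    simpa using this
  have hv0 : volume (Metric.closedBall (0 : Ed d) N) ≠ 0 :=
    (Metric.measure_closedBall_pos volume _ hNpos).ne'
  have hvt : volume (Metric.closedBall (0 : Ed d) N) ≠ ⊤ := measure_closedBall_lt_top.ne
  rw [h4] at h3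
  have h5 : ENNReal.ofReal ((8 * (K + 1)) ^ d) =
      ENNReal.ofReal ((4 * (K + 1)) ^ d) * ENNReal.ofReal (2 ^ d) := by
    rw [← ENNReal.ofReal_mul (by positivity), ← mul_pow]
    congr 2; ring
  rw [h5]
  refine (ENNReal.mul_le_mul_iff_left hv0 hvt).1 (h3.trans (le_of_eq ?_))
  ring

/-- Measurability of an existential over an open set. -/
theorem measurable_exists_aux {X Y : Type*} [TopologicalSpace X] [TopologicalSpace.SeparableSpace X]
    [Nonempty X] [MeasurableSpace Y] (O : Set X) (hO : IsOpen O) (f : X → Y → ℝ)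
    (hf : ∀ y, ContinuousOn (fun x => f x y) O) (hm : ∀ x ∈ O, Measurable (f x)) (c : ℝ) :
    MeasurableSet {y | ∃ x ∈ O, f x y < c} := by
  have : {y | ∃ x ∈ O, f x y < c} =
      ⋃ i : ℕ, ⋃ _ : TopologicalSpace.denseSeq X i ∈ O, {y | f (TopologicalSpace.denseSeq X i) y < c} := by
    ext y
    simp only [Set.mem_ofPred_eq, Set.mem_iUnion, exists_prop]
    constructor
    · rintro ⟨x, hx, hxc⟩
      have hopen : IsOpen (O ∩ (fun x => f x y) ⁻¹' Set.Iio c) :=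
        (hf y).isOpen_inter_preimage hO isOpen_Iio
      obtain ⟨_, hz, ⟨i, rfl⟩⟩ := (TopologicalSpace.denseRange_denseSeq X).inter_open_nonempty _
        hopen ⟨x, hx, hxc⟩
      exact ⟨i, hz.1, hz.2⟩
    · rintro ⟨i, hi, hic⟩
      exact ⟨_, hi, hic⟩
  rw [this]
  exact MeasurableSet.iUnion fun i => MeasurableSet.iUnion fun hi =>
    measurableSet_lt (hm _ hi) measurable_const

theorem char_aux (f : ℝ → ℝ) (C : ℝ) (hf : ∀ δ, 0 < δ → |f δ| ≤ C) (a : ℝ) :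
    a ≤ liminf f (𝓝[>] (0 : ℝ)) ↔
      ∀ b < a, ∃ k : ℕ, ∀ δ : ℝ, 0 < δ → δ < 1 / ((k : ℝ) + 1) → b ≤ f δ := by
  have hpos : ∀ᶠ δ : ℝ in 𝓝[>] 0, 0 < δ := self_mem_nhdsWithin
  have hb1 : IsBoundedUnder (· ≥ ·) (𝓝[>] (0 : ℝ)) f :=
    ⟨-C, by
      rw [eventually_map]
      filter_upwards [hpos] with δ hδ using (abs_le.1 (hf δ hδ)).1⟩
  have hb2 : IsBoundedUnder (· ≤ ·) (𝓝[>] (0 : ℝ)) f :=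
    ⟨C, by
      rw [eventually_map]
      filter_upwards [hpos] with δ hδ using (abs_le.1 (hf δ hδ)).2⟩
  constructor
  · intro ha b hb
    have h := eventually_lt_of_lt_liminf (lt_of_lt_of_le hb ha) hb1
    obtain ⟨u, hu, hus⟩ := mem_nhdsGT_iff_exists_Ioo_subset.1 h
    obtain ⟨k, hk⟩ := exists_nat_one_div_lt (Set.mem_Ioi.1 hu)
    exact ⟨k, fun δ h0 h1 => le_of_lt (hus ⟨h0, h1.trans hk⟩)⟩
  · intro h
    apply le_of_forall_lt
    intro b hb
    obtain ⟨b', hb', hb''⟩ := exists_between hb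
    obtain ⟨k, hk⟩ := h b' hb''
    refine lt_of_lt_of_le hb' (le_liminf_of_le hb2.isCoboundedUnder_ge ?_)
    have : Set.Ioo (0 : ℝ) (1 / ((k : ℝ) + 1)) ∈ 𝓝[>] (0 : ℝ) :=
      Ioo_mem_nhdsGT (by positivity)
    filter_upwards [this] with δ hδ using hk δ hδ.1 hδ.2

theorem core_aux {d : ℕ} {Ω : Type*} [MeasurableSpace Ω] (P : Measure Ω) [IsProbabilityMeasure P]
    (τ : Ed d → Ω → Ω)
    (hτmp : ∀ y : Ed d, MeasurePreserving (τ y) P P)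
    (hτgrp : ∀ x y : Ed d, τ (x + y) = τ x ∘ τ y)
    (hτzero : τ 0 = id)
    (hτerg : ∀ A : Set Ω, MeasurableSet A → (∀ z : Ed d, τ z ⁻¹' A = A) → P A = 0 ∨ P A = 1)
    (C : ℝ) (hC : 0 < C) (F : ℝ → Ed d → Ω → ℝ)
    (hmeas : ∀ δ : ℝ, 0 < δ → Measurable fun x : Ed d × Ω => F δ x.1 x.2)
    (hlip : ∀ δ : ℝ, 0 < δ → ∀ ω y z, F δ y ω ≤ F δ z ω + C * δ * ‖y - z‖)
    (hbdd : ∀ δ : ℝ, 0 < δ → ∀ ω y, |F δ y ω| ≤ C)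
    (hcont : ∀ ω, ContinuousOn (fun q : ℝ × Ed d => F q.1 q.2 ω) (Set.Ioi 0 ×ˢ Set.univ))
    (hstat : ∀ δ : ℝ, 0 < δ → ∀ (y z : Ed d) (ω : Ω), F δ (y + z) ω = F δ y (τ z ω)) :
    ∃ hs : ℝ, ∀ᵐ ω ∂P, liminf (fun δ => F δ 0 ω) (𝓝[>] (0:ℝ)) = hs ∧ ∀ R : ℝ, 0 < R →
      hs = liminf (fun δ : ℝ => sInf ((fun y => F δ y ω) '' {y : Ed d | ‖y‖ ≤ R / δ}))
        (𝓝[>] (0:ℝ)) := by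
  set h : Ω → ℝ := fun ω => liminf (fun δ => F δ 0 ω) (𝓝[>] (0:ℝ)) with hh
  have hch : ∀ ω a, a ≤ h ω ↔
      ∀ b < a, ∃ k : ℕ, ∀ δ : ℝ, 0 < δ → δ < 1 / ((k : ℝ) + 1) → b ≤ F δ 0 ω := fun ω a =>
    char_aux (fun δ => F δ 0 ω) C (fun δ hδ => hbdd δ hδ ω 0) a
  -- invariance
  have hinv1 : ∀ z ω, h ω ≤ h (τ z ω) := by
    intro z ω
    rw [hch]
    intro b hb
    obtain ⟨b', hb1, hb2⟩ := exists_between hb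
    obtain ⟨k, hk⟩ := (hch ω (h ω)).1 le_rfl b' hb2
    obtain ⟨j, hj⟩ := exists_nat_gt (max (k : ℝ) (C * ‖z‖ / (b' - b)))
    refine ⟨j, fun δ h0 h1 => ?_⟩
    have hkj : (k : ℝ) < j := (le_max_left _ _).trans_lt hj
    have hcj : C * ‖z‖ / (b' - b) < j := (le_max_right _ _).trans_lt hj
    have h2 := hk δ h0 (h1.trans_le (one_div_le_one_div_of_le (by positivity) (by linarith)))
    have h3 := hlip δ h0 ω 0 (0 + z)
    rw [hstat δ h0 0 z ω] at h3
    have h4 : C * δ * ‖(0 : Ed d) - (0 + z)‖ ≤ b' - b := by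
      have e : ‖(0 : Ed d) - (0 + z)‖ = ‖z‖ := by simp
      rw [e]
      have hbb : 0 < b' - b := by linarith
      rw [div_lt_iff₀ hbb] at hcj
      rw [lt_div_iff₀ (by positivity)] at h1
      have hj0 : (0 : ℝ) ≤ j := Nat.cast_nonneg j
      have : δ * (C * ‖z‖) ≤ δ * (j * (b' - b)) := by gcongr
      nlinarith
    linarith
  have hinv : ∀ z ω, h (τ z ω) = h ω := by
    intro z ω
    refine le_antisymm ?_ (hinv1 z ω)
    have := hinv1 (-z) (τ z ω)
    have e : τ (-z) (τ z ω) = ω := by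
      have := congrFun (hτgrp (-z) z) ω
      rw [neg_add_cancel, hτzero] at this
      exact this.symm
    rwa [e] at this
  -- measurability of the basic sets
  have hBm : ∀ (k : ℕ) (c : ℝ), MeasurableSet
      {q : Ed d × Ω | ∃ δ ∈ Set.Ioo (0 : ℝ) (1 / ((k : ℝ) + 1)), F δ q.1 q.2 < c} := by
    intro k c
    apply measurable_exists_aux _ isOpen_Ioo (fun δ (q : Ed d × Ω) => F δ q.1 q.2)
    · intro q
      exact (hcont q.2).comp (f := fun δ : ℝ => (δ, q.1)) (by fun_prop) (fun δ hδ => ⟨hδ.1, trivial⟩)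
    · exact fun δ hδ => hmeas δ hδ.1
  have hBm0 : ∀ (k : ℕ) (c : ℝ), MeasurableSet
      {ω : Ω | ∃ δ ∈ Set.Ioo (0 : ℝ) (1 / ((k : ℝ) + 1)), F δ 0 ω < c} := by
    intro k c
    exact (measurable_prodMk_left (x := (0 : Ed d))) (hBm k c)
  have hmeash : Measurable h := by
    apply measurable_of_Ici
    intro a
    have : h ⁻¹' Set.Ici a = ⋂ q : ℚ, ⋂ _ : (q : ℝ) < a, ⋃ k : ℕ,
        {ω : Ω | ∃ δ ∈ Set.Ioo (0 : ℝ) (1 / ((k : ℝ) + 1)), F δ 0 ω < q}ᶜ := by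
      ext ω
      simp only [Set.mem_preimage, Set.mem_Ici, Set.mem_iInter, Set.mem_iUnion, Set.mem_compl_iff,
        Set.mem_ofPred_eq, not_exists, not_and, not_lt, Set.mem_Ioo, and_imp]
      rw [hch]
      constructor
      · intro hb q hq
        exact hb q hq
      · intro hq b hb
        obtain ⟨q, hq1, hq2⟩ := exists_rat_btwn hb
        obtain ⟨k, hk⟩ := hq q hq2
        exact ⟨k, fun δ h0 h1 => hq1.le.trans (hk δ h0 h1)⟩
    rw [this]
    exact MeasurableSet.iInter fun q => MeasurableSet.iInter fun _ => MeasurableSet.iUnion fun k =>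
      (hBm0 k q).compl
  obtain ⟨hs, hhs⟩ : ∃ hs, h =ᵐ[P] Function.const Ω hs := by
    apply exists_eventuallyEq_const_of_forall_separating MeasurableSet
    intro U hU
    have hmU : MeasurableSet (h ⁻¹' U) := hmeash hU
    rcases hτerg (h ⁻¹' U) hmU (fun z => by ext ω; simp [hinv]) with h0 | h1
    · right
      exact measure_eq_zero_iff_ae_notMem.1 h0
    · left
      exact (mem_ae_iff_prob_eq_one hmU).2 h1
  refine ⟨hs, ?_⟩
  -- main estimate
  have main : ∀ n j : ℕ, ∀ᵐ ω ∂P, ∃ k : ℕ, ∀ δ : ℝ, 0 < δ → δ < 1 / ((k : ℝ) + 1) →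
      ∀ y : Ed d, ‖y‖ * δ < n → hs - 2 * (1 / ((j : ℝ) + 1)) ≤ F δ y ω := by
    intro n j
    set η : ℝ := 1 / ((j : ℝ) + 1) with hη
    have hηpos : 0 < η := by positivity
    set O : ℕ → ℕ → Set (ℝ × Ed d) := fun k m =>
      {q | 1 / ((m : ℝ) + 1) < q.1 ∧ q.1 < 1 / ((k : ℝ) + 1) ∧ ‖q.2‖ * q.1 < n} with hOdef
    have hOpen : ∀ k m, IsOpen (O k m) := by
      intro k m
      have o1 : IsOpen {q : ℝ × Ed d | 1 / ((m : ℝ) + 1) < q.1} :=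
        isOpen_lt (by fun_prop) (by fun_prop)
      have o2 : IsOpen {q : ℝ × Ed d | q.1 < 1 / ((k : ℝ) + 1)} :=
        isOpen_lt (by fun_prop) (by fun_prop)
      have o3 : IsOpen {q : ℝ × Ed d | ‖q.2‖ * q.1 < n} :=
        isOpen_lt (by fun_prop) (by fun_prop)
      exact o1.inter (o2.inter o3)
    have hOpos : ∀ k m, ∀ q ∈ O k m, 0 < q.1 := fun k m q hq =>
      lt_trans (by positivity) hq.1
    set E : ℕ → ℕ → Set (Ed d × Ω) := fun k m =>
      {q | ∃ s ∈ O k m, F s.1 (s.2 + q.1) q.2 < hs - 2 * η} with hEdef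
    set B : ℕ → Set (Ed d × Ω) := fun k =>
      {q | ∃ δ ∈ Set.Ioo (0 : ℝ) (1 / ((k : ℝ) + 1)), F δ q.1 q.2 < hs - η} with hBdef
    have hEm : ∀ k m, MeasurableSet (E k m) := by
      intro k m
      apply measurable_exists_aux _ (hOpen k m) (fun s (q : Ed d × Ω) => F s.1 (s.2 + q.1) q.2)
      · intro q
        exact (hcont q.2).comp (f := fun s : ℝ × Ed d => (s.1, s.2 + q.1)) (by fun_prop)
          (fun s hs => ⟨hOpos k m s hs, trivial⟩)
      · intro s hs
        exact (hmeas s.1 (hOpos k m s hs)).comp (g := fun x : Ed d × Ω => F s.1 x.1 x.2)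
          (f := fun q : Ed d × Ω => (s.2 + q.1, q.2)) (by fun_prop)
    set E0 : ℕ → ℕ → Set Ω := fun k m => {ω | (0, ω) ∈ E k m} with hE0
    set B0 : ℕ → Set Ω := fun k => {ω | (0, ω) ∈ B k} with hB0
    have hE0m : ∀ k m, MeasurableSet (E0 k m) := fun k m =>
      (measurable_prodMk_left (x := (0 : Ed d))) (hEm k m)
    have hB0m : ∀ k, MeasurableSet (B0 k) := fun k => hBm0 k _
    set c : ENNReal := ENNReal.ofReal ((8 * (n * C / η + 1)) ^ d) with hc
    have est : ∀ k m, P (E0 k m) ≤ c * P (B0 k) := by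
      intro k m
      apply transfer_aux P (E k m) (B k) (hEm k m) (hBm k _) _ _ _ _ (n * C / η)
        (η * (m + 1) / C) (by positivity) (by positivity)
      · -- the bad ball
        rintro ω x ⟨⟨δ, y⟩, ⟨h1, h2, h3⟩, h4⟩
        simp only at h1 h2 h3 h4
        have h0 : 0 < δ := lt_trans (by positivity) h1
        refine ⟨η / (C * δ), by positivity, ?_, y, ?_, ?_⟩
        · rw [div_le_div_iff₀ (by positivity) hC]
          rw [div_lt_iff₀ (by positivity)] at h1
          have : 0 ≤ η * C * (δ * (m + 1) - 1) :=
            mul_nonneg (by positivity) (by linarith)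
          nlinarith
        · have : n * C / η * (η / (C * δ)) = n / δ := by field_simp
          rw [this, le_div_iff₀ h0]
          exact h3.le
        · intro z hz
          refine ⟨δ, ⟨h0, h2⟩, ?_⟩
          have h5 := hlip δ h0 ω z (y + x)
          have h6 : C * δ * ‖z - (y + x)‖ ≤ C * δ * (η / (C * δ)) := by gcongr
          have h7 : C * δ * (η / (C * δ)) = η := by field_simp
          simp only
          linarith
      · intro x
        have : {ω | (x, ω) ∈ E k m} = τ x ⁻¹' E0 k m := by
          ext ω
          simp only [hE0, hEdef, Set.mem_preimage, Set.mem_ofPred_eq]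
          constructor
          · rintro ⟨s, hs1, hs2⟩
            refine ⟨s, hs1, ?_⟩
            rwa [add_zero, ← hstat s.1 (hOpos k m s hs1)]
          · rintro ⟨s, hs1, hs2⟩
            refine ⟨s, hs1, ?_⟩
            rwa [add_zero, ← hstat s.1 (hOpos k m s hs1)] at hs2
        rw [this]
        exact (hτmp x).measure_preimage (hE0m k m).nullMeasurableSet
      · intro x
        have : {ω | (x, ω) ∈ B k} = τ x ⁻¹' B0 k := by
          ext ω
          simp only [hB0, hBdef, Set.mem_preimage, Set.mem_ofPred_eq]
          constructor
          · rintro ⟨s, hs1, hs2⟩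
            refine ⟨s, hs1, ?_⟩
            rwa [← hstat s hs1.1, zero_add]
          · rintro ⟨s, hs1, hs2⟩
            refine ⟨s, hs1, ?_⟩
            rwa [← hstat s hs1.1, zero_add] at hs2
        rw [this]
        exact (hτmp x).measure_preimage (hB0m k).nullMeasurableSet
    have est2 : ∀ k, P (⋃ m, E0 k m) ≤ c * P (B0 k) := by
      intro k
      have hmono : Monotone (E0 k) := by
        rintro m m' hmm ω ⟨s, ⟨h1, h2⟩, hs2⟩
        refine ⟨s, ⟨lt_of_le_of_lt ?_ h1, h2⟩, hs2⟩
        have : (m : ℝ) ≤ m' := by exact_mod_cast hmm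
        exact one_div_le_one_div_of_le (by positivity) (by linarith)
      rw [hmono.measure_iUnion]
      exact iSup_le (est k)
    have hBlim : Tendsto (fun k => P (B0 k)) atTop (𝓝 0) := by
      have hanti : Antitone B0 := by
        rintro k k' hkk ω ⟨δ, ⟨h1, h2⟩, hs2⟩
        refine ⟨δ, ⟨h1, lt_of_lt_of_le h2 ?_⟩, hs2⟩
        have : (k : ℝ) ≤ k' := by exact_mod_cast hkk
        exact one_div_le_one_div_of_le (by positivity) (by linarith)
      have hlim := tendsto_measure_iInter_atTop (μ := P) (s := B0)
        (fun k => (hB0m k).nullMeasurableSet) hanti ⟨0, measure_ne_top _ _⟩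
      have hz : P (⋂ k, B0 k) = 0 := by
        rw [measure_eq_zero_iff_ae_notMem]
        filter_upwards [hhs] with ω hω hmem
        have hle : hs ≤ h ω := le_of_eq hω.symm
        obtain ⟨k, hk⟩ := (hch ω hs).1 hle (hs - η) (by linarith)
        obtain ⟨δ, hδ, hδ2⟩ := Set.mem_iInter.1 hmem k
        have := hk δ hδ.1 hδ.2
        simp only at hδ2
        linarith
      rwa [hz] at hlim
    have hzero : P (⋂ k, ⋃ m, E0 k m) = 0 := by
      have hlim2 : Tendsto (fun k => c * P (B0 k)) atTop (𝓝 0) := by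
        have := ENNReal.Tendsto.const_mul (a := c) hBlim (Or.inr ENNReal.ofReal_ne_top)
        simpa using this
      refine le_antisymm (ge_of_tendsto' hlim2 fun k => ?_) zero_le
      exact (measure_mono (Set.iInter_subset _ k)).trans (est2 k)
    filter_upwards [measure_eq_zero_iff_ae_notMem.1 hzero] with ω hω
    simp only [Set.mem_iInter, Set.mem_iUnion, not_forall, not_exists] at hω
    obtain ⟨k, hk⟩ := hω
    refine ⟨k, fun δ h0 h1 y hy => ?_⟩
    by_contra! hlt
    obtain ⟨m, hm⟩ := exists_nat_one_div_lt h0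
    exact hk m ⟨(δ, y), ⟨hm, h1, hy⟩, by simpa using hlt⟩
  have main' : ∀ᵐ ω ∂P, ∀ n j : ℕ, ∃ k : ℕ, ∀ δ : ℝ, 0 < δ → δ < 1 / ((k : ℝ) + 1) →
      ∀ y : Ed d, ‖y‖ * δ < n → hs - 2 * (1 / ((j : ℝ) + 1)) ≤ F δ y ω :=
    ae_all_iff.2 fun n => ae_all_iff.2 fun j => main n j
  filter_upwards [hhs, main'] with ω hω hmain
  refine ⟨hω, fun R hR => ?_⟩
  have hne : ∀ δ : ℝ, 0 < δ → ((fun y => F δ y ω) '' {y : Ed d | ‖y‖ ≤ R / δ}).Nonempty :=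
    fun δ hδ => ⟨F δ 0 ω, 0, by simpa using (by positivity : 0 ≤ R / δ), rfl⟩
  have hbb : ∀ δ : ℝ, 0 < δ → BddBelow ((fun y => F δ y ω) '' {y : Ed d | ‖y‖ ≤ R / δ}) := by
    intro δ hδ
    refine ⟨-C, ?_⟩
    rintro _ ⟨y, -, rfl⟩
    exact (abs_le.1 (hbdd δ hδ ω y)).1
  have hle0 : ∀ δ : ℝ, 0 < δ →
      sInf ((fun y => F δ y ω) '' {y : Ed d | ‖y‖ ≤ R / δ}) ≤ F δ 0 ω := fun δ hδ =>
    csInf_le (hbb δ hδ) ⟨0, by simpa using (by positivity : 0 ≤ R / δ), rfl⟩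
  have hsb : ∀ δ : ℝ, 0 < δ → |sInf ((fun y => F δ y ω) '' {y : Ed d | ‖y‖ ≤ R / δ})| ≤ C := by
    intro δ hδ
    rw [abs_le]
    constructor
    · apply le_csInf (hne δ hδ)
      rintro _ ⟨y, -, rfl⟩
      exact (abs_le.1 (hbdd δ hδ ω y)).1
    · exact (hle0 δ hδ).trans (abs_le.1 (hbdd δ hδ ω 0)).2
  apply le_antisymm
  · rw [char_aux _ C hsb]
    intro b hb
    obtain ⟨n, hn⟩ := exists_nat_gt R
    obtain ⟨j, hj⟩ := exists_nat_one_div_lt (show 0 < (hs - b) / 2 by linarith)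
    obtain ⟨k, hk⟩ := hmain n j
    refine ⟨k, fun δ h0 h1 => le_csInf (hne δ h0) ?_⟩
    rintro _ ⟨y, hy, rfl⟩
    have hy' : ‖y‖ * δ ≤ R := (le_div_iff₀ h0).1 hy
    have := hk δ h0 h1 y (by linarith)
    simp only
    linarith
  · have hω' : h ω = hs := hω
    rw [← hω', hch]
    intro b hb
    obtain ⟨k, hk⟩ := (char_aux _ C hsb _).1 le_rfl b hb
    exact ⟨k, fun δ h0 h1 => (hk δ h0 h1).trans (hle0 δ h0)⟩

theorem neg_limsup_aux (f : ℝ → ℝ) (C : ℝ) (hf : ∀ δ, 0 < δ → |f δ| ≤ C) :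
    limsup f (𝓝[>] (0 : ℝ)) = - liminf (fun δ => - f δ) (𝓝[>] (0 : ℝ)) := by
  have hpos : ∀ᶠ δ : ℝ in 𝓝[>] 0, 0 < δ := self_mem_nhdsWithin
  have hb1 : IsBoundedUnder (· ≥ ·) (𝓝[>] (0 : ℝ)) f :=
    ⟨-C, by
      rw [eventually_map]
      filter_upwards [hpos] with δ hδ using (abs_le.1 (hf δ hδ)).1⟩
  have hb2 : IsBoundedUnder (· ≤ ·) (𝓝[>] (0 : ℝ)) f :=
    ⟨C, by
      rw [eventually_map]
      filter_upwards [hpos] with δ hδ using (abs_le.1 (hf δ hδ)).2⟩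
  have hanti : Antitone (fun x : ℝ => -x) := fun a b hab => neg_le_neg hab
  have := hanti.map_limsup_of_continuousAt (F := 𝓝[>] (0 : ℝ)) f
    continuous_neg.continuousAt hb2 hb1.isCoboundedUnder_le
  rw [← neg_neg (limsup f _)]
  congr 1

/-- the limits of −δ v^δ are deterministic, uniformly on balls of radius R/δ. -/
theorem statement_18
    (d : ℕ) (hd : 0 < d)
    {Ω : Type*} [MeasurableSpace Ω] (P : Measure Ω) [IsProbabilityMeasure P]
    (τ : Ed d → Ω → Ω)
    (hτmeas : ∀ y : Ed d, Measurable (τ y))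
    (hτmp : ∀ y : Ed d, MeasurePreserving (τ y) P P)
    (hτgrp : ∀ x y : Ed d, τ (x + y) = τ x ∘ τ y)
    (hτzero : τ 0 = id)
    (hτerg : ∀ A : Set Ω, MeasurableSet A → (∀ z : Ed d, τ z ⁻¹' A = A) → P A = 0 ∨ P A = 1)
    (H : Ed d → Ed d → Ω → ℝ)
    (hHmeas : Measurable fun x : Ed d × Ed d × Ω => H x.1 x.2.1 x.2.2)
    (hHstat : ∀ (p y z : Ed d) (ω : Ω), H p y (τ z ω) = H p (y + z) ω)
    (hHcont : ∀ ω : Ω, Continuous fun q : Ed d × Ed d => H q.1 q.2 ω)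
    (hreg_bdd : ∀ R : ℝ, 0 < R → ∃ M : ℝ, ∀ (ω : Ω) (p y : Ed d), ‖p‖ ≤ R → |H p y ω| ≤ M)
    (hreg_uc : ∀ R : ℝ, 0 < R → ∀ ε : ℝ, 0 < ε → ∃ δ : ℝ, 0 < δ ∧ ∀ (ω : Ω) (p p' y y' : Ed d),
      ‖p‖ ≤ R → ‖p'‖ ≤ R → ‖p - p'‖ < δ → ‖y - y'‖ < δ → |H p y ω - H p' y' ω| < ε)
    (hcoer : ∀ M : ℝ, ∃ R : ℝ, ∀ (ω : Ω) (p y : Ed d), R ≤ ‖p‖ → M ≤ H p y ω)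
    (hqc : ∀ (ω : Ω) (p q y : Ed d), H ((1/2 : ℝ) • (p + q)) y ω ≤ max (H p y ω) (H q y ω))
    (Λ : ℝ → ℝ → ℝ)
    (hΛcont : Continuous fun m : ℝ × ℝ => Λ m.1 m.2)
    (hΛmono : ∀ a b a' b' : ℝ, a ≤ a' → b ≤ b' → Λ a b ≤ Λ a' b')
    (hΛstrict : ∀ a b : ℝ, a ≠ b → Λ a b < max a b)
    (hsqc : ∀ (ω : Ω) (p q y : Ed d), H ((1/2 : ℝ) • (p + q)) y ω ≤ Λ (H p y ω) (H q y ω))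
    (p : Ed d) (C : ℝ≥0) (hC : 0 < C)
    (v : ℝ → Ed d → Ω → ℝ)
    (hvmeas : ∀ δ : ℝ, 0 < δ → Measurable fun x : Ed d × Ω => v δ x.1 x.2)
    (hvlip : ∀ δ : ℝ, 0 < δ → ∀ ω : Ω, LipschitzWith C (fun y => v δ y ω))
    (hvbdd : ∀ δ : ℝ, 0 < δ → ∀ (ω : Ω) (y : Ed d), |δ * v δ y ω| ≤ (C : ℝ))
    (hvcont : ∀ δ : ℝ, 0 < δ → ∀ ω : Ω, Continuous fun y => v δ y ω)
    (hvsub : ∀ δ : ℝ, 0 < δ → ∀ ω : Ω,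
      ViscSubDelta d (fun q y => H (p + q) y ω) δ (fun y => v δ y ω))
    (hvsuper : ∀ δ : ℝ, 0 < δ → ∀ ω : Ω,
      ViscSuperDelta d (fun q y => H (p + q) y ω) δ (fun y => v δ y ω))
    (hvstat : ∀ δ : ℝ, 0 < δ → ∀ (y z : Ed d) (ω : Ω), v δ (y + z) ω = v δ y (τ z ω)) :
    ∃ hs hS : ℝ,
      (∀ᵐ ω ∂P,
        Filter.liminf (fun δ : ℝ => -(δ * v δ 0 ω)) (𝓝[>] (0:ℝ)) = hs ∧
        Filter.limsup (fun δ : ℝ => -(δ * v δ 0 ω)) (𝓝[>] (0:ℝ)) = hS) ∧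
      ∃ Ω₂ : Set Ω, MeasurableSet Ω₂ ∧ P Ω₂ = 1 ∧
        ∀ ω ∈ Ω₂, ∀ R : ℝ, 0 < R →
          hs = Filter.liminf
              (fun δ : ℝ => sInf ((fun y => -(δ * v δ y ω)) '' {y : Ed d | ‖y‖ ≤ R / δ}))
              (𝓝[>] (0:ℝ)) ∧
          hS = Filter.limsup
              (fun δ : ℝ => sSup ((fun y => -(δ * v δ y ω)) '' {y : Ed d | ‖y‖ ≤ R / δ}))
              (𝓝[>] (0:ℝ)) := by
  have hCr : (0 : ℝ) < C := hC
  have hcomp : ∀ ω δ δ', 0 < δ → 0 < δ' → ∀ x,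
      δ * (v δ x ω - v δ' x ω) ≤ |δ' - δ| * (C / δ') := by
    intro ω δ δ' h0 h0' x
    refine comparison_aux (fun q y => H q y ω) p C hC ?_ δ δ' h0 h0' (fun y => v δ y ω)
      (fun y => v δ' y ω) (hvcont δ h0 ω) (hvlip δ' h0' ω) (hvbdd δ h0 ω) (hvbdd δ' h0' ω)
      (hvsub δ h0 ω) (hvsuper δ' h0' ω) x
    intro R hR ε hε
    obtain ⟨ρ, hρ, h⟩ := hreg_uc R hR ε hε
    exact ⟨ρ, hρ, fun p p' y y' => h ω p p' y y'⟩
  have hvjoint : ∀ ω, ContinuousOn (fun q : ℝ × Ed d => v q.1 q.2 ω) (Set.Ioi 0 ×ˢ Set.univ) := by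
    intro ω
    apply continuousOn_prod_of_continuousOn_lipschitzOnWith' _ C
    · intro δ hδ
      exact (hvlip δ hδ ω).lipschitzOnWith
    · intro y _ δ hδ
      have hδ0 : (0 : ℝ) < δ := hδ
      have hb : Tendsto (fun δ' : ℝ => |δ' - δ| * (C / (δ' * δ))) (𝓝[Set.Ioi 0] δ) (𝓝 0) := by
        have hc : ContinuousAt (fun δ' : ℝ => |δ' - δ| * (C / (δ' * δ))) δ := by
          have : δ * δ ≠ 0 := by positivity
          have h1 : ContinuousAt (fun δ' : ℝ => |δ' - δ|) δ := by fun_prop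
          have h2 : ContinuousAt (fun δ' : ℝ => δ' * δ) δ := by fun_prop
          exact h1.mul (continuousAt_const.div h2 this)
        have := hc.tendsto.mono_left (nhdsWithin_le_nhds (s := Set.Ioi 0))
        simpa using this
      rw [ContinuousWithinAt, tendsto_iff_dist_tendsto_zero]
      refine squeeze_zero' (Eventually.of_forall fun _ => dist_nonneg) ?_ hb
      filter_upwards [self_mem_nhdsWithin] with δ' hδ'
      have hδ'0 : (0 : ℝ) < δ' := hδ'
      have h1 := hcomp ω δ δ' hδ0 hδ'0 y
      have h2 := hcomp ω δ' δ hδ'0 hδ0 y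
      rw [abs_sub_comm δ δ'] at h2
      have e1 : |δ' - δ| * (C / (δ' * δ)) * δ = |δ' - δ| * (C / δ') := by field_simp
      have e2 : |δ' - δ| * (C / (δ' * δ)) * δ' = |δ' - δ| * (C / δ) := by field_simp
      rw [Real.dist_eq, abs_le]
      constructor
      · rw [← e1, mul_comm δ] at h1
        have := le_of_mul_le_mul_right h1 hδ0
        linarith
      · rw [← e2, mul_comm δ'] at h2
        exact le_of_mul_le_mul_right h2 hδ'0
  have hlip : ∀ δ : ℝ, 0 < δ → ∀ ω y z, |δ * v δ y ω - δ * v δ z ω| ≤ C * δ * ‖y - z‖ := by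
    intro δ hδ ω y z
    have := (hvlip δ hδ ω).dist_le_mul y z
    rw [Real.dist_eq, dist_eq_norm] at this
    rw [← mul_sub, abs_mul, abs_of_pos hδ]
    calc δ * |v δ y ω - v δ z ω| ≤ δ * (C * ‖y - z‖) := by gcongr
      _ = _ := by ring
  have hFcont : ∀ ω, ContinuousOn (fun q : ℝ × Ed d => q.1 * v q.1 q.2 ω)
      (Set.Ioi 0 ×ˢ Set.univ) := fun ω => continuousOn_fst.mul (hvjoint ω)
  obtain ⟨hs, hhs⟩ := core_aux P τ hτmp hτgrp hτzero hτerg C hCr (fun δ y ω => -(δ * v δ y ω))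
    (fun δ hδ => ((hvmeas δ hδ).const_mul δ).neg)
    (fun δ hδ ω y z => by have := abs_le.1 (hlip δ hδ ω y z); linarith)
    (fun δ hδ ω y => by rw [abs_neg]; exact hvbdd δ hδ ω y)
    (fun ω => (hFcont ω).neg)
    (fun δ hδ y z ω => by rw [hvstat δ hδ y z ω])
  obtain ⟨hS, hhS⟩ := core_aux P τ hτmp hτgrp hτzero hτerg C hCr (fun δ y ω => δ * v δ y ω)
    (fun δ hδ => (hvmeas δ hδ).const_mul δ)
    (fun δ hδ ω y z => by have := abs_le.1 (hlip δ hδ ω y z); linarith)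
    (fun δ hδ ω y => hvbdd δ hδ ω y)
    (fun ω => hFcont ω)
    (fun δ hδ y z ω => by rw [hvstat δ hδ y z ω])
  have e1 : ∀ ω, limsup (fun δ : ℝ => -(δ * v δ 0 ω)) (𝓝[>] (0:ℝ)) =
      - liminf (fun δ : ℝ => δ * v δ 0 ω) (𝓝[>] (0:ℝ)) := by
    intro ω
    rw [neg_limsup_aux _ C (fun δ hδ => by rw [abs_neg]; exact hvbdd δ hδ ω 0)]
    simp only [neg_neg]
  have e2 : ∀ ω (R : ℝ), 0 < R →
      limsup (fun δ : ℝ => sSup ((fun y => -(δ * v δ y ω)) '' {y : Ed d | ‖y‖ ≤ R / δ}))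
        (𝓝[>] (0:ℝ)) =
      - liminf (fun δ : ℝ => sInf ((fun y => δ * v δ y ω) '' {y : Ed d | ‖y‖ ≤ R / δ}))
        (𝓝[>] (0:ℝ)) := by
    intro ω R hR
    have e3 : ∀ δ : ℝ, -sSup ((fun y => -(δ * v δ y ω)) '' {y : Ed d | ‖y‖ ≤ R / δ}) =
        sInf ((fun y => δ * v δ y ω) '' {y : Ed d | ‖y‖ ≤ R / δ}) := by
      intro δ
      rw [Real.sInf_def]
      congr 2
      ext t
      simp only [Set.mem_neg, Set.mem_image]
      constructor
      · rintro ⟨y, hy, rfl⟩; exact ⟨y, hy, by simp⟩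
      · rintro ⟨y, hy, h⟩; exact ⟨y, hy, by rw [h]; simp⟩
    rw [neg_limsup_aux _ C ?_]
    · simp only [e3]
    · intro δ hδ
      have hne : ((fun y => -(δ * v δ y ω)) '' {y : Ed d | ‖y‖ ≤ R / δ}).Nonempty :=
        ⟨_, 0, by simpa using (by positivity : 0 ≤ R / δ), rfl⟩
      have hup : ∀ t ∈ (fun y => -(δ * v δ y ω)) '' {y : Ed d | ‖y‖ ≤ R / δ}, t ≤ C := by
        rintro _ ⟨y, -, rfl⟩
        have := abs_le.1 (hvbdd δ hδ ω y)
        simp only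
        linarith
      have hlow : ∀ t ∈ (fun y => -(δ * v δ y ω)) '' {y : Ed d | ‖y‖ ≤ R / δ}, -(C : ℝ) ≤ t := by
        rintro _ ⟨y, -, rfl⟩
        have := abs_le.1 (hvbdd δ hδ ω y)
        simp only
        linarith
      rw [abs_le]
      refine ⟨?_, csSup_le hne hup⟩
      obtain ⟨t, ht⟩ := hne
      exact (hlow t ht).trans (le_csSup ⟨C, hup⟩ ht)
  have hall := hhs.and hhS
  refine ⟨hs, -hS, ?_, ?_⟩
  · filter_upwards [hall] with ω hω
    exact ⟨hω.1.1, by rw [e1, hω.2.1]⟩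
  · obtain ⟨T, hTsub, hTm, hT0⟩ := exists_measurable_superset_of_null (ae_iff.1 hall)
    refine ⟨Tᶜ, hTm.compl, ?_, ?_⟩
    · rw [prob_compl_eq_one_iff hTm]; exact hT0
    · intro ω hω R hR
      have hω' := not_not.1 (fun hn => hω (hTsub hn))
      exact ⟨hω'.1.2 R hR, by rw [e2 ω R hR, ← hω'.2.2 R hR]⟩
end
end
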